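/- arXiv:2509.17076 — 3 statements merged into one kernel-verified Lean document; each statement's English description precedes it below -/
import Mathlib

section
/- Under Assumption 1, the en route reachable tube B(f,T,χᵢ,χ_f) = ⋃_{t ∈ [0,T]} R(t) is a compact subset of ℝⁿ. -/
open MeasureTheory Metric Set

noncomputable section

abbrev En (n : ℕ) : Type := EuclideanSpace ℝ (Fin n)

/-- An admissible control on `[a, b]`: measurable with values in the restraint set `Ω`. -/
def IsAdmissible {m : ℕ} (Ω : Set (En m)) (a b : ℝ) (u : ℝ → En m) : Prop :=
  Measurable u ∧ ∀ t ∈ Set.Icc a b, u t ∈ Ω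

/-- A response of the system `χ' = g(χ, u)` from `x₀` on `[a, b]` for the control `u`. -/
def IsResponse {n m : ℕ} (g : En n → En m → En n) (a b : ℝ) (x₀ : En n)
    (χ : ℝ → En n) (u : ℝ → En m) : Prop :=
  ContinuousOn χ (Set.Icc a b) ∧
  ∀ t ∈ Set.Icc a b, χ t = x₀ + ∫ s in a..t, g (χ s) (u s)

/-- The reachable set `G(g, t, x₀)`. -/
def Reach {n m : ℕ} (Ω : Set (En m)) (g : En n → En m → En n) (t : ℝ) (x₀ : En n) :
    Set (En n) :=
  {y | ∃ χ u, IsAdmissible Ω 0 t u ∧ IsResponse g 0 t x₀ χ u ∧ χ t = y}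

/-- Assumption 1: uniform bound on responses on `[0, T]` and convex velocity sets. -/
def Assumption1 {n m : ℕ} (Ω : Set (En m)) (f : En n → En m → En n) (T : ℝ)
    (χi : En n) : Prop :=
  (∃ M > 0, ∀ χ u, IsAdmissible Ω 0 T u → IsResponse f 0 T χi χ u →
      ∀ t ∈ Set.Icc 0 T, ‖χ t‖ < M) ∧
  ∀ x : En n, Convex ℝ {v | ∃ u ∈ Ω, f x u = v}

/-- `X(f, T, χi, χf)`: the responses of `f` on `[0, T]` from `χi` ending at `χf`. -/
def XSet {n m : ℕ} (Ω : Set (En m)) (f : En n → En m → En n) (T : ℝ)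
    (χi χf : En n) : Set (ℝ → En n) :=
  {χ | ∃ u, IsAdmissible Ω 0 T u ∧ IsResponse f 0 T χi χ u ∧ χ T = χf}

/-- The en route reachable set `R(t)`. -/
def EnRoute {n m : ℕ} (Ω : Set (En m)) (f : En n → En m → En n) (T : ℝ)
    (χi χf : En n) (t : ℝ) : Set (En n) :=
  {x | ∃ χ ∈ XSet Ω f T χi χf, χ t = x}

/-- The en route reachable tube `B(f, T, χi, χf)`. -/
def Tube {n m : ℕ} (Ω : Set (En m)) (f : En n → En m → En n) (T : ℝ)
    (χi χf : En n) : Set (En n) :=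
  ⋃ t ∈ Set.Icc 0 T, EnRoute Ω f T χi χf t

theorem aux_selection {n m : ℕ} (Ω : Set (En m)) (hΩ : IsCompact Ω) (hne : Ω.Nonempty)
    (g : ℝ → En m → En n) (hg : Continuous (fun q : ℝ × En m => g q.1 q.2))
    (v : ℝ → En n) (hv : Measurable v) (h : ∀ t, ∃ u ∈ Ω, g t u = v t) :
    ∃ u : ℝ → En m, Measurable u ∧ ∀ t, u t ∈ Ω ∧ g t (u t) = v t := by
  have : Nonempty Ω := hne.to_subtype
  have : CompactSpace Ω := isCompact_iff_compactSpace.1 hΩ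
  have : CompactSpace cantorSet := isCompact_iff_compactSpace.1 isCompact_cantorSet
  obtain ⟨φ, hφc, hφs⟩ := exists_nat_bool_continuous_surjective_of_compact Ω
  let ψ : cantorSet → Ω := fun τ => φ (cantorSetHomeomorphNatToBool τ)
  have hψc : Continuous ψ := hφc.comp cantorSetHomeomorphNatToBool.continuous
  have hψs : Function.Surjective ψ := hφs.comp cantorSetHomeomorphNatToBool.surjective
  have hgt : ∀ t, Continuous (fun τ : cantorSet => g t (ψ τ)) := fun t =>
    hg.comp (continuous_const.prodMk (continuous_subtype_val.comp hψc))
  have hgu : ∀ u, Measurable (fun t => g t u) := fun u =>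
    (hg.comp (continuous_id.prodMk continuous_const)).measurable
  let S : ℝ → Set ℝ := fun t => Subtype.val '' {τ : cantorSet | g t (ψ τ) = v t}
  have hSc : ∀ t, IsCompact (S t) := fun t =>
    ((isClosed_eq (hgt t) continuous_const).isCompact).image continuous_subtype_val
  have hSn : ∀ t, (S t).Nonempty := by
    intro t
    obtain ⟨u, hu, hgu⟩ := h t
    obtain ⟨τ, hτ⟩ := hψs ⟨u, hu⟩
    exact ⟨τ, τ, by simp [hτ, hgu], rfl⟩
  have hmem : ∀ t, sInf (S t) ∈ S t := fun t => (hSc t).sInf_mem (hSn t)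
  have hmc : ∀ t, sInf (S t) ∈ cantorSet := by
    intro t
    obtain ⟨τ, _, h2⟩ := hmem t
    rw [← h2]; exact τ.2
  have hmeas : Measurable (fun t => sInf (S t)) := by
    apply measurable_of_Iic
    intro c
    let Kc : Set cantorSet := {τ | (τ : ℝ) ≤ c}
    have hKc : IsCompact Kc := (isClosed_le continuous_subtype_val continuous_const).isCompact
    have : CompactSpace Kc := isCompact_iff_compactSpace.1 hKc
    obtain ⟨D, hDc, hDd⟩ := TopologicalSpace.exists_countable_dense Kc
    have hN : ∀ t, Continuous (fun d : Kc => ‖g t (ψ d) - v t‖) := fun t =>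
      (((hgt t).comp continuous_subtype_val).sub continuous_const).norm
    have : (fun t => sInf (S t)) ⁻¹' Iic c =
        ⋂ k : ℕ, ⋃ d ∈ D, {t | ‖g t (ψ d) - v t‖ < 1 / ((k : ℝ) + 1)} := by
      ext t
      simp only [mem_preimage, mem_Iic, mem_iInter, mem_iUnion, mem_ofPred_eq, exists_prop]
      constructor
      · intro hle k
        obtain ⟨τ, h1, h2⟩ := hmem t
        have hτ : τ ∈ Kc := by
          change (τ : ℝ) ≤ c
          rw [h2]; exact hle
        have hO : IsOpen {d : Kc | ‖g t (ψ d) - v t‖ < 1 / ((k : ℝ) + 1)} :=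
          isOpen_lt (hN t) continuous_const
        obtain ⟨d, hd1, hd2⟩ := hDd.inter_open_nonempty _ hO ⟨⟨τ, hτ⟩, by
          have h1' : g t (ψ τ) = v t := h1
          simp only [mem_ofPred_eq, h1', sub_self, norm_zero]
          positivity⟩
        exact ⟨d, hd2, hd1⟩
      · intro hk
        obtain ⟨d0, _, _⟩ := hk 0
        obtain ⟨d, _, hd⟩ := isCompact_univ.exists_isMinOn ⟨d0, mem_univ _⟩ (hN t).continuousOn
        have hz : ‖g t (ψ d) - v t‖ ≤ 0 := by
          by_contra hcon
          push Not at hcon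
          obtain ⟨k, hk'⟩ := exists_nat_one_div_lt hcon
          obtain ⟨e, _, he⟩ := hk k
          have := hd (mem_univ e)
          simp only [mem_ofPred_eq] at this
          linarith
        have hz' : g t (ψ d) = v t := sub_eq_zero.1 (norm_le_zero_iff.1 hz)
        exact (csInf_le (hSc t).bddBelow ⟨d, hz', rfl⟩).trans d.2
    rw [this]
    refine MeasurableSet.iInter fun k => MeasurableSet.biUnion hDc fun d _ => ?_
    exact measurableSet_lt (((hgu _).sub hv).norm) measurable_const
  refine ⟨fun t => ψ ⟨sInf (S t), hmc t⟩, ?_, ?_⟩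
  · exact (continuous_subtype_val.comp hψc).measurable.comp (hmeas.subtype_mk)
  · intro t
    refine ⟨(ψ _).2, ?_⟩
    obtain ⟨τ, h1, h2⟩ := hmem t
    have : (⟨sInf (S t), hmc t⟩ : cantorSet) = τ := Subtype.ext h2.symm
    change g t (ψ ⟨sInf (S t), hmc t⟩) = v t
    rw [this]; exact h1

theorem aux_ftc {n : ℕ} {K : NNReal} (χ : ℝ → En n) (h : LipschitzWith K χ) (a b : ℝ) :
    ∫ s in a..b, deriv χ s = χ b - χ a := by
  have hd : ∀ᵐ s, DifferentiableAt ℝ χ s := h.ae_differentiableAt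
  have hint : IntervalIntegrable (deriv χ) volume a b := by
    refine (intervalIntegrable_const (c := (K : ℝ))).mono_fun
      (stronglyMeasurable_deriv χ).aestronglyMeasurable ?_
    refine Filter.Eventually.of_forall fun s => ?_
    simpa using norm_deriv_le_of_lipschitz h
  ext i
  have e1 : (∫ s in a..b, deriv χ s) i = ∫ s in a..b, (deriv χ s) i :=
    ((EuclideanSpace.proj i : En n →L[ℝ] ℝ).intervalIntegral_comp_comm hint).symm
  have hL : LipschitzWith K (fun s => χ s i) := by
    apply LipschitzWith.of_dist_le_mul
    intro x y
    refine le_trans ?_ (h.dist_le_mul x y)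
    rw [dist_eq_norm, dist_eq_norm]
    exact PiLp.norm_apply_le (χ x - χ y) i
  have e2 := (hL.lipschitzOnWith (s := uIcc a b)).absolutelyContinuousOnInterval.integral_deriv_eq_sub
  rw [e1]
  simp only [PiLp.sub_apply]
  rw [← e2]
  apply intervalIntegral.integral_congr_ae
  filter_upwards [hd] with s hs _
  have := ((EuclideanSpace.proj i : En n →L[ℝ] ℝ).hasFDerivAt.comp_hasDerivAt s hs.hasDerivAt)
  exact this.deriv.symm

/-- Compact set of curves. -/
def KSet {n : ℕ} (V : En n → Set (En n)) (M L T : ℝ) (χi χf : En n) : Set (ℝ → En n) :=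
  {χ | (∀ s, ‖χ s‖ ≤ M) ∧ (∀ s t, dist (χ s) (χ t) ≤ L * |s - t|) ∧ χ 0 = χi ∧ χ T = χf ∧
    ∀ (C : Set (En n)) (x : En n) (ε t s : ℝ), IsClosed C → Convex ℝ C →
      (∀ y, dist y x < ε → ∀ v ∈ V y, v ∈ C) → 0 ≤ t → t < s → s ≤ T →
      dist (χ t) x + L * (s - t) < ε → (s - t)⁻¹ • (χ s - χ t) ∈ C}

theorem aux_compact {n : ℕ} (V : En n → Set (En n)) (M L T : ℝ) (χi χf : En n) :
    IsCompact (KSet V M L T χi χf) := by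
  have hc : IsCompact (Set.pi univ fun _ : ℝ => closedBall (0 : En n) M) :=
    isCompact_univ_pi fun _ => isCompact_closedBall _ _
  refine hc.of_isClosed_subset ?_ ?_
  · simp only [KSet, ofPred_and, ofPred_forall]
    have ha : ∀ s : ℝ, Continuous fun χ : ℝ → En n => χ s := fun s => continuous_apply s
    refine IsClosed.inter (isClosed_iInter fun s => isClosed_le (ha s).norm continuous_const) ?_
    refine IsClosed.inter (isClosed_iInter fun s => isClosed_iInter fun t =>
      isClosed_le ((ha s).dist (ha t)) continuous_const) ?_
    refine IsClosed.inter (isClosed_eq (ha _) continuous_const) ?_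
    refine IsClosed.inter (isClosed_eq (ha _) continuous_const) ?_
    refine isClosed_iInter fun C => isClosed_iInter fun x => isClosed_iInter fun ε =>
      isClosed_iInter fun t => isClosed_iInter fun s => isClosed_iInter fun hC =>
      isClosed_iInter fun _ => isClosed_iInter fun _ => isClosed_iInter fun _ =>
      isClosed_iInter fun _ => isClosed_iInter fun _ => ?_
    refine isClosed_imp ?_ ?_
    · exact isOpen_lt (((ha t).dist continuous_const).add continuous_const) continuous_const
    · exact hC.preimage (((ha s).sub (ha t)).const_smul ((s - t)⁻¹))
  · intro χ hχ s _
    simpa using hχ.1 s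

theorem aux_eval {n : ℕ} (V : En n → Set (En n)) (M L T : ℝ) (χi χf : En n) :
    ContinuousOn (fun p : ℝ × (ℝ → En n) => p.2 p.1) (univ ×ˢ KSet V M L T χi χf) := by
  rintro ⟨t0, χ0⟩ _
  rw [ContinuousWithinAt, tendsto_iff_dist_tendsto_zero]
  have h1 : Filter.Tendsto (fun p : ℝ × (ℝ → En n) => L * |p.1 - t0| + dist (p.2 t0) (χ0 t0))
      (nhdsWithin (t0, χ0) (univ ×ˢ KSet V M L T χi χf)) (nhds 0) := by
    have : Continuous (fun p : ℝ × (ℝ → En n) => L * |p.1 - t0| + dist (p.2 t0) (χ0 t0)) := by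
      fun_prop
    have h2 := this.tendsto (t0, χ0)
    simp only [sub_self, abs_zero, mul_zero, dist_self, add_zero] at h2
    exact h2.mono_left nhdsWithin_le_nhds
  refine squeeze_zero' (Filter.Eventually.of_forall fun _ => dist_nonneg) ?_ h1
  filter_upwards [self_mem_nhdsWithin] with p hp
  exact (dist_triangle _ (p.2 t0) _).trans (add_le_add (hp.2.2.1 _ _) le_rfl)

theorem aux_deriv_mem {n m : ℕ} (T M L : ℝ) (χi χf : En n)
    (f : En n → En m → En n) (hf : Continuous (fun q : En n × En m => f q.1 q.2))
    (Ω : Set (En m)) (hΩ : IsCompact Ω)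
    (hV : ∀ x : En n, Convex ℝ {v | ∃ u ∈ Ω, f x u = v})
    (χ : ℝ → En n) (hχ : χ ∈ KSet (fun x => {v | ∃ u ∈ Ω, f x u = v}) M L T χi χf)
    (t : ℝ) (ht : t ∈ Ioo 0 T) (hd : DifferentiableAt ℝ χ t) :
    ∃ u ∈ Ω, f (χ t) u = deriv χ t := by
  set V := {v | ∃ u ∈ Ω, f (χ t) u = v} with hVdef
  have hVc : IsCompact V :=
    hΩ.image (hf.comp (continuous_const.prodMk continuous_id) : Continuous fun u => f (χ t) u)
  suffices h : deriv χ t ∈ V from h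
  rw [← hVc.isClosed.closure_eq, closure_eq_iInter_cthickening]
  simp only [mem_iInter]
  intro δ hδ
  have h1 : ∀ᶠ y in nhds (χ t), ∀ u ∈ Ω, f y u ∈ cthickening δ V := by
    refine hΩ.eventually_forall_of_forall_eventually fun u hu => ?_
    have : f (χ t) u ∈ thickening δ V := self_subset_thickening hδ _ ⟨u, hu, rfl⟩
    have h2 := (hf.continuousAt (x := (χ t, u))).eventually (isOpen_thickening.mem_nhds this)
    exact h2.mono fun z hz => thickening_subset_cthickening _ _ hz
  obtain ⟨ε, hε, h2⟩ := Metric.eventually_nhds_iff.1 h1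
  have hs := hasDerivAt_iff_tendsto_slope.1 hd.hasDerivAt
  have hs' : Filter.Tendsto (slope χ t) (nhdsWithin t (Ioi t)) (nhds (deriv χ t)) :=
    hs.mono_left (nhdsWithin_mono _ fun x hx => ne_of_gt hx)
  refine isClosed_cthickening.mem_of_tendsto hs' ?_
  have e1 : ∀ᶠ s in nhdsWithin t (Ioi t), s < T :=
    nhdsWithin_le_nhds (Iio_mem_nhds ht.2)
  have e2 : ∀ᶠ s in nhdsWithin t (Ioi t), L * (s - t) < ε := by
    have : Continuous fun s : ℝ => L * (s - t) := by fun_prop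
    exact nhdsWithin_le_nhds ((this.continuousAt (x := t)).eventually
      (Iio_mem_nhds (by simpa using hε)))
  filter_upwards [e1, e2, self_mem_nhdsWithin] with s hs1 hs2 hs3
  have := hχ.2.2.2.2 (cthickening δ V) (χ t) ε t s isClosed_cthickening ((hV _).cthickening δ)
    (by
      rintro y hy v ⟨u, hu, rfl⟩
      exact h2 hy u hu) ht.1.le hs3 hs1.le (by simpa using hs2)
  simpa [slope, vsub_eq_sub] using this

theorem aux_response {n m : ℕ} (T M L : ℝ) (hL : 0 ≤ L) (χi χf : En n)
    (f : En n → En m → En n) (hf : Continuous (fun q : En n × En m => f q.1 q.2))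
    (Ω : Set (En m)) (hΩ : IsCompact Ω) (hne : Ω.Nonempty)
    (hV : ∀ x : En n, Convex ℝ {v | ∃ u ∈ Ω, f x u = v})
    (χ : ℝ → En n) (hχ : χ ∈ KSet (fun x => {v | ∃ u ∈ Ω, f x u = v}) M L T χi χf) :
    χ ∈ XSet Ω f T χi χf := by
  have hlip : LipschitzWith ⟨L, hL⟩ χ := LipschitzWith.of_dist_le_mul fun x y => by
    simpa [Real.dist_eq] using! hχ.2.1 x y
  have hχc := hlip.continuous
  obtain ⟨u0, hu0⟩ := hne
  classical
  let G : Set ℝ := Ioo 0 T ∩ {t | DifferentiableAt ℝ χ t}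
  have hG : MeasurableSet G := measurableSet_Ioo.inter (measurableSet_of_differentiableAt ℝ χ)
  let v : ℝ → En n := G.piecewise (deriv χ) (fun t => f (χ t) u0)
  have hv : Measurable v := Measurable.piecewise hG (measurable_deriv χ)
    (hf.comp (hχc.prodMk continuous_const)).measurable
  obtain ⟨u, hum, hu⟩ := aux_selection Ω hΩ ⟨u0, hu0⟩ (fun t w => f (χ t) w)
    (hf.comp ((hχc.comp continuous_fst).prodMk continuous_snd)) v hv (by
      intro t
      by_cases ht : t ∈ G
      · obtain ⟨w, hw, hw'⟩ := aux_deriv_mem T M L χi χf f hf Ω hΩ hV χ hχ t ht.1 ht.2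
        exact ⟨w, hw, by simp [v, ht, hw']⟩
      · exact ⟨u0, hu0, by simp [v, ht]⟩)
  refine ⟨u, ⟨hum, fun t _ => (hu t).1⟩, ⟨hχc.continuousOn, ?_⟩, hχ.2.2.2.1⟩
  intro t ht
  have : ∫ s in (0:ℝ)..t, f (χ s) (u s) = ∫ s in (0:ℝ)..t, deriv χ s := by
    apply intervalIntegral.integral_congr_ae
    have hd : ∀ᵐ s, DifferentiableAt ℝ χ s := hlip.ae_differentiableAt
    filter_upwards [hd, Measure.ae_ne volume T] with s hs hsT hst
    rw [uIoc_of_le ht.1] at hst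
    have hsG : s ∈ G := ⟨⟨hst.1, lt_of_le_of_ne (hst.2.trans ht.2) hsT⟩, hs⟩
    rw [(hu s).2]
    simp [v, hsG]
  rw [this, aux_ftc χ hlip, hχ.2.2.1]
  abel

theorem aux_mem {n m : ℕ} (T M L : ℝ) (hT : 0 < T) (hL : 0 ≤ L) (χi χf : En n)
    (f : En n → En m → En n) (hf : Continuous (fun q : En n × En m => f q.1 q.2))
    (Ω : Set (En m))
    (hM : ∀ χ u, IsAdmissible Ω 0 T u → IsResponse f 0 T χi χ u →
      ∀ t ∈ Set.Icc 0 T, ‖χ t‖ < M)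
    (hLb : ∀ x u, ‖x‖ ≤ M → u ∈ Ω → ‖f x u‖ ≤ L)
    (χ : ℝ → En n) (hχ : χ ∈ XSet Ω f T χi χf) :
    IccExtend hT.le ((Icc 0 T).domRestrict χ) ∈
      KSet (fun x => {v | ∃ u ∈ Ω, f x u = v}) M L T χi χf := by
  obtain ⟨u, hu, hr, hT'⟩ := hχ
  have hb := hM χ u hu hr
  have h0T : (0:ℝ) ∈ Icc 0 T := ⟨le_rfl, hT.le⟩
  have hTT : T ∈ Icc 0 T := ⟨hT.le, le_rfl⟩
  have hext : ∀ s (hs : s ∈ Icc 0 T), IccExtend hT.le ((Icc 0 T).domRestrict χ) s = χ s :=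
    fun s hs => IccExtend_of_mem _ _ hs
  have hint0 : IntegrableOn (fun s => f (χ s) (u s)) (Icc 0 T) := by
    refine Integrable.of_bound (C := L) ?_ ?_
    · have h1 : AEMeasurable χ (volume.restrict (Icc 0 T)) := hr.1.aemeasurable measurableSet_Icc
      exact (hf.measurable.comp_aemeasurable (h1.prodMk hu.1.aemeasurable)).aestronglyMeasurable
    · refine (ae_restrict_iff' measurableSet_Icc).2 (Filter.Eventually.of_forall fun s hs => ?_)
      exact hLb _ _ (hb s hs).le (hu.2 s hs)
  have hint : ∀ a ∈ Icc 0 T, ∀ b ∈ Icc 0 T,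
      IntervalIntegrable (fun s => f (χ s) (u s)) volume a b := by
    intro a ha b hb
    refine (hint0.mono_set ?_).intervalIntegrable
    exact (convex_Icc 0 T).ordConnected.uIcc_subset ha hb
  have hdiff : ∀ a ∈ Icc 0 T, ∀ b ∈ Icc 0 T, χ b - χ a = ∫ s in a..b, f (χ s) (u s) := by
    intro a ha b hb
    rw [hr.2 a ha, hr.2 b hb, add_sub_add_left_eq_sub,
      intervalIntegral.integral_interval_sub_left (hint _ h0T _ hb) (hint _ h0T _ ha)]
  have hlip : ∀ a ∈ Icc 0 T, ∀ b ∈ Icc 0 T, dist (χ b) (χ a) ≤ L * |b - a| := by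
    intro a ha b hb'
    rw [dist_eq_norm, hdiff a ha b hb']
    refine intervalIntegral.norm_integral_le_of_norm_le_const fun s hs => ?_
    have hs' : s ∈ Icc 0 T :=
      (convex_Icc 0 T).ordConnected.uIcc_subset ha hb' (uIoc_subset_uIcc hs)
    exact hLb _ _ (hb s hs').le (hu.2 s hs')
  refine ⟨?_, ?_, ?_, ?_, ?_⟩
  · intro s
    exact (hb _ (projIcc 0 T hT.le s).2).le
  · intro s t
    refine (hlip _ (projIcc 0 T hT.le t).2 _ (projIcc 0 T hT.le s).2).trans ?_
    exact mul_le_mul_of_nonneg_left (abs_projIcc_sub_projIcc hT.le) hL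
  · rw [hext 0 h0T, hr.2 0 h0T]; simp
  · rw [hext T hTT, hT']
  · intro C x ε t s hC hCv hin ht hts hsT hd
    have htm : t ∈ Icc 0 T := ⟨ht, hts.le.trans hsT⟩
    have hsm : s ∈ Icc 0 T := ⟨ht.trans hts.le, hsT⟩
    rw [hext t htm] at hd ⊢
    rw [hext s hsm, hdiff t htm s hsm, ← interval_average_eq, uIoc_of_le hts.le]
    have hsub : Ioc t s ⊆ Icc 0 T := fun r hr => ⟨ht.trans hr.1.le, hr.2.trans hsT⟩
    refine hCv.set_average_mem hC (by simp [hts]) (by simp) ?_ (hint0.mono_set hsub)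
    refine (ae_restrict_iff' measurableSet_Ioc).2 (Filter.Eventually.of_forall fun r hr => ?_)
    refine hin (χ r) ?_ _ ⟨u r, hu.2 r (hsub hr), rfl⟩
    refine lt_of_le_of_lt ((dist_triangle _ (χ t) _).trans ?_) hd
    rw [add_comm]
    refine add_le_add le_rfl ((hlip t htm r (hsub hr)).trans ?_)
    refine mul_le_mul_of_nonneg_left ?_ hL
    rw [abs_of_pos (sub_pos.2 hr.1)]
    linarith [hr.2]

/-- Under Assumption 1, the en route reachable tube
`B(f,T,χi,χf) = ⋃_{t ∈ [0,T]} R(t)` is compact. -/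
theorem tube_isCompact
    {n m : ℕ} (T : ℝ) (hT : 0 < T) (χi χf : En n)
    (f : En n → En m → En n) (hf : ContDiff ℝ 1 (fun q : En n × En m => f q.1 q.2))
    (Ω : Set (En m)) (hΩ : IsCompact Ω)
    (hA : Assumption1 Ω f T χi) :
    IsCompact (Tube Ω f T χi χf) := by
  rcases Ω.eq_empty_or_nonempty with he | hne
  · have : Tube Ω f T χi χf = ∅ := by
      ext x
      simp only [Tube, EnRoute, XSet, mem_iUnion, mem_ofPred_eq, mem_empty_iff_false, iff_false]
      rintro ⟨t, ht, χ, ⟨u, hu, -⟩, -⟩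
      have := hu.2 t ht
      simp [he] at this
    rw [this]; exact isCompact_empty
  obtain ⟨⟨M, hM0, hM⟩, hV⟩ := hA
  have hfc : Continuous (fun q : En n × En m => f q.1 q.2) := hf.continuous
  obtain ⟨L0, hL0⟩ := ((isCompact_closedBall (0 : En n) M).prod hΩ).exists_bound_of_continuousOn
    hfc.continuousOn
  have hL : 0 ≤ max L0 0 := le_max_right _ _
  have hLb : ∀ x u, ‖x‖ ≤ M → u ∈ Ω → ‖f x u‖ ≤ max L0 0 := fun x u hx hu =>
    (hL0 (x, u) ⟨by simpa using hx, hu⟩).trans (le_max_left _ _)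
  have key : Tube Ω f T χi χf = (fun p : ℝ × (ℝ → En n) => p.2 p.1) ''
      (Icc 0 T ×ˢ KSet (fun x => {v | ∃ u ∈ Ω, f x u = v}) M (max L0 0) T χi χf) := by
    ext x
    simp only [Tube, EnRoute, mem_iUnion, mem_ofPred_eq, mem_image, mem_prod, Prod.exists]
    constructor
    · rintro ⟨t, ht, χ, hχ, rfl⟩
      exact ⟨t, _, ⟨ht, aux_mem T M _ hT hL χi χf f hfc Ω hM hLb χ hχ⟩, IccExtend_of_mem _ _ ht⟩
    · rintro ⟨t, χ, ⟨ht, hχ⟩, rfl⟩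
      exact ⟨t, ht, χ, aux_response T M _ hL χi χf f hfc Ω hΩ hne hV χ hχ, rfl⟩
  rw [key]
  exact (isCompact_Icc.prod (aux_compact _ _ _ _ _ _)).image_of_continuousOn
    ((aux_eval _ _ _ _ _ _).mono (prod_mono (subset_univ _) le_rfl))
end
end

section
/- Under Assumption 1, let X₁ be the set of responses of f from χᵢ on [0,T] and X₂ the set of responses of −f from χ_f on [0,T]. Suppose A₁ and A₂ are maps from [0,T] to the nonempty compact subsets of ℝⁿ, continuous with respect to the Hausdorff distance, such that: (i) bd(G(f,t,χᵢ)) ⊆ A₁(t) ⊆ G(f,t,χᵢ) and bd(G(−f,T−t,χ_f)) ⊆ A₂(t) ⊆ G(−f,T−t,χ_f) for all t ∈ [0,T]; (ii) for every χ₁ ∈ X₁ and t' ∈ [0,T] with χ₁(t') ∈ A₁(t'), there exists an admissible control on [t',T] whose response χ̃ on [t',T] with χ̃(t') = χ₁(t') satisfies χ̃(t) ∈ A₁(t) for all t ∈ [t',T]; and for every χ₂ ∈ X₂ and t' ∈ [0,T] with χ₂(t') ∈ A₂(T−t'), there exists an admissible control on [t',T] whose response (of −f) χ̃ on [t',T]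 with χ̃(t') = χ₂(t') satisfies χ̃(t) ∈ A₂(T−t) for all t ∈ [t',T]. Then for every x ∈ B(f,T,χᵢ,χ_f) there exist τ ∈ [0,T], χ₁ ∈ X₁, and χ₂ ∈ X₂ such that χ₁(τ) = χ₂(T−τ) ∈ A₁(τ) ∩ A₂(τ), and x belongs to χ₁([0,τ]) or to χ₂([0,T−τ]). -/
open MeasureTheory Metric Set

noncomputable section

open Filter Topology in
theorem ball_subset_of_frontier {E : Type*} [NormedAddCommGroup E] [NormedSpace ℝ E] {G A : Set E} (hcl : IsClosed G)
    (hF : frontier G ⊆ A) {p w : E} {r : ℝ} (hr : r < infDist p A) (hw : w ∈ G)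
    (hwb : w ∈ ball p r) : ball p r ⊆ G := by
  have hd : ∀ z ∈ ball p r, z ∈ G → z ∈ interior G := by
    intro z hz hzG
    by_contra hn
    have : z ∈ A := hF ⟨subset_closure hzG, hn⟩
    have h1 := infDist_le_dist_of_mem (x := p) this
    rw [mem_ball, dist_comm] at hz
    linarith
  have hpre : IsPreconnected (ball p r) := (convex_ball p r).isPreconnected
  refine (hpre.subset_of_closure_inter_subset isOpen_interior ⟨w, hwb, hd w hwb hw⟩ ?_).trans
    interior_subset
  rintro z ⟨hz1, hz2⟩
  exact hd z hz2 (closure_minimal interior_subset hcl hz1)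

open Filter Topology in
theorem propagate {E : Type*} [NormedAddCommGroup E] [NormedSpace ℝ E] {a b C : ℝ}
    {G1 G2 : ℝ → Set E} {A1 A2 : ℝ → TopologicalSpace.NonemptyCompacts E} {y : ℝ → E}
    (hy : ContinuousOn y (Icc a b))
    (hA1 : ContinuousOn A1 (Icc a b)) (hA2 : ContinuousOn A2 (Icc a b))
    (hF1 : ∀ t ∈ Icc a b, frontier (G1 t) ⊆ A1 t) (hF2 : ∀ t ∈ Icc a b, frontier (G2 t) ⊆ A2 t)
    (hc1 : ∀ t ∈ Icc a b, IsClosed (G1 t)) (hc2 : ∀ t ∈ Icc a b, IsClosed (G2 t))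
    (hL : ∀ t ∈ Icc a b, ∀ z, z ∈ G1 t → z ∈ G2 t → ∀ s ∈ Icc a b,
      ∃ w, w ∈ G1 s ∧ w ∈ G2 s ∧ dist w z ≤ C * |s - t|)
    {t0 : ℝ} (ht0 : t0 ∈ Icc a b) (h01 : y t0 ∈ G1 t0) (h02 : y t0 ∈ G2 t0)
    (h1 : ∀ t ∈ Icc a b, y t ∈ G1 t → y t ∈ G2 t → (y t ∉ A1 t ∨ ∀ s ∈ Icc a b, y s ∈ G1 s))
    (h2 : ∀ t ∈ Icc a b, y t ∈ G1 t → y t ∈ G2 t → (y t ∉ A2 t ∨ ∀ s ∈ Icc a b, y s ∈ G2 s)) :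
    ∀ t ∈ Icc a b, y t ∈ G1 t ∧ y t ∈ G2 t := by
  let S : Set (Icc a b) := {t | y t ∈ G1 t ∧ y t ∈ G2 t}
  have hy' : Continuous (fun t : Icc a b => y t) := continuousOn_iff_continuous_domRestrict.1 hy
  have hA1' : Continuous (fun t : Icc a b => A1 t) := continuousOn_iff_continuous_domRestrict.1 hA1
  have hA2' : Continuous (fun t : Icc a b => A2 t) := continuousOn_iff_continuous_domRestrict.1 hA2
  have hφ : ∀ s : Icc a b, ∀ ε > 0, ∀ᶠ t : Icc a b in 𝓝 s,
      dist (y t) (y s) < ε ∧ C * |(s : ℝ) - t| < ε ∧ C * |(t : ℝ) - s| < ε := by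
    intro s ε hε
    have e1 : Continuous (fun t : Icc a b => dist (y t) (y s)) := hy'.dist continuous_const
    have e2 : Continuous (fun t : Icc a b => C * |(s : ℝ) - t|) := by fun_prop
    have e3 : Continuous (fun t : Icc a b => C * |(t : ℝ) - s|) := by fun_prop
    refine (e1.continuousAt.eventually_lt continuousAt_const (by simpa using hε)).and
      ((e2.continuousAt.eventually_lt continuousAt_const (by simpa using hε)).and
      (e3.continuousAt.eventually_lt continuousAt_const (by simpa using hε)))
  have hclosed : IsClosed S := by
    rw [← closure_subset_iff_isClosed]
    intro s hs
    have key : ∀ ε > 0, ∃ w, w ∈ G1 s ∧ w ∈ G2 s ∧ dist (y s) w < ε := by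
      intro ε hε
      obtain ⟨t, ⟨q1, q2, q3⟩, ht1, ht2⟩ :=
        mem_closure_iff_nhds.1 hs _ (hφ s (ε / 2) (by linarith))
      obtain ⟨w, hw1, hw2, hw⟩ := hL t t.2 (y t) ht1 ht2 s s.2
      refine ⟨w, hw1, hw2, ?_⟩
      have := dist_triangle w (y t) (y s)
      rw [dist_comm]
      linarith
    constructor
    · refine (hc1 s s.2).closure_subset (Metric.mem_closure_iff.2 fun ε hε => ?_)
      obtain ⟨w, w1, w2, w3⟩ := key ε hε
      exact ⟨w, w1, w3⟩
    · refine (hc2 s s.2).closure_subset (Metric.mem_closure_iff.2 fun ε hε => ?_)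
      obtain ⟨w, w1, w2, w3⟩ := key ε hε
      exact ⟨w, w2, w3⟩
  have hop : ∀ (G : ℝ → Set E) (A : ℝ → TopologicalSpace.NonemptyCompacts E),
      (∀ t s, G1 t ∩ G2 t ⊆ s → G t ⊆ s → True) → Continuous (fun t : Icc a b => A t) →
      (∀ t ∈ Icc a b, frontier (G t) ⊆ A t) → (∀ t ∈ Icc a b, IsClosed (G t)) →
      (∀ t, G1 t ∩ G2 t ⊆ G t) → ∀ s : Icc a b, s ∈ S → y s ∉ A s →
      ∀ᶠ t : Icc a b in 𝓝 s, y t ∈ G t := by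
    intro G A _ hAc hF hc hsub s hs hn
    have hpos : 0 < infDist (y s) (A s : Set E) :=
      ((A s).isCompact.isClosed.notMem_iff_infDist_pos (A s).nonempty).1 hn
    set r := infDist (y s) (A s : Set E) / 2 with hr
    have c1 : Continuous (fun t : Icc a b => infDist (y s) (A t : Set E)) :=
      (Metric.lipschitz_infDist_set (y s)).continuous.comp hAc
    have e1 : ∀ᶠ t : Icc a b in 𝓝 s, r < infDist (y s) (A t : Set E) :=
      continuousAt_const.eventually_lt c1.continuousAt (by linarith)
    filter_upwards [e1, hφ s r (by linarith)] with t ht1 ht2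
    obtain ⟨w, w1, w2, w3⟩ := hL s s.2 (y s) hs.1 hs.2 t t.2
    exact ball_subset_of_frontier (hc t t.2) (hF t t.2) ht1 (hsub t ⟨w1, w2⟩)
      (mem_ball.2 (by linarith [ht2.2.2])) (mem_ball.2 ht2.1)
  have hopen : IsOpen S := by
    rw [isOpen_iff_mem_nhds]
    intro s hs
    have g1 : ∀ᶠ t : Icc a b in 𝓝 s, y t ∈ G1 t := by
      rcases h1 s s.2 hs.1 hs.2 with h | h
      · exact hop G1 A1 (fun _ _ _ _ => trivial) hA1' hF1 hc1 (fun _ => inter_subset_left) s hs h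
      · exact Eventually.of_forall fun t => h t t.2
    have g2 : ∀ᶠ t : Icc a b in 𝓝 s, y t ∈ G2 t := by
      rcases h2 s s.2 hs.1 hs.2 with h | h
      · exact hop G2 A2 (fun _ _ _ _ => trivial) hA2' hF2 hc2 (fun _ => inter_subset_right) s hs h
      · exact Eventually.of_forall fun t => h t t.2
    exact g1.and g2
  have : PreconnectedSpace (Icc a b) := isPreconnected_iff_preconnectedSpace.1 isPreconnected_Icc
  have hu : S = univ := IsClopen.eq_univ ⟨hclosed, hopen⟩ ⟨⟨t0, ht0⟩, h01, h02⟩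
  intro t ht
  have : (⟨t, ht⟩ : Icc a b) ∈ S := hu ▸ mem_univ _
  exact this

/-- Two-point form of a controlled trajectory. -/
def Tr {n m : ℕ} (Ω : Set (En m)) (g : En n → En m → En n) (a b : ℝ)
    (χ : ℝ → En n) (u : ℝ → En m) : Prop :=
  IsAdmissible Ω a b u ∧ ContinuousOn χ (Icc a b) ∧
  ∀ s ∈ Icc a b, ∀ t ∈ Icc a b, χ t - χ s = ∫ r in s..t, g (χ r) (u r)

section
variable {n m : ℕ} {Ω : Set (En m)} {g : En n → En m → En n}

theorem integrableOn_traj (hg : Continuous (fun q : En n × En m => g q.1 q.2)) (hΩ : IsCompact Ω)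
    {a b : ℝ} {χ : ℝ → En n} {u : ℝ → En m} (hu : IsAdmissible Ω a b u)
    (hχ : ContinuousOn χ (Icc a b)) : IntegrableOn (fun r => g (χ r) (u r)) (Icc a b) := by
  have hK : IsCompact ((χ '' Icc a b) ×ˢ Ω) := (isCompact_Icc.image_of_continuousOn hχ).prod hΩ
  obtain ⟨C, hC⟩ := hK.exists_bound_of_continuousOn hg.continuousOn
  have hm : AEStronglyMeasurable (fun r => g (χ r) (u r)) (volume.restrict (Icc a b)) :=
    hg.comp_aestronglyMeasurable
      ((hχ.aestronglyMeasurable measurableSet_Icc).prodMk hu.1.aestronglyMeasurable)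
  refine IntegrableOn.of_bound (by simp) hm C ?_
  filter_upwards [ae_restrict_mem measurableSet_Icc] with r hr
  exact hC (χ r, u r) ⟨mem_image_of_mem _ hr, hu.2 r hr⟩

theorem Tr.of_resp (hg : Continuous (fun q : En n × En m => g q.1 q.2)) (hΩ : IsCompact Ω)
    {a b : ℝ} {χ : ℝ → En n} {u : ℝ → En m} {x₀ : En n} (hu : IsAdmissible Ω a b u)
    (h : IsResponse g a b x₀ χ u) : Tr Ω g a b χ u := by
  refine ⟨hu, h.1, fun s hs t ht => ?_⟩
  have hi := integrableOn_traj hg hΩ hu h.1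
  have hab : a ≤ b := hs.1.trans hs.2
  have ha : a ∈ Icc a b := ⟨le_rfl, hab⟩
  have key : ∀ s ∈ Icc a b, ∀ t ∈ Icc a b,
      IntervalIntegrable (fun r => g (χ r) (u r)) volume s t := by
    intro s hs t ht
    exact (hi.mono_set (uIcc_subset_Icc hs ht)).intervalIntegrable
  rw [h.2 t ht, h.2 s hs, add_sub_add_left_eq_sub,
    intervalIntegral.integral_interval_sub_left (key a ha t ht) (key a ha s hs)]

theorem resp_init {a b : ℝ} (hab : a ≤ b) {χ : ℝ → En n} {u : ℝ → En m} {x₀ : En n}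
    (h : IsResponse g a b x₀ χ u) : χ a = x₀ := by
  have := h.2 a ⟨le_rfl, hab⟩
  simpa using this

theorem Tr.resp {a b : ℝ} {χ : ℝ → En n} {u : ℝ → En m} (h : Tr Ω g a b χ u) :
    IsResponse g a b (χ a) χ u := by
  refine ⟨h.2.1, fun t ht => ?_⟩
  rw [← h.2.2 a ⟨le_rfl, ht.1.trans ht.2⟩ t ht]; abel

theorem Tr.mono {a b a' b' : ℝ} {χ : ℝ → En n} {u : ℝ → En m} (h : Tr Ω g a b χ u)
    (hs : Icc a' b' ⊆ Icc a b) : Tr Ω g a' b' χ u :=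
  ⟨⟨h.1.1, fun t ht => h.1.2 t (hs ht)⟩, h.2.1.mono hs,
    fun s hs' t ht => h.2.2 s (hs hs') t (hs ht)⟩

theorem Tr.glue (hg : Continuous (fun q : En n × En m => g q.1 q.2)) (hΩ : IsCompact Ω)
    {a b c : ℝ} (hab : a ≤ b) (hbc : b ≤ c) {χ χ' : ℝ → En n} {u u' : ℝ → En m}
    (h : Tr Ω g a b χ u) (h' : Tr Ω g b c χ' u') (hb : χ b = χ' b) :
    Tr Ω g a c (fun r => if r ≤ b then χ r else χ' r) (fun r => if r ≤ b then u r else u' r) := by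
  have hadm : IsAdmissible Ω a c (fun r => if r ≤ b then u r else u' r) := by
    refine ⟨Measurable.ite measurableSet_Iic h.1.1 h'.1.1, fun t ht => ?_⟩
    by_cases htb : t ≤ b
    · simpa [htb] using h.1.2 t ⟨ht.1, htb⟩
    · simpa [htb] using h'.1.2 t ⟨(not_le.1 htb).le, ht.2⟩
  have hcont : ContinuousOn (fun r => if r ≤ b then χ r else χ' r) (Icc a c) := by
    rw [← Icc_union_Icc_eq_Icc hab hbc]
    refine ContinuousOn.union_of_isClosed (h.2.1.congr fun t ht => ?_)
      (h'.2.1.congr fun t ht => ?_) isClosed_Icc isClosed_Icc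
    · simp [ht.2]
    · by_cases htb : t ≤ b
      · have : t = b := le_antisymm htb ht.1
        simp [this, hb]
      · simp [htb]
  have hi := integrableOn_traj hg hΩ hadm hcont
  refine Tr.of_resp (x₀ := χ a) hg hΩ hadm ⟨hcont, fun t ht => ?_⟩
  have p1 : ∀ t ∈ Icc a b, (∫ s in a..t, g (if s ≤ b then χ s else χ' s)
      (if s ≤ b then u s else u' s)) = ∫ s in a..t, g (χ s) (u s) := by
    intro t ht
    refine intervalIntegral.integral_congr_ae (Filter.Eventually.of_forall fun s hs => ?_)
    rw [uIoc_of_le ht.1] at hs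
    simp [hs.2.trans ht.2]
  by_cases htb : t ≤ b
  · have e := p1 t ⟨ht.1, htb⟩
    simp only [htb, if_true]
    rw [e, ← h.2.2 a ⟨le_rfl, hab⟩ t ⟨ht.1, htb⟩]; abel
  · have hbt := (not_le.1 htb).le
    have p2 : (∫ s in b..t, g (if s ≤ b then χ s else χ' s)
      (if s ≤ b then u s else u' s)) = ∫ s in b..t, g (χ' s) (u' s) := by
      refine intervalIntegral.integral_congr_ae (Filter.Eventually.of_forall fun s hs => ?_)
      rw [uIoc_of_le hbt] at hs
      simp [not_le.2 hs.1]
    have ia : IntervalIntegrable (fun s => g (if s ≤ b then χ s else χ' s)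
      (if s ≤ b then u s else u' s)) volume a b :=
      (hi.mono_set (uIcc_subset_Icc ⟨le_rfl, hab.trans hbc⟩ ⟨hab, hbc⟩)).intervalIntegrable
    have ib : IntervalIntegrable (fun s => g (if s ≤ b then χ s else χ' s)
      (if s ≤ b then u s else u' s)) volume b t :=
      (hi.mono_set (uIcc_subset_Icc ⟨hab, hbc⟩ ht)).intervalIntegrable
    simp only [htb, if_false]
    rw [← intervalIntegral.integral_add_adjacent_intervals ia ib, p1 b ⟨hab, le_rfl⟩, p2,
      ← h.2.2 a ⟨le_rfl, hab⟩ b ⟨hab, le_rfl⟩, ← h'.2.2 b ⟨le_rfl, hbc⟩ t ⟨hbt, ht.2⟩, hb]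
    abel

theorem Tr.rev {a b : ℝ} (T : ℝ) {χ : ℝ → En n} {u : ℝ → En m} (h : Tr Ω g a b χ u) :
    Tr Ω (fun x w => -g x w) (T - b) (T - a) (fun r => χ (T - r)) (fun r => u (T - r)) := by
  have hm : ∀ t ∈ Icc (T - b) (T - a), T - t ∈ Icc a b := fun t ht =>
    ⟨by linarith [ht.2], by linarith [ht.1]⟩
  refine ⟨⟨h.1.1.comp (measurable_const.sub measurable_id), fun t ht => h.1.2 _ (hm t ht)⟩,
    h.2.1.comp (by fun_prop) hm, fun s hs t ht => ?_⟩
  rw [h.2.2 _ (hm s hs) _ (hm t ht), intervalIntegral.integral_neg,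
    intervalIntegral.integral_comp_sub_left (fun r => g (χ r) (u r)) T,
    intervalIntegral.integral_symm]

end

/-- **main theorem.** Under Assumption 1, suppose `A₁, A₂` are continuous
nonempty-compact-valued maps squeezed between the boundary of and the full reachable
sets of `f` from `χi` (forward) and of `−f` from `χf` (backward), and trajectories
touching `A₁` (resp. `A₂`) can be continued staying inside `A₁` (resp. `A₂`). Then every
point `x` of the en route reachable tube is passed through by a concatenation of some
`χ₁ ∈ X₁` and `χ₂ ∈ X₂` meeting in `A₁(τ) ∩ A₂(τ)`. -/
theorem main_theorem
    {n m : ℕ} (T : ℝ) (hT : 0 < T) (χi χf : En n)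
    (f : En n → En m → En n) (hf : ContDiff ℝ 1 (fun q : En n × En m => f q.1 q.2))
    (Ω : Set (En m)) (hΩ : IsCompact Ω)
    (hA : Assumption1 Ω f T χi)
    (A₁ A₂ : ℝ → TopologicalSpace.NonemptyCompacts (En n))
    (hA₁c : ContinuousOn A₁ (Set.Icc 0 T)) (hA₂c : ContinuousOn A₂ (Set.Icc 0 T))
    (hA₁ : ∀ t ∈ Set.Icc 0 T, frontier (Reach Ω f t χi) ⊆ (A₁ t : Set (En n)) ∧
      (A₁ t : Set (En n)) ⊆ Reach Ω f t χi)
    (hA₂ : ∀ t ∈ Set.Icc 0 T,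
      frontier (Reach Ω (fun x w => -f x w) (T - t) χf) ⊆ (A₂ t : Set (En n)) ∧
      (A₂ t : Set (En n)) ⊆ Reach Ω (fun x w => -f x w) (T - t) χf)
    (hext₁ : ∀ χ₁ u₁, IsAdmissible Ω 0 T u₁ → IsResponse f 0 T χi χ₁ u₁ →
      ∀ t' ∈ Set.Icc 0 T, χ₁ t' ∈ (A₁ t' : Set (En n)) →
        ∃ χ' u', IsAdmissible Ω t' T u' ∧ IsResponse f t' T (χ₁ t') χ' u' ∧
          ∀ t ∈ Set.Icc t' T, χ' t ∈ (A₁ t : Set (En n)))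
    (hext₂ : ∀ χ₂ u₂, IsAdmissible Ω 0 T u₂ →
      IsResponse (fun x w => -f x w) 0 T χf χ₂ u₂ →
      ∀ t' ∈ Set.Icc 0 T, χ₂ t' ∈ (A₂ (T - t') : Set (En n)) →
        ∃ χ' u', IsAdmissible Ω t' T u' ∧
          IsResponse (fun x w => -f x w) t' T (χ₂ t') χ' u' ∧
          ∀ t ∈ Set.Icc t' T, χ' t ∈ (A₂ (T - t) : Set (En n))) :
    ∀ x ∈ Tube Ω f T χi χf, ∃ τ ∈ Set.Icc 0 T,
      ∃ χ₁ u₁, IsAdmissible Ω 0 T u₁ ∧ IsResponse f 0 T χi χ₁ u₁ ∧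
      ∃ χ₂ u₂, IsAdmissible Ω 0 T u₂ ∧
        IsResponse (fun x w => -f x w) 0 T χf χ₂ u₂ ∧
        χ₁ τ = χ₂ (T - τ) ∧
        χ₁ τ ∈ (A₁ τ : Set (En n)) ∩ (A₂ τ : Set (En n)) ∧
        (x ∈ χ₁ '' Set.Icc 0 τ ∨ x ∈ χ₂ '' Set.Icc 0 (T - τ)) := by
  have hfc : Continuous (fun q : En n × En m => f q.1 q.2) := hf.continuous
  have hgc : Continuous (fun q : En n × En m => -f q.1 q.2) := hfc.neg
  obtain ⟨⟨M, hM0, hM⟩, -⟩ := hA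
  have hK : IsCompact ((closedBall (0 : En n) M) ×ˢ Ω) := (isCompact_closedBall 0 M).prod hΩ
  obtain ⟨C, hC⟩ := hK.exists_bound_of_continuousOn hfc.continuousOn
  set G1 : ℝ → Set (En n) := fun t => Reach Ω f t χi with hG1
  set G2 : ℝ → Set (En n) := fun t => Reach Ω (fun x w => -f x w) (T - t) χf with hG2
  -- concatenation
  have cat : ∀ t ∈ Icc 0 T, ∀ z, z ∈ G1 t → z ∈ G2 t →
      ∃ χ u, Tr Ω f 0 T χ u ∧ χ 0 = χi ∧ χ T = χf ∧ χ t = z := by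
    rintro t ht z ⟨χ, u, hu, hχ, hz⟩ ⟨χ', u', hu', hχ', hz'⟩
    have k1 := Tr.of_resp hfc hΩ hu hχ
    have k2 := (Tr.of_resp hgc hΩ hu' hχ').rev T
    simp only [neg_neg, sub_sub_cancel, sub_zero] at k2
    have i1 := resp_init ht.1 hχ
    have i2 := resp_init (sub_nonneg.2 ht.2) hχ'
    refine ⟨_, _, Tr.glue hfc hΩ ht.1 ht.2 k1 k2 (by simp [hz, hz']), ?_, ?_, ?_⟩
    · simp [ht.1, i1]
    · by_cases h : T ≤ t
      · have : t = T := le_antisymm ht.2 h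
        subst this
        simp only [le_refl, if_true]
        rw [hz, ← hz', ← i2, sub_self]
      · simp [h, i2]
    · simp [hz]
  -- full trajectories lie in reachable sets
  have mem1 : ∀ χ u, Tr Ω f 0 T χ u → χ 0 = χi → ∀ t ∈ Icc 0 T, χ t ∈ G1 t := by
    intro χ u h h0 t ht
    have k := h.mono (Icc_subset_Icc_right ht.2)
    exact ⟨χ, u, k.1, h0 ▸ k.resp, rfl⟩
  have mem2 : ∀ χ u, Tr Ω (fun x w => -f x w) 0 T χ u → χ 0 = χf → ∀ t ∈ Icc 0 T,
      χ (T - t) ∈ G2 t := by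
    intro χ u h h0 t ht
    have k := h.mono (Icc_subset_Icc_right (show T - t ≤ T by linarith [ht.1]))
    exact ⟨χ, u, k.1, h0 ▸ k.resp, rfl⟩
  have rv : ∀ χ u, Tr Ω f 0 T χ u →
      Tr Ω (fun x w => -f x w) 0 T (fun r => χ (T - r)) (fun r => u (T - r)) := by
    intro χ u h
    have := h.rev T
    simpa using this
  have mem2' : ∀ χ u, Tr Ω f 0 T χ u → χ T = χf → ∀ t ∈ Icc 0 T, χ t ∈ G2 t := by
    intro χ u h h0 t ht
    have := mem2 _ _ (rv χ u h) (by simpa using h0) t ht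
    simpa using this
  have hL : ∀ t ∈ Icc 0 T, ∀ z, z ∈ G1 t → z ∈ G2 t → ∀ s ∈ Icc 0 T,
      ∃ w, w ∈ G1 s ∧ w ∈ G2 s ∧ dist w z ≤ C * |s - t| := by
    intro t ht z hz1 hz2 s hs
    obtain ⟨χ, u, h, h0, hT', hz⟩ := cat t ht z hz1 hz2
    refine ⟨χ s, mem1 χ u h h0 s hs, mem2' χ u h hT' s hs, ?_⟩
    rw [← hz, dist_eq_norm, h.2.2 t ht s hs]
    refine intervalIntegral.norm_integral_le_of_norm_le_const fun r hr => ?_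
    have hr' : r ∈ Icc 0 T := uIcc_subset_Icc ht hs (uIoc_subset_uIcc hr)
    refine hC (χ r, u r) ⟨?_, h.1.2 r hr'⟩
    have := hM χ u h.1 (h0 ▸ h.resp) r hr'
    simpa using this.le
  have hF1 : ∀ t ∈ Icc 0 T, frontier (G1 t) ⊆ A₁ t := fun t ht => (hA₁ t ht).1
  have hF2 : ∀ t ∈ Icc 0 T, frontier (G2 t) ⊆ A₂ t := fun t ht => (hA₂ t ht).1
  have hc1 : ∀ t ∈ Icc 0 T, IsClosed (G1 t) := fun t ht =>
    frontier_subset_iff_isClosed.1 ((hA₁ t ht).1.trans (hA₁ t ht).2)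
  have hc2 : ∀ t ∈ Icc 0 T, IsClosed (G2 t) := fun t ht =>
    frontier_subset_iff_isClosed.1 ((hA₂ t ht).1.trans (hA₂ t ht).2)
  have h0m : (0 : ℝ) ∈ Icc 0 T := ⟨le_rfl, hT.le⟩
  have hTm : T ∈ Icc 0 T := ⟨hT.le, le_rfl⟩
  have G10 : ∀ z ∈ G1 0, z = χi := by
    rintro z ⟨χ, u, hu, hχ, hz⟩
    rw [← hz, resp_init le_rfl hχ]
  have G2T : ∀ z ∈ G2 T, z = χf := by
    rintro z ⟨χ, u, hu, hχ, hz⟩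
    rw [sub_self] at hχ hz
    rw [← hz, resp_init le_rfl hχ]
  have A10 : ∀ z ∈ G1 0, z ∈ A₁ 0 := by
    intro z hz
    obtain ⟨w, hw⟩ := (A₁ 0).nonempty
    have := G10 w ((hA₁ 0 h0m).2 hw)
    rw [G10 z hz, ← this]; exact hw
  have A2T : ∀ z ∈ G2 T, z ∈ A₂ T := by
    intro z hz
    obtain ⟨w, hw⟩ := (A₂ T).nonempty
    have := G2T w ((hA₂ T hTm).2 hw)
    rw [G2T z hz, ← this]; exact hw
  have prop : ∀ a b : ℝ, Icc a b ⊆ Icc 0 T → ∀ y : ℝ → En n, ContinuousOn y (Icc a b) →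
      ∀ t0 ∈ Icc a b, y t0 ∈ G1 t0 → y t0 ∈ G2 t0 →
      (∀ t ∈ Icc a b, y t ∈ G1 t → y t ∈ G2 t → (y t ∉ A₁ t ∨ ∀ s ∈ Icc a b, y s ∈ G1 s)) →
      (∀ t ∈ Icc a b, y t ∈ G1 t → y t ∈ G2 t → (y t ∉ A₂ t ∨ ∀ s ∈ Icc a b, y s ∈ G2 s)) →
      ∀ t ∈ Icc a b, y t ∈ G1 t ∧ y t ∈ G2 t := by
    intro a b hab y hy t0 ht0 h01 h02 h1 h2
    exact propagate (C := C) hy (hA₁c.mono hab) (hA₂c.mono hab) (fun t ht => hF1 t (hab ht))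
      (fun t ht => hF2 t (hab ht)) (fun t ht => hc1 t (hab ht)) (fun t ht => hc2 t (hab ht))
      (fun t ht z z1 z2 s hs => hL t (hab ht) z z1 z2 s (hab hs)) ht0 h01 h02 h1 h2
  intro x hx
  simp only [Tube, mem_iUnion] at hx
  obtain ⟨t0, ht0, χ, ⟨u, hu, hχ, hχT⟩, hxt⟩ := hx
  have tr0 := Tr.of_resp hfc hΩ hu hχ
  have x1 : x ∈ G1 t0 := hxt ▸ mem1 χ u tr0 (resp_init hT.le hχ) t0 ht0
  have x2 : x ∈ G2 t0 := hxt ▸ mem2' χ u tr0 hχT t0 ht0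
  obtain ⟨s, hs, hs1, hs2, hsA⟩ : ∃ s ∈ Icc 0 T, x ∈ G1 s ∧ x ∈ G2 s ∧ (x ∈ A₁ s ∨ x ∈ A₂ s) := by
    by_contra! hno
    have := prop 0 T subset_rfl (fun _ => x) continuousOn_const t0 ht0 x1 x2
      (fun t ht q1 q2 => Or.inl (hno t ht q1 q2).1) (fun t ht q1 q2 => Or.inl (hno t ht q1 q2).2)
      0 h0m
    exact (hno 0 h0m this.1 this.2).1 (A10 x this.1)
  obtain ⟨χ, u, hχ, hχ0, hχT, hχs⟩ := cat s hs x hs1 hs2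
  clear hxt
  rcases hsA with hsA | hsA
  · obtain ⟨χ', u', hu', hχ', hA'⟩ := hext₁ χ u hχ.1 (hχ0 ▸ hχ.resp) s hs (hχs ▸ hsA)
    have i' := resp_init hs.2 hχ'
    have tg := Tr.glue hfc hΩ hs.1 hs.2 (hχ.mono (Icc_subset_Icc_right hs.2))
      (Tr.of_resp hfc hΩ hu' hχ') i'.symm
    obtain ⟨y, hyd⟩ : ∃ y : ℝ → En n, y = fun r => if r ≤ s then χ r else χ' r := ⟨_, rfl⟩
    rw [← hyd] at tg
    have y0 : y 0 = χi := by simp [hyd, hs.1, hχ0]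
    have ys : y s = x := by simp [hyd, hχs]
    have yA : ∀ t ∈ Icc s T, y t ∈ A₁ t := by
      intro t ht
      by_cases h : t ≤ s
      · have : t = s := le_antisymm h ht.1
        rw [this, ys]; exact hsA
      · simpa [hyd, h] using hA' t ht
    have hsub : Icc s T ⊆ Icc 0 T := Icc_subset_Icc_left hs.1
    obtain ⟨τ, hτ, hτ1, hτ2, hτA⟩ : ∃ τ ∈ Icc s T, y τ ∈ G1 τ ∧ y τ ∈ G2 τ ∧ y τ ∈ A₂ τ := by
      by_contra! hno
      have := prop s T hsub y (tg.2.1.mono hsub) s ⟨le_rfl, hs.2⟩ (ys ▸ hs1) (ys ▸ hs2)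
        (fun t ht q1 q2 => Or.inr fun r hr => mem1 y _ tg y0 r (hsub hr))
        (fun t ht q1 q2 => Or.inl (hno t ht q1 q2)) T ⟨hs.2, le_rfl⟩
      exact hno T ⟨hs.2, le_rfl⟩ this.1 this.2 (A2T _ this.2)
    obtain ⟨ψ, v, hψ, hψ0, hψT, hψτ⟩ := cat τ (hsub hτ) _ hτ1 hτ2
    have rψ := rv ψ v hψ
    refine ⟨τ, hsub hτ, y, _, tg.1, y0 ▸ tg.resp, (fun r => ψ (T - r)), _, rψ.1, ?_, ?_, ⟨yA τ hτ, hτA⟩,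
      Or.inl ⟨s, ⟨hs.1, hτ.1⟩, ys⟩⟩
    · have := rψ.resp
      simpa only [sub_zero, hψT] using this
    · simp [hψτ]
  · have rχ := rv χ u hχ
    have hs' : T - s ∈ Icc 0 T := ⟨by linarith [hs.2], by linarith [hs.1]⟩
    have rr := rχ.resp
    simp only [sub_zero, hχT] at rr
    obtain ⟨χ', u', hu', hχ', hA'⟩ := hext₂ _ _ rχ.1 rr (T - s) hs' (by
      simpa [hχs] using hsA)
    have i' := resp_init hs'.2 hχ'
    have tg := Tr.glue hgc hΩ hs'.1 hs'.2 (rχ.mono (Icc_subset_Icc_right hs'.2))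
      (Tr.of_resp hgc hΩ hu' hχ') i'.symm
    obtain ⟨y, hyd⟩ : ∃ y : ℝ → En n,
      y = fun r => if r ≤ T - s then χ (T - r) else χ' r := ⟨_, rfl⟩
    rw [← hyd] at tg
    have y0 : y 0 = χf := by simp [hyd, hs.2, hχT]
    have ys : y (T - s) = x := by simp [hyd, hχs]
    have yA : ∀ t ∈ Icc 0 s, y (T - t) ∈ A₂ t := by
      intro t ht
      by_cases h : T - t ≤ T - s
      · have : t = s := le_antisymm ht.2 (by linarith)
        rw [this, ys]; exact hsA
      · have := hA' (T - t) ⟨(not_le.1 h).le, by linarith [ht.1]⟩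
        rw [sub_sub_cancel] at this
        simp only [hyd, h, if_false]
        exact this
    have hsub : Icc 0 s ⊆ Icc 0 T := Icc_subset_Icc_right hs.2
    have yc : ContinuousOn (fun t => y (T - t)) (Icc 0 s) :=
      tg.2.1.comp (by fun_prop) fun t ht =>
        ⟨by linarith [ht.2, hs.2], by linarith [ht.1]⟩
    obtain ⟨τ, hτ, hτ1, hτ2, hτA⟩ : ∃ τ ∈ Icc 0 s, y (T - τ) ∈ G1 τ ∧ y (T - τ) ∈ G2 τ ∧
        y (T - τ) ∈ A₁ τ := by
      by_contra! hno
      have := prop 0 s hsub (fun t => y (T - t)) yc s ⟨hs.1, le_rfl⟩ (ys.symm ▸ hs1)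
        (ys.symm ▸ hs2)
        (fun t ht q1 q2 => Or.inl (hno t ht q1 q2))
        (fun t ht q1 q2 => Or.inr fun r hr => mem2 y _ tg y0 r (hsub hr)) 0 ⟨le_rfl, hs.1⟩
      exact hno 0 ⟨le_rfl, hs.1⟩ this.1 this.2 (A10 _ this.1)
    obtain ⟨ψ, v, hψ, hψ0, hψT, hψτ⟩ := cat τ (hsub hτ) _ hτ1 hτ2
    refine ⟨τ, hsub hτ, ψ, v, hψ.1, hψ0 ▸ hψ.resp, y, _, tg.1, y0 ▸ tg.resp, hψτ, ?_,
      Or.inr ⟨T - s, ⟨hs'.1, by linarith [hτ.2]⟩, ys⟩⟩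
    rw [hψτ]
    exact ⟨hτA, yA τ hτ⟩
end
end

section
/- For every t > 0 and every boundary point q of the Dubins reachable set G(f_{2D}, t, χ_{2D,i}), there exists a Dubins trajectory χ on [0,t] from χ_{2D,i} of class CSC or of class CCC (with possibly degenerate subintervals, which includes all subsegments of such curves) such that χ(t) = q. -/
open MeasureTheory Metric Set

noncomputable section

/-- Right-hand side of the Dubins car dynamics on state `(x, y, γ)`:
`ẋ = cos γ, ẏ = sin γ, γ̇ = u`. -/
def dubinsRHS (q : ℝ × ℝ × ℝ) (w : ℝ) : ℝ × ℝ × ℝ :=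
  (Real.cos q.2.2, Real.sin q.2.2, w)

/-- A Dubins trajectory on `[a, b]` from `x₀`: an (absolutely continuous, in integral
form) solution of the Dubins car equations for a measurable control with values in
`[-1, 1]`. -/
def IsDubinsTraj (a b : ℝ) (x₀ : ℝ × ℝ × ℝ) (χ : ℝ → ℝ × ℝ × ℝ) (u : ℝ → ℝ) : Prop :=
  Measurable u ∧ (∀ t ∈ Set.Icc a b, u t ∈ Set.Icc (-1 : ℝ) 1) ∧
  ContinuousOn χ (Set.Icc a b) ∧
  ∀ t ∈ Set.Icc a b, χ t = x₀ + ∫ s in a..t, dubinsRHS (χ s) (u s)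

/-- The control on `[a, b]` is of class CSC: bang (`±1`), then straight (`0`), then
bang (`±1`), with possibly degenerate subintervals. -/
def IsCSCControl (a b : ℝ) (u : ℝ → ℝ) : Prop :=
  ∃ t₁ t₂, a ≤ t₁ ∧ t₁ ≤ t₂ ∧ t₂ ≤ b ∧
    ∃ c ∈ ({-1, 1} : Set ℝ), ∃ d ∈ ({-1, 1} : Set ℝ),
      (∀ t ∈ Set.Ioo a t₁, u t = c) ∧ (∀ t ∈ Set.Ioo t₁ t₂, u t = 0) ∧
      (∀ t ∈ Set.Ioo t₂ b, u t = d)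

/-- The control on `[a, b]` is of class CCC: bang `c`, then `-c`, then `c`,
with `c = ±1` and possibly degenerate subintervals. -/
def IsCCCControl (a b : ℝ) (u : ℝ → ℝ) : Prop :=
  ∃ t₁ t₂, a ≤ t₁ ∧ t₁ ≤ t₂ ∧ t₂ ≤ b ∧
    ∃ c ∈ ({-1, 1} : Set ℝ),
      (∀ t ∈ Set.Ioo a t₁, u t = c) ∧ (∀ t ∈ Set.Ioo t₁ t₂, u t = -c) ∧
      (∀ t ∈ Set.Ioo t₂ b, u t = c)

/-- The Dubins reachable set `G(f_{2D}, t, χ_{2D,i})` from the origin. -/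
def DubinsReach (t : ℝ) : Set (ℝ × ℝ × ℝ) :=
  {y | ∃ χ u, IsDubinsTraj 0 t (0, 0, 0) χ u ∧ χ t = y}

/-- Admissible heading functions. -/
def Adm (γ : ℝ → ℝ) : Prop := LipschitzWith 1 γ ∧ γ 0 = 0

/-- Endpoint map. -/
def Fend (t : ℝ) (γ : ℝ → ℝ) : ℝ × ℝ × ℝ :=
  (∫ s in (0:ℝ)..t, Real.cos (γ s), ∫ s in (0:ℝ)..t, Real.sin (γ s), γ t)


theorem Adm.lip {γ : ℝ → ℝ} (h : Adm γ) (x y : ℝ) : |γ x - γ y| ≤ |x - y| := by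
  have := h.1.dist_le_mul x y
  simpa [Real.dist_eq] using this

theorem Adm.cont {γ : ℝ → ℝ} (h : Adm γ) : Continuous γ := h.1.continuous

theorem adm_of {γ : ℝ → ℝ} (h : ∀ x y, x ≤ y → |γ y - γ x| ≤ y - x) (h0 : γ 0 = 0) : Adm γ := by
  refine ⟨LipschitzWith.of_dist_le_mul fun x y => ?_, h0⟩
  simp only [Real.dist_eq, NNReal.coe_one, one_mul]
  rcases le_total x y with hxy | hxy
  · rw [abs_sub_comm, abs_sub_comm x y, abs_of_nonneg (sub_nonneg.2 hxy)]; exact h x y hxy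
  · rw [abs_of_nonneg (sub_nonneg.2 hxy)]; exact h y x hxy

theorem Adm.up {γ : ℝ → ℝ} (h : Adm γ) {x y : ℝ} (hxy : x ≤ y) : γ y - γ x ≤ y - x := by
  have := h.lip y x
  rw [abs_of_nonneg (sub_nonneg.2 hxy)] at this
  exact (abs_le.1 this).2

theorem Adm.down {γ : ℝ → ℝ} (h : Adm γ) {x y : ℝ} (hxy : x ≤ y) : -(y - x) ≤ γ y - γ x := by
  have := h.lip y x
  rw [abs_of_nonneg (sub_nonneg.2 hxy)] at this
  exact (abs_le.1 this).1

theorem Adm.neg {γ : ℝ → ℝ} (h : Adm γ) : Adm (fun s => - γ s) := by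
  refine adm_of (fun x y hxy => ?_) (by simp [h.2])
  rw [abs_le]
  have := h.up hxy; have := h.down hxy
  constructor <;> linarith

/-- gluing of two functions at `c` -/
def glue (c : ℝ) (f g : ℝ → ℝ) : ℝ → ℝ := fun s => if s ≤ c then f s else g s

theorem glue_left {c : ℝ} {f g : ℝ → ℝ} {s : ℝ} (h : s ≤ c) : glue c f g s = f s := by
  simp [glue, h]

theorem glue_right {c : ℝ} {f g : ℝ → ℝ} (hc : f c = g c) {s : ℝ} (h : c ≤ s) :
    glue c f g s = g s := by
  rcases h.eq_or_lt with rfl | h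
  · simp [glue, hc]
  · simp [glue, not_le.2 h]

theorem glue_lip {c : ℝ} {f g : ℝ → ℝ} (hc : f c = g c) (hf : LipschitzWith 1 f)
    (hg : LipschitzWith 1 g) : LipschitzWith 1 (glue c f g) := by
  have key : ∀ x y, x ≤ y → |glue c f g y - glue c f g x| ≤ y - x := by
    intro x y hxy
    have F : ∀ x y, x ≤ y → |f y - f x| ≤ y - x := fun x y h => by
      have := hf.dist_le_mul y x
      simpa [Real.dist_eq, abs_of_nonneg (sub_nonneg.2 h)] using this
    have G : ∀ x y, x ≤ y → |g y - g x| ≤ y - x := fun x y h => by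
      have := hg.dist_le_mul y x
      simpa [Real.dist_eq, abs_of_nonneg (sub_nonneg.2 h)] using this
    rcases le_total y c with h1 | h1
    · rw [glue_left h1, glue_left (hxy.trans h1)]; exact F x y hxy
    · rcases le_total x c with h2 | h2
      · rw [glue_right hc h1, glue_left h2]
        have a := F x c h2; have b := G c y h1
        rw [hc] at a
        rw [abs_le] at *
        constructor <;> linarith [a.1, a.2, b.1, b.2]
      · rw [glue_right hc h1, glue_right hc h2]; exact G x y hxy
  refine LipschitzWith.of_dist_le_mul fun x y => ?_
  simp only [Real.dist_eq, NNReal.coe_one, one_mul]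
  rcases le_total x y with hxy | hxy
  · rw [abs_sub_comm, abs_sub_comm x y, abs_of_nonneg (sub_nonneg.2 hxy)]; exact key x y hxy
  · rw [abs_of_nonneg (sub_nonneg.2 hxy)]; exact key y x hxy

theorem shift_lip {f : ℝ → ℝ} (hf : LipschitzWith 1 f) (d e : ℝ) :
    LipschitzWith 1 (fun s => f (s + d) + e) := by
  refine LipschitzWith.of_dist_le_mul fun x y => ?_
  have := hf.dist_le_mul (x + d) (y + d)
  simpa using this

theorem id_lip (d : ℝ) : LipschitzWith 1 (fun s : ℝ => s + d) :=
  LipschitzWith.of_dist_le_mul fun x y => by simp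

theorem negid_lip (d : ℝ) : LipschitzWith 1 (fun s : ℝ => d - s) :=
  LipschitzWith.of_dist_le_mul fun x y => by
    rw [Real.dist_eq, Real.dist_eq, abs_sub_comm x y]; simp

theorem rhs_integral {χ : ℝ → ℝ × ℝ × ℝ} {u : ℝ → ℝ} {s : ℝ}
    (h1 : IntervalIntegrable (fun r => Real.cos (χ r).2.2) volume 0 s)
    (h2 : IntervalIntegrable (fun r => Real.sin (χ r).2.2) volume 0 s)
    (h3 : IntervalIntegrable u volume 0 s) :
    ∫ r in (0:ℝ)..s, dubinsRHS (χ r) (u r) =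
      (∫ r in (0:ℝ)..s, Real.cos (χ r).2.2, ∫ r in (0:ℝ)..s, Real.sin (χ r).2.2,
        ∫ r in (0:ℝ)..s, u r) := by
  have hp : ∀ {f g : ℝ → ℝ}, IntervalIntegrable f volume 0 s → IntervalIntegrable g volume 0 s →
      IntervalIntegrable (fun r => (f r, g r)) volume 0 s := fun hf hg =>
    ⟨hf.1.prodMk hg.1, hf.2.prodMk hg.2⟩
  have h23 := hp h2 h3
  have h123 : IntervalIntegrable (fun r => dubinsRHS (χ r) (u r)) volume 0 s :=
    ⟨h1.1.prodMk h23.1, h1.2.prodMk h23.2⟩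
  refine Prod.ext ?_ (Prod.ext ?_ ?_)
  · exact ((ContinuousLinearMap.fst ℝ ℝ (ℝ × ℝ)).intervalIntegral_comp_comm h123).symm
  · exact (((ContinuousLinearMap.fst ℝ ℝ ℝ).comp
      (ContinuousLinearMap.snd ℝ ℝ (ℝ × ℝ))).intervalIntegral_comp_comm h123).symm
  · exact (((ContinuousLinearMap.snd ℝ ℝ ℝ).comp
      (ContinuousLinearMap.snd ℝ ℝ (ℝ × ℝ))).intervalIntegral_comp_comm h123).symm

theorem traj_of_adm {γ : ℝ → ℝ} (h : Adm γ) (t : ℝ) :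
    IsDubinsTraj 0 t (0, 0, 0) (fun s => Fend s γ) (deriv γ) := by
  have hd : ∀ x, |deriv γ x| ≤ 1 := fun x => by
    simpa using norm_deriv_le_of_lipschitz (x₀ := x) h.1
  have hcc : Continuous fun s => Real.cos (γ s) := Real.continuous_cos.comp h.cont
  have hcs : Continuous fun s => Real.sin (γ s) := Real.continuous_sin.comp h.cont
  refine ⟨measurable_deriv γ, fun s _ => abs_le.1 (hd s), ?_, fun s _ => ?_⟩
  · refine Continuous.continuousOn ?_
    have i1 : Continuous fun s => ∫ r in (0:ℝ)..s, Real.cos (γ r) :=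
      intervalIntegral.continuous_primitive (fun a b => hcc.intervalIntegrable a b) 0
    have i2 : Continuous fun s => ∫ r in (0:ℝ)..s, Real.sin (γ r) :=
      intervalIntegral.continuous_primitive (fun a b => hcs.intervalIntegrable a b) 0
    exact i1.prodMk (i2.prodMk h.cont)
  · have ac : AbsolutelyContinuousOnInterval γ 0 s :=
      (h.1.lipschitzOnWith (s := uIcc 0 s)).absolutelyContinuousOnInterval
    have e := rhs_integral (χ := fun s => Fend s γ) (u := deriv γ) (s := s)
      (hcc.intervalIntegrable _ _) (hcs.intervalIntegrable _ _) ac.intervalIntegrable_deriv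
    rw [e, ac.integral_deriv_eq_sub, h.2]
    simp [Fend]

theorem mem_reach_of_adm {γ : ℝ → ℝ} (h : Adm γ) (t : ℝ) : Fend t γ ∈ DubinsReach t :=
  ⟨_, _, traj_of_adm h t, rfl⟩

theorem exists_adm_of_mem {t : ℝ} (ht : 0 < t) {q} (hq : q ∈ DubinsReach t) :
    ∃ γ, Adm γ ∧ Fend t γ = q := by
  obtain ⟨χ, u, ⟨hum, hub, hχ, hint⟩, rfl⟩ := hq
  have hc : ContinuousOn (fun r => (χ r).2.2) (Icc 0 t) := (hχ.snd).snd
  have hu : IntervalIntegrable u volume 0 t := by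
    rw [intervalIntegrable_iff_integrableOn_Icc_of_le ht.le]
    refine Measure.integrableOn_of_bounded (M := 1) (by simp) hum.aestronglyMeasurable ?_
    filter_upwards [ae_restrict_mem measurableSet_Icc] with x hx
    exact abs_le.2 (hub x hx)
  have sub : ∀ s ∈ Icc 0 t, uIcc 0 s ⊆ Icc 0 t := fun s hs => by
    rw [uIcc_of_le hs.1]; exact Icc_subset_Icc_right hs.2
  have hus : ∀ a ∈ Icc 0 t, ∀ s ∈ Icc 0 t, IntervalIntegrable u volume a s := fun a ha s hs => by
    refine hu.mono_set ?_
    rw [uIcc_of_le ht.le]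
    exact (convex_Icc 0 t).ordConnected.uIcc_subset ha hs
  have h1 : ∀ s ∈ Icc 0 t, χ s = (∫ r in (0:ℝ)..s, Real.cos (χ r).2.2,
      ∫ r in (0:ℝ)..s, Real.sin (χ r).2.2, ∫ r in (0:ℝ)..s, u r) := by
    intro s hs
    rw [hint s hs, rhs_integral _ _ (hus 0 ⟨le_rfl, ht.le⟩ s hs)]
    · simp
    · exact ((Real.continuous_cos.comp_continuousOn hc).mono (sub s hs)).intervalIntegrable
    · exact ((Real.continuous_sin.comp_continuousOn hc).mono (sub s hs)).intervalIntegrable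
  have h0 : (0:ℝ) ∈ Icc 0 t := ⟨le_rfl, ht.le⟩
  have hl : LipschitzOnWith 1 (fun r => (χ r).2.2) (Icc 0 t) := by
    refine LipschitzOnWith.of_dist_le_mul fun x hx y hy => ?_
    have e1 : (χ x).2.2 = ∫ r in (0:ℝ)..x, u r := by rw [h1 x hx]
    have e2 : (χ y).2.2 = ∫ r in (0:ℝ)..y, u r := by rw [h1 y hy]
    rw [Real.dist_eq, e1, e2, intervalIntegral.integral_interval_sub_left (hus 0 h0 x hx) (hus 0 h0 y hy)]
    have := intervalIntegral.norm_integral_le_of_norm_le_const (a := y) (b := x) (f := u) (C := 1)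
      (fun z hz => abs_le.2 (hub z ((convex_Icc 0 t).ordConnected.uIcc_subset hy hx (uIoc_subset_uIcc hz))))
    simpa [Real.dist_eq] using this
  obtain ⟨γ, hγ, he⟩ := hl.extend_real
  refine ⟨γ, ⟨hγ, ?_⟩, ?_⟩
  · rw [← he h0]
    simp [h1 0 h0]
  · have htt : t ∈ Icc 0 t := ⟨ht.le, le_rfl⟩
    have e3 : (χ t).2.2 = γ t := he htt
    have e4 : χ t = (∫ r in (0:ℝ)..t, Real.cos (χ r).2.2,
      ∫ r in (0:ℝ)..t, Real.sin (χ r).2.2, (χ t).2.2) := by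
      conv_lhs => rw [h1 t htt]
      congr 2
      rw [h1 t htt]
    rw [e4, Fend, e3]
    congr 1
    · refine intervalIntegral.integral_congr fun s hs => ?_
      rw [uIcc_of_le ht.le] at hs
      simp only [← he hs]
    · congr 1
      refine intervalIntegral.integral_congr fun s hs => ?_
      rw [uIcc_of_le ht.le] at hs
      simp only [← he hs]


def lift0 {t : ℝ} (ht : 0 < t) (f : BoundedContinuousFunction (Icc 0 t) ℝ) : ℝ → ℝ :=
  fun s => f (projIcc 0 t ht.le s)

def admSet {t : ℝ} (ht : 0 < t) : Set (BoundedContinuousFunction (Icc 0 t) ℝ) :=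
  {f | (∀ x y, |f x - f y| ≤ dist x y) ∧ f ⟨0, le_rfl, ht.le⟩ = 0}

theorem admSet_compact {t : ℝ} (ht : 0 < t) : IsCompact (admSet ht) := by
  refine BoundedContinuousFunction.arzela_ascoli₂ (Icc (-t) t) isCompact_Icc _ ?_ ?_ ?_
  · have e : admSet ht = (⋂ x, ⋂ y, {f | |f x - f y| ≤ dist x y}) ∩
        {f | f ⟨0, le_rfl, ht.le⟩ = 0} := by
      ext f; simp only [admSet, mem_inter_iff, mem_iInter, mem_ofPred_eq]
    have hev : ∀ x, Continuous fun f : BoundedContinuousFunction (Icc 0 t) ℝ => f x :=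
      fun x => continuous_eval_const x
    rw [e]
    refine IsClosed.inter ?_ ?_
    · refine isClosed_iInter fun x => isClosed_iInter fun y => ?_
      exact isClosed_le ((hev x).sub (hev y)).abs continuous_const
    · exact isClosed_eq (hev _) continuous_const
  · intro f x hf
    have := hf.1 x ⟨0, le_rfl, ht.le⟩
    rw [hf.2, sub_zero, Subtype.dist_eq, Real.dist_eq, sub_zero, abs_of_nonneg x.2.1] at this
    exact abs_le.1 (this.trans x.2.2)
  · refine Metric.equicontinuous_of_continuity_modulus id Filter.tendsto_id _ ?_
    intro x y f
    have := f.2.1 x y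
    simpa [Real.dist_eq] using this

theorem lift0_adm {t : ℝ} (ht : 0 < t) {f} (hf : f ∈ admSet ht) : Adm (lift0 ht f) := by
  refine ⟨LipschitzWith.of_dist_le_mul fun x y => ?_, ?_⟩
  · have h1 := hf.1 (projIcc 0 t ht.le x) (projIcc 0 t ht.le y)
    have h2 : dist (projIcc 0 t ht.le x) (projIcc 0 t ht.le y) ≤ dist x y := by
      have := (LipschitzWith.projIcc ht.le).dist_le_mul x y
      simpa using this
    simp only [lift0, Real.dist_eq, NNReal.coe_one, one_mul] at *
    linarith
  · simp only [lift0]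
    rw [projIcc_left]; exact hf.2

theorem exists_lift0 {t : ℝ} (ht : 0 < t) {γ : ℝ → ℝ} (h : Adm γ) :
    ∃ f ∈ admSet ht, ∀ s ∈ Icc 0 t, lift0 ht f s = γ s := by
  refine ⟨BoundedContinuousFunction.mkOfCompact ⟨fun x => γ x, h.cont.comp continuous_subtype_val⟩,
    ⟨fun x y => ?_, ?_⟩, fun s hs => ?_⟩
  · simpa [Subtype.dist_eq, Real.dist_eq] using h.lip x y
  · simpa using h.2
  · simp [lift0, projIcc_of_mem ht.le hs]

theorem lift0_cont {t : ℝ} (ht : 0 < t) :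
    Continuous fun p : BoundedContinuousFunction (Icc 0 t) ℝ × ℝ => lift0 ht p.1 p.2 := by
  unfold lift0
  exact ContinuousEval.continuous_eval.comp
    (continuous_fst.prodMk ((continuous_projIcc (h := ht.le)).comp continuous_snd))

theorem lift0_int_cont {t : ℝ} (ht : 0 < t) {Φ : ℝ → ℝ → ℝ} (hΦ : Continuous Φ.uncurry) :
    Continuous fun f : BoundedContinuousFunction (Icc 0 t) ℝ =>
      ∫ s in (0:ℝ)..t, Φ s (lift0 ht f s) := by
  refine intervalIntegral.continuous_parametric_intervalIntegral_of_continuous'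
    (f := fun f s => Φ s (lift0 ht f s)) ?_ 0 t
  exact hΦ.comp (continuous_snd.prodMk (lift0_cont ht))

theorem Fend_cont {t : ℝ} (ht : 0 < t) :
    Continuous fun f : BoundedContinuousFunction (Icc 0 t) ℝ => Fend t (lift0 ht f) := by
  have c1 := lift0_int_cont ht (Φ := fun _ x => Real.cos x) (Real.continuous_cos.comp continuous_snd)
  have c2 := lift0_int_cont ht (Φ := fun _ x => Real.sin x) (Real.continuous_sin.comp continuous_snd)
  have c3 : Continuous fun f : BoundedContinuousFunction (Icc 0 t) ℝ => lift0 ht f t :=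
    continuous_eval_const _
  exact c1.prodMk (c2.prodMk c3)

theorem int_congr_Icc {t : ℝ} (ht : 0 < t) {f g : ℝ → ℝ} (h : ∀ s ∈ Icc 0 t, f s = g s) :
    ∫ s in (0:ℝ)..t, f s = ∫ s in (0:ℝ)..t, g s :=
  intervalIntegral.integral_congr fun s hs => by rw [uIcc_of_le ht.le] at hs; exact h s hs

theorem Fend_congr {t : ℝ} (ht : 0 < t) {f g : ℝ → ℝ} (h : ∀ s ∈ Icc 0 t, f s = g s) :
    Fend t f = Fend t g := by
  unfold Fend
  rw [int_congr_Icc ht (fun s hs => by rw [h s hs] : ∀ s ∈ Icc 0 t, Real.cos (f s) = Real.cos (g s)),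
    int_congr_Icc ht (fun s hs => by rw [h s hs] : ∀ s ∈ Icc 0 t, Real.sin (f s) = Real.sin (g s)),
    h t ⟨ht.le, le_rfl⟩]

theorem Fend_closed {t : ℝ} (ht : 0 < t) : IsClosed (Fend t '' {γ | Adm γ}) := by
  have : Fend t '' {γ | Adm γ} = (fun f => Fend t (lift0 ht f)) '' admSet ht := by
    ext q; constructor
    · rintro ⟨γ, h, rfl⟩
      obtain ⟨f, hf, he⟩ := exists_lift0 ht h
      exact ⟨f, hf, Fend_congr ht he⟩
    · rintro ⟨f, hf, rfl⟩
      exact ⟨_, lift0_adm ht hf, rfl⟩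
  rw [this]
  exact ((admSet_compact ht).image (Fend_cont ht)).isClosed

theorem exists_lexmax {t : ℝ} (ht : 0 < t) {q} (hq : q ∈ Fend t '' {γ | Adm γ}) :
    ∃ γ, Adm γ ∧ Fend t γ = q ∧ ∀ η, Adm η → Fend t η = q →
      (∫ s in (0:ℝ)..t, η s) ≤ ∫ s in (0:ℝ)..t, γ s ∧
      ((∫ s in (0:ℝ)..t, η s) = (∫ s in (0:ℝ)..t, γ s) →
        (∫ s in (0:ℝ)..t, s * η s) ≤ ∫ s in (0:ℝ)..t, s * γ s) := by
  have c1 := lift0_int_cont ht (Φ := fun _ x => x) continuous_snd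
  have c2 := lift0_int_cont ht (Φ := fun s x => s * x) continuous_mul
  set K := admSet ht ∩ {f | Fend t (lift0 ht f) = q} with hK
  have hKc : IsCompact K := (admSet_compact ht).inter_right
    (isClosed_eq (Fend_cont ht) continuous_const)
  have hKn : K.Nonempty := by
    obtain ⟨γ, h, rfl⟩ := hq
    obtain ⟨f, hf, he⟩ := exists_lift0 ht h
    exact ⟨f, hf, Fend_congr ht he⟩
  obtain ⟨f1, hf1, hm1⟩ := hKc.exists_isMaxOn hKn c1.continuousOn
  set K2 := K ∩ {f | (∫ s in (0:ℝ)..t, lift0 ht f s) = ∫ s in (0:ℝ)..t, lift0 ht f1 s} with hK2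
  have hK2c : IsCompact K2 := hKc.inter_right (isClosed_eq c1 continuous_const)
  obtain ⟨f2, hf2, hm2⟩ := hK2c.exists_isMaxOn ⟨f1, hf1, rfl⟩ c2.continuousOn
  refine ⟨lift0 ht f2, lift0_adm ht hf2.1.1, hf2.1.2, fun η hη hq => ?_⟩
  obtain ⟨g, hg, he⟩ := exists_lift0 ht hη
  have hgK : g ∈ K := ⟨hg, (Fend_congr ht he).trans hq⟩
  have e1 : ∫ s in (0:ℝ)..t, lift0 ht g s = ∫ s in (0:ℝ)..t, η s := int_congr_Icc ht he
  have e2 : ∫ s in (0:ℝ)..t, s * lift0 ht g s = ∫ s in (0:ℝ)..t, s * η s :=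
    int_congr_Icc ht fun s hs => by rw [he s hs]
  have e3 : (∫ s in (0:ℝ)..t, lift0 ht f2 s) = ∫ s in (0:ℝ)..t, lift0 ht f1 s := hf2.2
  have m1 : (∫ s in (0:ℝ)..t, lift0 ht g s) ≤ ∫ s in (0:ℝ)..t, lift0 ht f1 s := hm1 hgK
  refine ⟨by linarith, fun he' => ?_⟩
  have : g ∈ K2 := ⟨hgK, by simp only [mem_ofPred_eq]; linarith⟩
  have m2 : (∫ s in (0:ℝ)..t, s * lift0 ht g s) ≤ ∫ s in (0:ℝ)..t, s * lift0 ht f2 s := hm2 this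
  linarith


theorem cos_est (g X Y : ℝ) :
    |Real.cos (g + X) - Real.cos (g + Y) - (-Real.sin g) * (X - Y)| ≤ (|X| + |Y|) * |X - Y| := by
  have hd : ∀ u ∈ Icc (-(|X| + |Y|)) (|X| + |Y|), HasDerivWithinAt (fun u => Real.cos (g + u) - (-Real.sin g) * u)
      (-Real.sin (g + u) - (-Real.sin g)) (Icc (-(|X| + |Y|)) (|X| + |Y|)) u := by
    intro u _
    have h1 : HasDerivAt (fun u => g + u) 1 u := (hasDerivAt_id' u).const_add g
    have h2 : HasDerivAt (fun u => (-Real.sin g) * u) ((-Real.sin g) * 1) u :=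
      (hasDerivAt_id' u).const_mul (-Real.sin g)
    have := (h1.cos).sub h2
    rw [mul_one, mul_one] at this
    exact this.hasDerivWithinAt
  have hb : ∀ u ∈ Icc (-(|X| + |Y|)) (|X| + |Y|), ‖-Real.sin (g + u) - (-Real.sin g)‖ ≤ |X| + |Y| := by
    intro u hu
    have h1 : |Real.sin g - Real.sin (g + u)| ≤ |g - (g + u)| := by
      have := Real.lipschitzWith_sin.dist_le_mul g (g + u)
      simpa [Real.dist_eq] using this
    have : ‖-Real.sin (g + u) - (-Real.sin g)‖ = |Real.sin g - Real.sin (g + u)| := by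
      rw [Real.norm_eq_abs]; congr 1; ring
    rw [this]
    refine h1.trans ?_
    rw [sub_add_cancel_left, abs_neg]; exact abs_le.2 hu
  have hX : X ∈ Icc (-(|X| + |Y|)) (|X| + |Y|) := abs_le.1 (by linarith [abs_nonneg Y])
  have hY : Y ∈ Icc (-(|X| + |Y|)) (|X| + |Y|) := abs_le.1 (by linarith [abs_nonneg X])
  have := (convex_Icc _ _).norm_image_sub_le_of_norm_hasDerivWithin_le hd hb hY hX
  simp only [Real.norm_eq_abs] at this
  convert this using 2
  ring

theorem sin_est (g X Y : ℝ) :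
    |Real.sin (g + X) - Real.sin (g + Y) - (Real.cos g) * (X - Y)| ≤ (|X| + |Y|) * |X - Y| := by
  have := cos_est (g - Real.pi / 2) X Y
  have e : ∀ X, g - Real.pi / 2 + X = g + X - Real.pi / 2 := fun X => by ring
  simpa [e, Real.cos_sub_pi_div_two, Real.sin_sub_pi_div_two] using this

/-- derivative of the endpoint map -/
def dF (t : ℝ) (γ h : ℝ → ℝ) : ℝ × ℝ × ℝ :=
  (∫ s in (0:ℝ)..t, -Real.sin (γ s) * h s, ∫ s in (0:ℝ)..t, Real.cos (γ s) * h s, h t)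

theorem adm_comb {γ : ℝ → ℝ} (h : Adm γ) {η : Fin 6 → ℝ → ℝ} (hη : ∀ i, Adm (η i))
    {x : Fin 6 → ℝ} (h0 : ∀ i, 0 ≤ x i) (h1 : ∑ i, x i ≤ 1) :
    Adm (fun s => γ s + ∑ i, x i * (η i s - γ s)) := by
  refine adm_of (fun u v huv => ?_) ?_
  · have e : (γ v + ∑ i, x i * (η i v - γ v)) - (γ u + ∑ i, x i * (η i u - γ u)) =
        (1 - ∑ i, x i) * (γ v - γ u) + ∑ i, x i * (η i v - η i u) := by
      simp only [Fin.sum_univ_six]; ring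
    have e2 : (1 - ∑ i, x i) * (v - u) + ∑ i, x i * (v - u) = v - u := by
      rw [← Finset.sum_mul]; ring
    have hs : 0 ≤ 1 - ∑ i, x i := by linarith
    rw [e, abs_le]
    constructor
    · have a1 : (1 - ∑ i, x i) * (-(v - u)) ≤ (1 - ∑ i, x i) * (γ v - γ u) :=
        mul_le_mul_of_nonneg_left (h.down huv) hs
      have a2 : ∑ i, x i * (-(v - u)) ≤ ∑ i, x i * (η i v - η i u) :=
        Finset.sum_le_sum fun i _ => mul_le_mul_of_nonneg_left ((hη i).down huv) (h0 i)
      simp only [mul_neg, Finset.sum_neg_distrib] at a1 a2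
      linarith
    · have a1 : (1 - ∑ i, x i) * (γ v - γ u) ≤ (1 - ∑ i, x i) * (v - u) :=
        mul_le_mul_of_nonneg_left (h.up huv) hs
      have a2 : ∑ i, x i * (η i v - η i u) ≤ ∑ i, x i * (v - u) :=
        Finset.sum_le_sum fun i _ => mul_le_mul_of_nonneg_left ((hη i).up huv) (h0 i)
      linarith
  · simp [h.2, fun i => (hη i).2]

/-- the finite-dimensional variation -/
def Gv (t : ℝ) (γ : ℝ → ℝ) (η : Fin 6 → ℝ → ℝ) (x : Fin 6 → ℝ) : ℝ × ℝ × ℝ :=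
  Fend t (fun s => γ s + ∑ i, x i * (η i s - γ s))

def Mv (V : Fin 6 → ℝ × ℝ × ℝ) : (Fin 6 → ℝ) →L[ℝ] ℝ × ℝ × ℝ :=
  ∑ i, (ContinuousLinearMap.proj (R := ℝ) (φ := fun _ : Fin 6 => ℝ) i).smulRight (V i)

theorem Mv_apply (V : Fin 6 → ℝ × ℝ × ℝ) (x : Fin 6 → ℝ) : Mv V x = ∑ i, x i • V i := by
  simp [Mv]

theorem Mv_dF {t : ℝ} {γ : ℝ → ℝ} (h : Adm γ) {η : Fin 6 → ℝ → ℝ} (hη : ∀ i, Adm (η i))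
    (x : Fin 6 → ℝ) :
    Mv (fun i => dF t γ (fun s => η i s - γ s)) x =
      dF t γ (fun s => ∑ i, x i * (η i s - γ s)) := by
  have hc := h.cont
  have hce := fun i => (hη i).cont
  rw [Mv_apply]
  refine Prod.ext ?_ (Prod.ext ?_ ?_)
  · simp only [dF, Prod.fst_sum, Prod.smul_fst, smul_eq_mul]
    simp_rw [Finset.mul_sum]
    rw [intervalIntegral.integral_finsetSum]
    · refine Finset.sum_congr rfl fun i _ => ?_
      rw [← intervalIntegral.integral_const_mul]
      congr 1; ext s; ring
    · intro i _
      have := hce i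
      exact (by fun_prop : Continuous _).intervalIntegrable _ _
  · simp only [dF, Prod.fst_sum, Prod.snd_sum, Prod.smul_snd, Prod.smul_fst, smul_eq_mul]
    simp_rw [Finset.mul_sum]
    rw [intervalIntegral.integral_finsetSum]
    · refine Finset.sum_congr rfl fun i _ => ?_
      rw [← intervalIntegral.integral_const_mul]
      congr 1; ext s; ring
    · intro i _
      have := hce i
      exact (by fun_prop : Continuous _).intervalIntegrable _ _
  · simp only [dF, Prod.snd_sum, Prod.smul_snd, smul_eq_mul]

theorem Gv_est {t : ℝ} (ht : 0 < t) {γ : ℝ → ℝ} (h : Adm γ) {η : Fin 6 → ℝ → ℝ}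
    (hη : ∀ i, Adm (η i)) {ρ : ℝ} {x y : Fin 6 → ℝ} (hx : ‖x‖ ≤ ρ) (hy : ‖y‖ ≤ ρ) :
    ‖Gv t γ η x - Gv t γ η y - Mv (fun i => dF t γ (fun s => η i s - γ s)) (x - y)‖ ≤
      (288 * t ^ 3 * ρ) * ‖x - y‖ := by
  have hc := h.cont
  have hce := fun i => (hη i).cont
  rw [Mv_dF h hη]
  have hX : ∀ (z : Fin 6 → ℝ) (s : ℝ), s ∈ Icc 0 t → |∑ i, z i * (η i s - γ s)| ≤ 12 * t * ‖z‖ := by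
    intro z s hs
    have hb : ∀ f : ℝ → ℝ, Adm f → |f s| ≤ t := fun f hf => by
      have := hf.lip s 0
      rw [hf.2, sub_zero, sub_zero, abs_of_nonneg hs.1] at this
      exact this.trans hs.2
    calc |∑ i, z i * (η i s - γ s)| ≤ ∑ i, |z i * (η i s - γ s)| := Finset.abs_sum_le_sum_abs _ _
      _ ≤ ∑ i : Fin 6, ‖z‖ * (2 * t) := by
        refine Finset.sum_le_sum fun i _ => ?_
        rw [abs_mul]
        refine mul_le_mul (norm_le_pi_norm z i) ?_ (abs_nonneg _) (norm_nonneg _)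
        have := abs_sub (η i s) (γ s)
        linarith [hb _ (hη i), hb _ h]
      _ = 12 * t * ‖z‖ := by simp; ring
  set X : ℝ → ℝ := fun s => ∑ i, x i * (η i s - γ s) with hXd
  set Y : ℝ → ℝ := fun s => ∑ i, y i * (η i s - γ s) with hYd
  have hXY : (fun s => ∑ i, (x - y) i * (η i s - γ s)) = fun s => X s - Y s := by
    ext s; simp [hXd, hYd, sub_mul, Finset.sum_sub_distrib]
  have cX : Continuous X := by
    exact continuous_finsetSum _ fun i _ => continuous_const.mul ((hce i).sub hc)
  have cY : Continuous Y := by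
    exact continuous_finsetSum _ fun i _ => continuous_const.mul ((hce i).sub hc)
  have bXY : ∀ s ∈ Icc 0 t, (|X s| + |Y s|) * |X s - Y s| ≤ 288 * t ^ 2 * ρ * ‖x - y‖ := by
    intro s hs
    have b1 := hX x s hs
    have b2 := hX y s hs
    have b3 := hX (x - y) s hs
    rw [congrFun hXY s] at b3
    have b4 : |X s| + |Y s| ≤ 24 * t * ρ := by
      have := mul_le_mul_of_nonneg_left hx (by positivity : 0 ≤ 12 * t)
      have := mul_le_mul_of_nonneg_left hy (by positivity : 0 ≤ 12 * t)
      simp only [hXd, hYd]; linarith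
    calc (|X s| + |Y s|) * |X s - Y s| ≤ (24 * t * ρ) * (12 * t * ‖x - y‖) :=
          mul_le_mul b4 b3 (abs_nonneg _) ((by positivity : 0 ≤ |X s| + |Y s|).trans b4)
      _ = _ := by ring
  rw [hXY]
  have hgen : ∀ f : ℝ → ℝ, (∀ s ∈ Icc 0 t, |f s| ≤ (|X s| + |Y s|) * |X s - Y s|) →
      |∫ s in (0:ℝ)..t, f s| ≤ (288 * t ^ 3 * ρ) * ‖x - y‖ := by
    intro f hf
    have := intervalIntegral.norm_integral_le_of_norm_le_const (a := 0) (b := t) (f := f)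
      (C := 288 * t ^ 2 * ρ * ‖x - y‖) (fun s hs => by
        rw [uIoc_of_le ht.le] at hs
        have hs' : s ∈ Icc 0 t := ⟨hs.1.le, hs.2⟩
        exact (hf s hs').trans (bXY s hs'))
    rw [sub_zero, abs_of_pos ht, Real.norm_eq_abs] at this
    calc _ ≤ _ := this
      _ = _ := by ring
  have i1 : ∀ f : ℝ → ℝ, Continuous f → IntervalIntegrable f volume 0 t :=
    fun f hf => hf.intervalIntegrable _ _
  rw [Prod.norm_def, Prod.norm_def]
  refine max_le ?_ (max_le ?_ ?_)
  · simp only [Gv, Fend, dF, Prod.fst_sub, Real.norm_eq_abs]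
    rw [← intervalIntegral.integral_sub (i1 _ (by fun_prop)) (i1 _ (by fun_prop)),
      ← intervalIntegral.integral_sub (i1 _ (by fun_prop)) (i1 _ (by fun_prop))]
    exact hgen _ fun s _ => cos_est _ _ _
  · simp only [Gv, Fend, dF, Prod.fst_sub, Prod.snd_sub, Real.norm_eq_abs]
    rw [← intervalIntegral.integral_sub (i1 _ (by fun_prop)) (i1 _ (by fun_prop)),
      ← intervalIntegral.integral_sub (i1 _ (by fun_prop)) (i1 _ (by fun_prop))]
    exact hgen _ fun s _ => sin_est _ _ _
  · simp only [Gv, Fend, dF, Prod.snd_sub, Real.norm_eq_abs]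
    have : γ t + ∑ i, x i * (η i t - γ t) - (γ t + ∑ i, y i * (η i t - γ t)) - (X t - Y t) = 0 := by
      simp only [hXd, hYd]; ring
    rw [this, abs_zero]
    have : 0 ≤ ρ := (norm_nonneg x).trans hx
    positivity

theorem interior_of_surj {t : ℝ} (ht : 0 < t) {γ : ℝ → ℝ} (h : Adm γ) {η : Fin 6 → ℝ → ℝ}
    (hη : ∀ i, Adm (η i))
    (hs : (Mv (fun i => dF t γ (fun s => η i s - γ s))).range = ⊤)
    (h1 : Mv (fun i => dF t γ (fun s => η i s - γ s)) (fun _ => 1) = 0) :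
    Fend t γ ∈ interior (Fend t '' {γ | Adm γ}) := by
  set M := Mv (fun i => dF t γ (fun s => η i s - γ s)) with hM
  set R := M.nonlinearRightInverseOfSurjective hs with hR
  have hN : 0 < (R.nnnorm : ℝ) := by
    exact_mod_cast M.nonlinearRightInverseOfSurjective_nnnorm_pos hs
  set N := (R.nnnorm : ℝ)⁻¹ with hNd
  have hNp : 0 < N := inv_pos.2 hN
  obtain ⟨ρ, hρ0, hρ1, hρ2⟩ : ∃ ρ : ℝ, 0 < ρ ∧ 6 * ρ ≤ 1 ∧ 2 * (288 * t ^ 3 * ρ) < N := by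
    refine ⟨min (1 / 6) (N / (1000 * t ^ 3)), by positivity, ?_, ?_⟩
    · linarith [min_le_left (1 / 6) (N / (1000 * t ^ 3))]
    · have h2 := min_le_right (1 / 6) (N / (1000 * t ^ 3))
      have h3 : 2 * (288 * t ^ 3 * min (1 / 6) (N / (1000 * t ^ 3))) ≤
          2 * (288 * t ^ 3 * (N / (1000 * t ^ 3))) := by gcongr
      have h4 : 2 * (288 * t ^ 3 * (N / (1000 * t ^ 3))) = N * (576 / 1000) := by
        field_simp; norm_num
      linarith
  have hc0 : 0 ≤ 288 * t ^ 3 * ρ := by positivity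
  have happ : ApproximatesLinearOn (Gv t γ η) M (closedBall 0 ρ) ⟨288 * t ^ 3 * ρ, hc0⟩ := by
    intro x hx y hy
    exact Gv_est ht h hη (mem_closedBall_zero_iff.1 hx) (mem_closedBall_zero_iff.1 hy)
  set b : Fin 6 → ℝ := fun _ => ρ / 2 with hb
  have hbn : ‖b‖ ≤ ρ / 2 := (pi_norm_le_iff_of_nonneg (by positivity)).2 fun i => by
    simp [hb, abs_of_pos hρ0]
  have hsub : closedBall b (ρ / 2) ⊆ closedBall 0 ρ := by
    intro x hx
    rw [mem_closedBall_zero_iff]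
    rw [mem_closedBall, dist_eq_norm] at hx
    calc ‖x‖ = ‖(x - b) + b‖ := by simp
      _ ≤ ‖x - b‖ + ‖b‖ := norm_add_le _ _
      _ ≤ ρ := by linarith
  have hsurj := happ.surjOn_closedBall_of_nonlinearRightInverse R (by positivity : 0 ≤ ρ / 2) hsub
  have hMb : M b = 0 := by
    have : b = (ρ / 2) • (fun _ => 1 : Fin 6 → ℝ) := by ext; simp [hb]
    rw [this, map_smul, h1, smul_zero]
  have hd := Gv_est ht h hη (hbn.trans (by linarith : ρ / 2 ≤ ρ))
    (by simpa using hρ0.le : ‖(0 : Fin 6 → ℝ)‖ ≤ ρ)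
  rw [sub_zero, ← hM, hMb, sub_zero] at hd
  have hG0 : Gv t γ η 0 = Fend t γ := by simp [Gv]
  rw [hG0] at hd
  have hd2 : ‖Gv t γ η b - Fend t γ‖ ≤ 288 * t ^ 3 * ρ * (ρ / 2) :=
    hd.trans (mul_le_mul_of_nonneg_left hbn hc0)
  rw [mem_interior_iff_mem_nhds, Metric.mem_nhds_iff]
  refine ⟨(N - 2 * (288 * t ^ 3 * ρ)) * (ρ / 2), mul_pos (by linarith) (by positivity), ?_⟩
  intro z hz
  have hz2 : z ∈ closedBall (Gv t γ η b) ((N - 288 * t ^ 3 * ρ) * (ρ / 2)) := by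
    rw [mem_closedBall]
    have := dist_triangle z (Fend t γ) (Gv t γ η b)
    rw [dist_comm (Fend t γ), dist_eq_norm (Gv t γ η b)] at this
    rw [mem_ball] at hz
    nlinarith
  obtain ⟨x, hx, rfl⟩ := hsurj hz2
  have hxi : ∀ i, |x i - ρ / 2| ≤ ρ / 2 := fun i => by
    rw [mem_closedBall, dist_eq_norm] at hx
    exact (norm_le_pi_norm (x - b) i).trans hx
  refine ⟨_, adm_comb h hη (fun i => ?_) ?_, rfl⟩
  · have := (abs_le.1 (hxi i)).1; linarith
  · calc ∑ i, x i ≤ ∑ i : Fin 6, ρ := Finset.sum_le_sum fun i _ => by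
          have := (abs_le.1 (hxi i)).2; linarith
      _ = 6 * ρ := by simp
      _ ≤ 1 := hρ1


theorem sep3 {D : Set (ℝ × ℝ × ℝ)} (hD : Convex ℝ D) (h0 : (0 : ℝ × ℝ × ℝ) ∈ D)
    (hi : (0 : ℝ × ℝ × ℝ) ∉ interior D) :
    ∃ f : (ℝ × ℝ × ℝ) →ₗ[ℝ] ℝ, f ≠ 0 ∧ ∀ d ∈ D, f d ≤ 0 := by
  by_cases hne : (interior D).Nonempty
  · obtain ⟨f, hf, h⟩ := geometric_hahn_banach_of_nonempty_interior_point hD hi hne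
    refine ⟨f.toLinearMap, ?_, fun d hd => by simpa using h d hd⟩
    intro h
    exact hf (ContinuousLinearMap.coe_injective h)
  · have hs : Submodule.span ℝ D < ⊤ := by
      rw [lt_top_iff_ne_top]
      intro hs
      apply hne
      rw [hD.interior_nonempty_iff_affineSpan_eq_top]
      rw [AffineSubspace.affineSpan_eq_top_iff_vectorSpan_eq_top_of_nonempty ℝ _ _ ⟨0, h0⟩,
        vectorSpan_eq_span_vsub_set_right ℝ h0]
      simpa using hs
    obtain ⟨f, hf, h⟩ := Submodule.exists_le_ker_of_lt_top _ hs
    refine ⟨f, hf, fun d hd => ?_⟩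
    have := h (Submodule.subset_span hd)
    rw [LinearMap.mem_ker] at this
    exact this.le

theorem dF_convex {t : ℝ} {γ : ℝ → ℝ} (h : Adm γ) :
    Convex ℝ {v | ∃ η, Adm η ∧ dF t γ (fun s => η s - γ s) = v} := by
  rintro _ ⟨η₁, h1, rfl⟩ _ ⟨η₂, h2, rfl⟩ x y hx hy hxy
  refine ⟨fun s => x * η₁ s + y * η₂ s, adm_of (fun u v huv => ?_) ?_, ?_⟩
  · have := mul_le_mul_of_nonneg_left (h1.up huv) hx
    have := mul_le_mul_of_nonneg_left (h1.down huv) hx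
    have := mul_le_mul_of_nonneg_left (h2.up huv) hy
    have := mul_le_mul_of_nonneg_left (h2.down huv) hy
    have e : x * (v - u) + y * (v - u) = v - u := by rw [← add_mul, hxy, one_mul]
    rw [abs_le]
    constructor <;> linarith
  · simp [h1.2, h2.2]
  · have c0 := h.cont
    have c1 := h1.cont
    have c2 := h2.cont
    have hy' : y = 1 - x := by linarith
    simp only [dF, Prod.smul_mk, Prod.mk_add_mk, smul_eq_mul]
    rw [← intervalIntegral.integral_const_mul, ← intervalIntegral.integral_const_mul,
      ← intervalIntegral.integral_const_mul, ← intervalIntegral.integral_const_mul,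
      ← intervalIntegral.integral_add, ← intervalIntegral.integral_add]
    · refine Prod.ext ?_ (Prod.ext ?_ ?_)
      · simp only; congr 1; ext s; rw [hy']; ring
      · simp only; congr 1; ext s; rw [hy']; ring
      · simp only; rw [hy']; ring
    all_goals exact Continuous.intervalIntegrable (by fun_prop) _ _

theorem pmp {t : ℝ} (ht : 0 < t) {γ : ℝ → ℝ} (h : Adm γ)
    (hb : Fend t γ ∉ interior (Fend t '' {γ | Adm γ})) :
    ∃ a b l : ℝ, (a ≠ 0 ∨ b ≠ 0 ∨ l ≠ 0) ∧ ∀ η, Adm η →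
      (∫ s in (0:ℝ)..t, (-a * Real.sin (γ s) + b * Real.cos (γ s)) * (η s - γ s)) + l * (η t - γ t) ≤ 0 := by
  set D : Set (ℝ × ℝ × ℝ) := {v | ∃ η, Adm η ∧ dF t γ (fun s => η s - γ s) = v} with hDdef
  have h0 : (0 : ℝ × ℝ × ℝ) ∈ D := ⟨γ, h, by simp [dF]⟩
  have hi : (0 : ℝ × ℝ × ℝ) ∉ interior D := by
    intro hi
    apply hb
    rw [mem_interior_iff_mem_nhds, Metric.mem_nhds_iff] at hi
    obtain ⟨ε, hε, hs⟩ := hi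
    have hr : 0 < ε / 2 := by linarith
    set r := ε / 2 with hrdef
    have hre : r < ε := by linarith
    have key : ∀ v : ℝ × ℝ × ℝ, ‖v‖ ≤ r → ∃ η, Adm η ∧ dF t γ (fun s => η s - γ s) = v := by
      intro v hv
      exact hs (by rw [mem_ball_zero_iff]; linarith)
    set V : Fin 6 → ℝ × ℝ × ℝ := ![(r,0,0),(-r,0,0),(0,r,0),(0,-r,0),(0,0,r),(0,0,-r)] with hV
    have hk : ∀ i, ∃ η, Adm η ∧ dF t γ (fun s => η s - γ s) = V i := by
      intro i
      apply key
      fin_cases i <;> simp [hV, Prod.norm_def, abs_of_pos hr, hr.le]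
    choose η hη hηV using hk
    have e : (fun i => dF t γ (fun s => η i s - γ s)) = V := funext hηV
    refine interior_of_surj ht h hη ?_ ?_
    · rw [e]
      rw [LinearMap.range_eq_top]
      rintro ⟨y1, y2, y3⟩
      refine ⟨![y1/r,0,y2/r,0,y3/r,0], ?_⟩
      have : (Mv V) ![y1/r,0,y2/r,0,y3/r,0] = (y1, y2, y3) := by
        rw [Mv_apply]
        simp [Fin.sum_univ_six, hV, hr.ne']
      exact this
    · rw [e, Mv_apply]
      simp [Fin.sum_univ_six, hV]
  obtain ⟨f, hf, hfD⟩ := sep3 (dF_convex h) h0 hi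
  have ef : ∀ x y z, f (x, y, z) = f (1,0,0) * x + f (0,1,0) * y + f (0,0,1) * z := by
    intro x y z
    have : (x, y, z) = x • ((1:ℝ), (0:ℝ), (0:ℝ)) + y • ((0:ℝ), (1:ℝ), (0:ℝ)) + z • ((0:ℝ), (0:ℝ), (1:ℝ)) := by simp
    rw [this, map_add, map_add, map_smul, map_smul, map_smul]
    simp only [smul_eq_mul]; ring
  refine ⟨f (1,0,0), f (0,1,0), f (0,0,1), ?_, fun η hη => ?_⟩
  · by_contra hcon
    push Not at hcon
    apply hf
    refine LinearMap.ext fun ⟨x, y, z⟩ => ?_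
    rw [ef]; simp [hcon]
  · have := hfD _ ⟨η, hη, rfl⟩
    rw [dF, ef] at this
    have c0 := h.cont
    have c1 := hη.cont
    rw [← intervalIntegral.integral_const_mul, ← intervalIntegral.integral_const_mul,
      ← intervalIntegral.integral_add] at this
    · refine le_trans (le_of_eq ?_) this
      congr 1
      refine intervalIntegral.integral_congr fun s _ => ?_
      ring
    all_goals exact Continuous.intervalIntegrable (by fun_prop) _ _


structure Ex (t l W : ℝ) (w γ : ℝ → ℝ) : Prop where
  ht : 0 < t
  adm : Adm γ
  wc : Continuous w
  wb : ∀ s, |w s| ≤ W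
  opt : ∀ η, Adm η → (∫ s in (0:ℝ)..t, w s * (η s - γ s)) + l * (η t - γ t) ≤ 0

def Psi (t l : ℝ) (w : ℝ → ℝ) (s : ℝ) : ℝ := l + ∫ x in s..t, w x

theorem Ex.neg {t l W : ℝ} {w γ : ℝ → ℝ} (E : Ex t l W w γ) :
    Ex t (-l) W (fun s => - w s) (fun s => - γ s) := by
  refine ⟨E.ht, E.adm.neg, E.wc.neg, fun s => by rw [abs_neg]; exact E.wb s, fun η hη => ?_⟩
  have := E.opt _ hη.neg
  refine le_trans (le_of_eq ?_) this
  congr 1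
  · refine intervalIntegral.integral_congr fun s _ => ?_
    ring
  · ring

theorem Psi_neg (t l : ℝ) (w : ℝ → ℝ) (s : ℝ) : Psi t (-l) (fun s => - w s) s = - Psi t l w s := by
  simp only [Psi, intervalIntegral.integral_neg]; ring

theorem Psi_deriv {t l : ℝ} {w : ℝ → ℝ} (hw : Continuous w) (s : ℝ) :
    HasDerivAt (Psi t l w) (- w s) s := by
  have := intervalIntegral.integral_hasDerivAt_left (hw.intervalIntegrable s t)
    hw.stronglyMeasurable.stronglyMeasurableAtFilter hw.continuousAt
  exact this.const_add l

theorem Psi_cont {t l : ℝ} {w : ℝ → ℝ} (hw : Continuous w) : Continuous (Psi t l w) :=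
  continuous_iff_continuousAt.2 fun s => (Psi_deriv hw s).continuousAt

theorem Ex.back {t l W : ℝ} {w γ : ℝ → ℝ} (E : Ex t l W w γ) {x y : ℝ} (hx : 0 ≤ x) (hxy : x < y)
    (hy : y ≤ t) (hP : W * (y - x) < Psi t l w y) : γ y - γ x = y - x := by
  set D := (y - x) - (γ y - γ x) with hD
  have hγ := E.adm
  have hD0 : 0 ≤ D := by have := hγ.up hxy.le; linarith
  set g2 : ℝ → ℝ := glue y (fun s => s + (γ x - x)) (fun s => γ (s + 0) + D) with hg2
  have e2 : (fun s => s + (γ x - x)) y = (fun s => γ (s + 0) + D) y := by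
    simp only [add_zero, hD]; ring
  have l2 : LipschitzWith 1 g2 := glue_lip e2 (id_lip _) (shift_lip hγ.1 _ _)
  set η := glue x γ g2 with hη
  have e1 : γ x = g2 x := by rw [hg2, glue_left hxy.le]; ring
  have v1 : ∀ s, s ≤ x → η s = γ s := fun s hs => glue_left hs
  have v2 : ∀ s, x ≤ s → s ≤ y → η s = γ x + (s - x) := fun s h1 h2 => by
    rw [hη, glue_right e1 h1, hg2, glue_left h2]; ring
  have v3 : ∀ s, y ≤ s → η s = γ s + D := fun s h1 => by
    rw [hη, glue_right e1 (hxy.le.trans h1), hg2, glue_right e2 h1, add_zero]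
  have aη : Adm η := ⟨glue_lip e1 hγ.1 l2, by rw [v1 0 hx]; exact hγ.2⟩
  have hc : Continuous (fun s => w s * (η s - γ s)) := E.wc.mul (aη.cont.sub hγ.cont)
  have ho := E.opt η aη
  rw [v3 t hy, ← intervalIntegral.integral_add_adjacent_intervals (hc.intervalIntegrable 0 x) (hc.intervalIntegrable x t),
    ← intervalIntegral.integral_add_adjacent_intervals (hc.intervalIntegrable x y) (hc.intervalIntegrable y t)] at ho
  have i1 : ∫ s in (0:ℝ)..x, w s * (η s - γ s) = 0 := by
    rw [intervalIntegral.integral_congr (g := fun _ => (0:ℝ))]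
    · simp
    · intro s hs
      rw [uIcc_of_le hx] at hs
      simp [v1 s hs.2]
  have i3 : ∫ s in y..t, w s * (η s - γ s) = (∫ s in y..t, w s) * D := by
    rw [← intervalIntegral.integral_mul_const]
    refine intervalIntegral.integral_congr fun s hs => ?_
    rw [uIcc_of_le hy] at hs
    simp [v3 s hs.1]
  have i2 : ‖∫ s in x..y, w s * (η s - γ s)‖ ≤ (W * D) * |y - x| := by
    refine intervalIntegral.norm_integral_le_of_norm_le_const fun s hs => ?_
    rw [uIoc_of_le hxy.le] at hs
    rw [v2 s hs.1.le hs.2, Real.norm_eq_abs, abs_mul]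
    have a1 := hγ.up hs.1.le
    have a2 := hγ.up hs.2
    refine mul_le_mul (E.wb s) ?_ (abs_nonneg _) ((abs_nonneg _).trans (E.wb s))
    rw [abs_of_nonneg (by linarith)]; linarith
  rw [Real.norm_eq_abs, abs_of_pos (sub_pos.2 hxy), abs_le] at i2
  rw [i1, i3] at ho
  have hPs : Psi t l w y = l + ∫ s in y..t, w s := rfl
  by_contra hne
  have hDpos : 0 < D := lt_of_le_of_ne hD0 (fun h => hne (by linarith))
  have := mul_lt_mul_of_pos_right hP hDpos
  rw [hPs] at this
  linarith [i2.1]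

theorem Ex.der_pos {t l W : ℝ} {w γ : ℝ → ℝ} (E : Ex t l W w γ) {s : ℝ} (h0 : 0 < s) (h1 : s < t)
    (hP : 0 < Psi t l w s) : HasDerivAt γ 1 s := by
  have hW : 0 ≤ W := (abs_nonneg _).trans (E.wb 0)
  have ev1 : ∀ᶠ y in nhds s, W * |y - s| < Psi t l w y := by
    have c1 : Continuous fun y => W * |y - s| := by fun_prop
    refine c1.continuousAt.eventually_lt (Psi_cont E.wc).continuousAt ?_
    simpa using hP
  have ev2 : ∀ᶠ y in nhds s, W * |y - s| < Psi t l w s := by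
    have c1 : Continuous fun y => W * |y - s| := by fun_prop
    refine c1.continuousAt.eventually_lt continuousAt_const ?_
    simpa using hP
  have ev : γ =ᶠ[nhds s] fun y => y + (γ s - s) := by
    filter_upwards [ev1, ev2, Ioo_mem_nhds h0 h1] with y y1 y2 y3
    rcases lt_trichotomy y s with h | h | h
    · rw [abs_of_neg (sub_neg.2 h)] at y2
      have := E.back y3.1.le h h1.le (by linarith)
      linarith
    · rw [h]; ring
    · rw [abs_of_pos (sub_pos.2 h)] at y1
      have := E.back h0.le h y3.2.le y1
      linarith
  exact ((hasDerivAt_id' s).add_const _).congr_of_eventuallyEq ev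

theorem Ex.slope_pos {t l W : ℝ} {w γ : ℝ → ℝ} (E : Ex t l W w γ) {s₁ s₂ : ℝ} (h0 : 0 ≤ s₁)
    (h1 : s₂ ≤ t) (hP : ∀ s ∈ Ioo s₁ s₂, 0 < Psi t l w s) :
    ∀ s ∈ Icc s₁ s₂, γ s = γ s₁ + (s - s₁) := by
  intro s hs
  rcases hs.1.eq_or_lt with h | h
  · rw [← h]; ring
  obtain ⟨c, hc, e⟩ := exists_hasDerivAt_eq_slope γ (fun _ => 1) h E.adm.cont.continuousOn
    (fun x hx => E.der_pos (h0.trans_lt hx.1) (hx.2.trans_le (hs.2.trans h1)) (hP x ⟨hx.1, hx.2.trans_le hs.2⟩))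
  have : s - s₁ ≠ 0 := (sub_pos.2 h).ne'
  field_simp at e
  linarith

theorem Ex.der_neg {t l W : ℝ} {w γ : ℝ → ℝ} (E : Ex t l W w γ) {s : ℝ} (h0 : 0 < s) (h1 : s < t)
    (hP : Psi t l w s < 0) : HasDerivAt γ (-1) s := by
  have := (E.neg.der_pos h0 h1 (by rw [Psi_neg]; linarith)).neg
  have e : (-fun s => - γ s) = γ := by funext u; simp
  rwa [e] at this

theorem Ex.slope_neg {t l W : ℝ} {w γ : ℝ → ℝ} (E : Ex t l W w γ) {s₁ s₂ : ℝ} (h0 : 0 ≤ s₁)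
    (h1 : s₂ ≤ t) (hP : ∀ s ∈ Ioo s₁ s₂, Psi t l w s < 0) :
    ∀ s ∈ Icc s₁ s₂, γ s = γ s₁ - (s - s₁) := by
  intro s hs
  have := E.neg.slope_pos h0 h1 (fun s hs => by rw [Psi_neg]; linarith [hP s hs]) s hs
  linarith


theorem sign_of_deriv {f : ℝ → ℝ} {d s : ℝ} (h : HasDerivAt f d s) (hd : 0 < d) (h0 : f s = 0) :
    ∀ᶠ u in nhds s, (s < u → 0 < f u) ∧ (u < s → f u < 0) := by
  have h1 := hasDerivAt_iff_tendsto_slope.1 h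
  have h2 := h1.eventually (lt_mem_nhds hd)
  rw [eventually_nhdsWithin_iff] at h2
  filter_upwards [h2] with u hu
  constructor
  · intro hsu
    have := hu hsu.ne'
    rw [slope_def_field, h0, sub_zero] at this
    by_contra hc
    exact absurd this (not_lt.2 (div_nonpos_of_nonpos_of_nonneg (not_lt.1 hc) (sub_pos.2 hsu).le))
  · intro hsu
    have := hu hsu.ne
    rw [slope_def_field, h0, sub_zero] at this
    by_contra hc
    exact absurd this (not_lt.2 (div_nonpos_of_nonneg_of_nonpos (not_lt.1 hc) (sub_neg.2 hsu).le))

/-- extremal with explicit weights -/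
def Xt (t a b l : ℝ) (γ : ℝ → ℝ) : Prop :=
  Ex t l (|a| + |b|) (fun s => -a * Real.sin (γ s) + b * Real.cos (γ s)) γ

def ww (a b : ℝ) (γ : ℝ → ℝ) (s : ℝ) : ℝ := -a * Real.sin (γ s) + b * Real.cos (γ s)
def PP (a b x : ℝ) : ℝ := a * Real.cos x + b * Real.sin x
/-- switching function -/
def psi (t a b l : ℝ) (γ : ℝ → ℝ) (s : ℝ) : ℝ := Psi t l (ww a b γ) s

theorem PP_deriv (a b x : ℝ) : HasDerivAt (PP a b) (-a * Real.sin x + b * Real.cos x) x := by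
  have := ((Real.hasDerivAt_cos x).const_mul a).add ((Real.hasDerivAt_sin x).const_mul b)
  have e : a * -Real.sin x + b * Real.cos x = -a * Real.sin x + b * Real.cos x := by ring
  rw [e] at this
  exact this

theorem xt_of {t a b l : ℝ} (ht : 0 < t) {γ : ℝ → ℝ} (h : Adm γ) (ho : ∀ η, Adm η →
      (∫ s in (0:ℝ)..t, (-a * Real.sin (γ s) + b * Real.cos (γ s)) * (η s - γ s)) + l * (η t - γ t) ≤ 0) :
    Xt t a b l γ := by
  have := h.cont
  refine ⟨ht, h, by fun_prop, fun s => ?_, ho⟩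
  refine (abs_add_le _ _).trans ?_
  rw [abs_mul, abs_mul, abs_neg]
  exact add_le_add (mul_le_of_le_one_right (abs_nonneg _) (Real.abs_sin_le_one _))
    (mul_le_of_le_one_right (abs_nonneg _) (Real.abs_cos_le_one _))

section
variable {t a b l : ℝ} {γ : ℝ → ℝ}

theorem Xt.adm (E : Xt t a b l γ) : Adm γ := Ex.adm E
theorem Xt.ht (E : Xt t a b l γ) : 0 < t := Ex.ht E
theorem Xt.neg (E : Xt t a b l γ) : Xt t a (-b) (-l) (fun s => - γ s) := by
  have := Ex.neg E
  unfold Xt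
  convert this using 2
  · simp
  · simp; ring

theorem psi_neg (s : ℝ) : psi t a (-b) (-l) (fun s => - γ s) s = - psi t a b l γ s := by
  unfold psi
  rw [← Psi_neg]
  congr 1
  funext s
  simp [ww]; ring

theorem Xt.psi_deriv (E : Xt t a b l γ) (s : ℝ) : HasDerivAt (psi t a b l γ) (- ww a b γ s) s :=
  Psi_deriv (Ex.wc E) s
theorem Xt.psi_cont (E : Xt t a b l γ) : Continuous (psi t a b l γ) := Psi_cont (Ex.wc E)
theorem Xt.w_cont (E : Xt t a b l γ) : Continuous (ww a b γ) := Ex.wc E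

theorem Xt.H_der_pos (E : Xt t a b l γ) {s s₂ : ℝ} (h0 : 0 ≤ s) (hs : s < s₂) (h2 : s₂ ≤ t)
    (hP : ∀ u ∈ Ioo s s₂, 0 < psi t a b l γ u) :
    HasDerivWithinAt (fun u => |psi t a b l γ u| + PP a b (γ u)) 0 (Ici s) s := by
  have hsl := Ex.slope_pos E h0 h2 hP
  have hPs : ∀ u ∈ Ico s s₂, 0 ≤ psi t a b l γ u := by
    have : Icc s s₂ ⊆ {u | 0 ≤ psi t a b l γ u} := by
      rw [← closure_Ioo hs.ne]
      exact closure_minimal (fun u hu => (hP u hu).le) (isClosed_le continuous_const E.psi_cont)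
    exact fun u hu => this ⟨hu.1, hu.2.le⟩
  have d1 : HasDerivAt (fun u => psi t a b l γ u + PP a b (γ s + (u - s))) 0 s := by
    have e1 : HasDerivAt (fun u => γ s + (u - s)) 1 s := ((hasDerivAt_id' s).sub_const s).const_add _
    have e2 : HasDerivAt (PP a b) (ww a b γ s) (γ s + (s - s)) := by
      rw [sub_self, add_zero]; exact PP_deriv a b _
    have := (E.psi_deriv s).add (e2.comp s e1)
    have e : -ww a b γ s + ww a b γ s * 1 = 0 := by ring
    rw [e] at this
    exact this
  refine d1.hasDerivWithinAt.congr_of_eventuallyEq_of_mem ?_ self_mem_Ici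
  filter_upwards [Ico_mem_nhdsGE hs] with u hu
  rw [abs_of_nonneg (hPs u hu), hsl u ⟨hu.1, hu.2.le⟩]

theorem Xt.H_der_neg (E : Xt t a b l γ) {s s₂ : ℝ} (h0 : 0 ≤ s) (hs : s < s₂) (h2 : s₂ ≤ t)
    (hP : ∀ u ∈ Ioo s s₂, psi t a b l γ u < 0) :
    HasDerivWithinAt (fun u => |psi t a b l γ u| + PP a b (γ u)) 0 (Ici s) s := by
  have := E.neg.H_der_pos h0 hs h2 (fun u hu => by rw [psi_neg]; linarith [hP u hu])
  convert this using 2 with u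
  rw [psi_neg, abs_neg]
  simp [PP]

theorem Xt.right_pos (E : Xt t a b l γ) {s : ℝ} (hs : s < t)
    (h : ∀ᶠ u in nhds s, s < u → 0 < psi t a b l γ u) :
    ∃ s₂, s < s₂ ∧ s₂ ≤ t ∧ ∀ u ∈ Ioo s s₂, 0 < psi t a b l γ u := by
  obtain ⟨ε, hε, h⟩ := Metric.eventually_nhds_iff.1 h
  refine ⟨min t (s + ε), lt_min hs (by linarith), min_le_left _ _, fun u hu => h ?_ hu.1⟩
  have := hu.2.trans_le (min_le_right _ _)
  rw [Real.dist_eq, abs_lt]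
  constructor <;> linarith [hu.1]

theorem Xt.H_const (E : Xt t a b l γ) : ∀ s ∈ Icc 0 t,
    |psi t a b l γ s| + PP a b (γ s) = |psi t a b l γ 0| + PP a b (γ 0) := by
  have key : ∀ {b l γ}, Xt t a b l γ → ∀ s ∈ Ico 0 t, (0 < psi t a b l γ s ∨ (psi t a b l γ s = 0 ∧ ww a b γ s < 0)) →
     HasDerivWithinAt (fun u => |psi t a b l γ u| + PP a b (γ u)) 0 (Ici s) s := by
    intro b l γ E s hs h
    have : ∀ᶠ u in nhds s, s < u → 0 < psi t a b l γ u := by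
      rcases h with h | ⟨h, h'⟩
      · filter_upwards [E.psi_cont.continuousAt.eventually (lt_mem_nhds h)] with u hu _
        exact hu
      · filter_upwards [sign_of_deriv (E.psi_deriv s) (by linarith) h] with u hu
        exact hu.1
    obtain ⟨s₂, h1, h2, h3⟩ := E.right_pos hs.2 this
    exact E.H_der_pos hs.1 h1 h2 h3
  have hPc : Continuous (PP a b) := by unfold PP; fun_prop
  refine constant_of_has_deriv_right_zero
    ((E.psi_cont.abs.add (hPc.comp E.adm.cont)).continuousOn) fun s hs => ?_
  by_cases c1 : 0 < psi t a b l γ s ∨ (psi t a b l γ s = 0 ∧ ww a b γ s < 0)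
  · exact key E s hs c1
  by_cases c2 : psi t a b l γ s < 0 ∨ (psi t a b l γ s = 0 ∧ 0 < ww a b γ s)
  · have := key E.neg s hs (by
      rw [psi_neg]
      rcases c2 with c2 | ⟨c2, c3⟩
      · left; linarith
      · right; refine ⟨by linarith, ?_⟩
        simp [ww] at c3 ⊢; linarith)
    have e : (fun u => |psi t a (-b) (-l) (fun s => -γ s) u| + PP a (-b) (-γ u)) =
        fun u => |psi t a b l γ u| + PP a b (γ u) := by
      funext u
      rw [psi_neg, abs_neg]
      simp [PP]
    rwa [e] at this
  have hψ : psi t a b l γ s = 0 := by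
    push Not at c1 c2
    linarith [c1.1, c2.1]
  have hw : ww a b γ s = 0 := by
    push Not at c1 c2
    linarith [c1.2 hψ, c2.2 hψ]
  have o1 : (fun u => |psi t a b l γ u|) =o[nhds s] fun u => u - s := by
    have := (hasDerivAt_iff_isLittleO.1 (E.psi_deriv s))
    simp only [hψ, hw, neg_zero, smul_zero, sub_zero] at this
    exact this.norm_left
  have o2 : (fun u => PP a b (γ u) - PP a b (γ s)) =o[nhds s] fun u => u - s := by
    have := (hasDerivAt_iff_isLittleO.1 (PP_deriv a b (γ s)))
    have e : -a * Real.sin (γ s) + b * Real.cos (γ s) = 0 := hw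
    simp only [e, smul_zero, sub_zero] at this
    have := this.comp_tendsto (E.adm.cont.tendsto s)
    refine this.trans_isBigO (Asymptotics.IsBigO.of_bound 1 (Filter.Eventually.of_forall fun u => ?_))
    simp only [Function.comp, Real.norm_eq_abs, one_mul]
    exact E.adm.lip u s
  have : HasDerivAt (fun u => |psi t a b l γ u| + PP a b (γ u)) 0 s := by
    rw [hasDerivAt_iff_isLittleO]
    refine (o1.add o2).congr_left fun u => ?_
    simp only [hψ, abs_zero, smul_zero]; ring
  exact this.hasDerivWithinAt

end


theorem int_split3 {f : ℝ → ℝ} (hf : Continuous f) (a b c d : ℝ) :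
    ∫ s in a..d, f s = (∫ s in a..b, f s) + (∫ s in b..c, f s) + ∫ s in c..d, f s := by
  rw [intervalIntegral.integral_add_adjacent_intervals (hf.intervalIntegrable _ _) (hf.intervalIntegrable _ _),
    intervalIntegral.integral_add_adjacent_intervals (hf.intervalIntegrable _ _) (hf.intervalIntegrable _ _)]

theorem int_cong {f g : ℝ → ℝ} {a b : ℝ} (hab : a ≤ b) (h : ∀ s, a ≤ s → s ≤ b → f s = g s) :
    ∫ s in a..b, f s = ∫ s in a..b, g s :=
  intervalIntegral.integral_congr fun s hs => by
    rw [uIcc_of_le hab] at hs; exact h s hs.1 hs.2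

theorem swap_move {t : ℝ} {γ : ℝ → ℝ} (h : Adm γ) {s₁ s₂ s₃ : ℝ} (h0 : 0 ≤ s₁) (h12 : s₁ ≤ s₂)
    (h23 : s₂ ≤ s₃) (h3 : s₃ ≤ t) (e1 : γ s₁ = γ s₂) (e2 : γ s₃ = γ s₂) :
    ∃ η, Adm η ∧ Fend t η = Fend t γ ∧ (∫ s in (0:ℝ)..t, η s) = (∫ s in (0:ℝ)..t, γ s) ∧
      (∫ s in (0:ℝ)..t, s * η s) = (∫ s in (0:ℝ)..t, s * γ s) +
        ((s₃ - s₂) * (∫ s in s₁..s₂, γ s) - (s₂ - s₁) * ∫ s in s₂..s₃, γ s) := by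
  set d1 := s₂ - s₁ with hd1
  set d2 := s₃ - s₂ with hd2
  set m := s₁ + d2 with hm
  set g3 := glue s₃ (fun s => γ (s + -d2) + 0) γ with hg3
  have c3 : (fun s => γ (s + -d2) + 0) s₃ = γ s₃ := by
    simp only [add_zero, e2]; congr 1; rw [hd2]; ring
  set g2 := glue m (fun s => γ (s + d1) + 0) g3 with hg2
  have c2 : (fun s => γ (s + d1) + 0) m = g3 m := by
    rw [hg3, glue_left (by linarith)]
    simp only [add_zero]
    rw [show m + d1 = s₃ by rw [hm, hd1, hd2]; ring, show m + -d2 = s₁ by rw [hm]; ring, e2, e1]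
  have c1 : γ s₁ = g2 s₁ := by
    rw [hg2, glue_left (by linarith)]
    simp only [add_zero]
    rw [e1]; congr 1; rw [hd1]; ring
  set η := glue s₁ γ g2 with hη
  have v1 : ∀ s, s ≤ s₁ → η s = γ s := fun s hs => glue_left hs
  have v2 : ∀ s, s₁ ≤ s → s ≤ m → η s = γ (s + d1) := fun s a1 a2 => by
    rw [hη, glue_right c1 a1, hg2, glue_left a2, add_zero]
  have v3 : ∀ s, m ≤ s → s ≤ s₃ → η s = γ (s + -d2) := fun s a1 a2 => by
    rw [hη, glue_right c1 (by linarith), hg2, glue_right c2 a1, hg3, glue_left a2, add_zero]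
  have v4 : ∀ s, s₃ ≤ s → η s = γ s := fun s a1 => by
    rw [hη, glue_right c1 (by linarith), hg2, glue_right c2 (by linarith), hg3, glue_right c3 a1]
  have aη : Adm η := ⟨glue_lip c1 h.1 (glue_lip c2 (shift_lip h.1 _ _) (glue_lip c3 (shift_lip h.1 _ _) h.1)),
    by rw [v1 0 h0]; exact h.2⟩
  have hcη := aη.cont
  have hcγ := h.cont
  have key : ∀ F : ℝ → ℝ → ℝ, Continuous F.uncurry → ∫ s in (0:ℝ)..t, F s (η s) =
      (∫ s in (0:ℝ)..t, F s (γ s)) + ((∫ s in s₁..s₂, F (s + d2) (γ s) - F s (γ s)) +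
      ∫ s in s₂..s₃, F (s - d1) (γ s) - F s (γ s)) := by
    intro F hF
    have k1 : Continuous fun s => F s (η s) := hF.comp (continuous_id.prodMk hcη)
    have k2 : Continuous fun s => F s (γ s) := hF.comp (continuous_id.prodMk hcγ)
    have k3 : Continuous fun s => F (s + d2) (γ s) :=
      hF.comp ((continuous_id.add continuous_const).prodMk hcγ)
    have k4 : Continuous fun s => F (s - d1) (γ s) :=
      hF.comp ((continuous_id.sub continuous_const).prodMk hcγ)
    rw [int_split3 k1 0 s₁ s₃ t, int_split3 k2 0 s₁ s₃ t,
      ← intervalIntegral.integral_add_adjacent_intervals (k1.intervalIntegrable s₁ m) (k1.intervalIntegrable m s₃),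
      ← intervalIntegral.integral_add_adjacent_intervals (k2.intervalIntegrable s₁ s₂) (k2.intervalIntegrable s₂ s₃),
      intervalIntegral.integral_sub (k3.intervalIntegrable _ _) (k2.intervalIntegrable _ _),
      intervalIntegral.integral_sub (k4.intervalIntegrable _ _) (k2.intervalIntegrable _ _)]
    have j1 : ∫ s in (0:ℝ)..s₁, F s (η s) = ∫ s in (0:ℝ)..s₁, F s (γ s) :=
      int_cong h0 fun s _ hs => by rw [v1 s hs]
    have j4 : ∫ s in s₃..t, F s (η s) = ∫ s in s₃..t, F s (γ s) :=
      int_cong h3 fun s hs _ => by rw [v4 s hs]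
    have j2 : ∫ s in s₁..m, F s (η s) = ∫ s in s₂..s₃, F (s - d1) (γ s) := by
      rw [int_cong (g := fun s => F (s + d1 - d1) (γ (s + d1))) (by linarith) fun s a1 a2 => by rw [v2 s a1 a2, add_sub_cancel_right]]
      rw [intervalIntegral.integral_comp_add_right (fun s => F (s - d1) (γ s))]
      congr 1 <;> rw [hd1] <;> linarith
    have j3 : ∫ s in m..s₃, F s (η s) = ∫ s in s₁..s₂, F (s + d2) (γ s) := by
      rw [int_cong (g := fun s => F (s + -d2 + d2) (γ (s + -d2))) (by linarith) fun s a1 a2 => by rw [v3 s a1 a2, neg_add_cancel_right]]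
      rw [intervalIntegral.integral_comp_add_right (fun s => F (s + d2) (γ s))]
      congr 1 <;> linarith
    rw [j1, j2, j3, j4]; ring
  refine ⟨η, aη, ?_, ?_, ?_⟩
  · refine Prod.ext ?_ (Prod.ext ?_ ?_)
    · have := key (fun _ x => Real.cos x) (by fun_prop)
      simpa [Fend] using this
    · have := key (fun _ x => Real.sin x) (by fun_prop)
      simpa [Fend] using this
    · exact v4 t h3
  · have := key (fun _ x => x) (by fun_prop)
    simpa using this
  · have := key (fun s x => s * x) (by fun_prop)
    rw [this, ← intervalIntegral.integral_const_mul]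
    rw [sub_eq_add_neg, ← intervalIntegral.integral_const_mul, ← intervalIntegral.integral_neg]
    congr 2
    · refine intervalIntegral.integral_congr fun s _ => ?_
      ring
    · refine intervalIntegral.integral_congr fun s _ => ?_
      ring

theorem cos_per (x c : ℝ) : ∫ s in x..x + 2 * Real.pi, Real.cos (c + (s - x)) = 0 := by
  have : ∀ s, c + (s - x) = s + (c - x) := fun s => by ring
  simp only [this]
  rw [intervalIntegral.integral_comp_add_right (fun s => Real.cos s), integral_cos,
    show x + 2 * Real.pi + (c - x) = (x + (c - x)) + 2 * Real.pi by ring, Real.sin_add_two_pi, sub_self]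

theorem sin_per (x c : ℝ) : ∫ s in x..x + 2 * Real.pi, Real.sin (c + (s - x)) = 0 := by
  have : ∀ s, c + (s - x) = s + (c - x) := fun s => by ring
  simp only [this]
  rw [intervalIntegral.integral_comp_add_right (fun s => Real.sin s), integral_sin,
    show x + 2 * Real.pi + (c - x) = (x + (c - x)) + 2 * Real.pi by ring, Real.cos_add_two_pi, sub_self]

theorem cos_per' (x c : ℝ) : ∫ s in x..x + 2 * Real.pi, Real.cos (c - (s - x)) = 0 := by
  rw [← cos_per x (-c)]
  refine intervalIntegral.integral_congr fun s _ => ?_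
  rw [← Real.cos_neg]; congr 1; ring

theorem sin_per' (x c : ℝ) : ∫ s in x..x + 2 * Real.pi, Real.sin (c - (s - x)) = 0 := by
  rw [← neg_eq_zero, ← sin_per x (-c), ← intervalIntegral.integral_neg]
  refine intervalIntegral.integral_congr fun s _ => ?_
  rw [← Real.sin_neg]; congr 1; ring

theorem lin_int (x c d : ℝ) : ∫ s in x..x + d, (c + (s - x)) = c * d + d ^ 2 / 2 := by
  rw [intervalIntegral.integral_add (by simp) (by simp), intervalIntegral.integral_sub (by simp) (by simp)]
  simp; ring

theorem lin_int' (x c d : ℝ) : ∫ s in x..x + d, (c - (s - x)) = c * d - d ^ 2 / 2 := by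
  rw [intervalIntegral.integral_sub (by simp) (by simp), intervalIntegral.integral_sub (by simp) (by simp)]
  simp; ring

theorem circ_start {t : ℝ} {γ : ℝ → ℝ} (h : Adm γ) {α : ℝ} (h0 : 0 ≤ α) (h1 : α + 2 * Real.pi ≤ t)
    (hs : ∀ s ∈ Icc α (α + 2 * Real.pi), γ s = γ α + (s - α)) :
    ∃ η, Adm η ∧ Fend t η = Fend t γ ∧
      (∫ s in (0:ℝ)..t, η s) = (∫ s in (0:ℝ)..t, γ s) + 2 * Real.pi * (α - γ α) := by
  have hp := Real.pi_pos
  set p := 2 * Real.pi with hpd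
  have hp' : 0 < p := by linarith
  have c2 : (fun s => γ (s + -p) + p) (α + p) = γ (α + p) := by
    rw [hs (α + p) ⟨by linarith, le_rfl⟩]
    simp
  set g2 := glue (α + p) (fun s => γ (s + -p) + p) γ with hg2
  have c1 : (fun s => s + 0) p = g2 p := by
    rw [hg2, glue_left (by linarith)]; simp [h.2]
  set η := glue p (fun s => s + 0) g2 with hη
  have v1 : ∀ s, s ≤ p → η s = 0 + (s - 0) := fun s hs => by rw [hη, glue_left hs]; ring
  have v2 : ∀ s, p ≤ s → s ≤ α + p → η s = γ (s + -p) + p := fun s a1 a2 => by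
    rw [hη, glue_right c1 a1, hg2, glue_left a2]
  have v3 : ∀ s, α + p ≤ s → η s = γ s := fun s a1 => by
    rw [hη, glue_right c1 (by linarith), hg2, glue_right c2 a1]
  have aη : Adm η := ⟨glue_lip c1 (id_lip _) (glue_lip c2 (shift_lip h.1 _ _) h.1),
    by rw [v1 0 hp'.le]; ring⟩
  have hcη := aη.cont
  have hcγ := h.cont
  have key : ∀ F : ℝ → ℝ, Continuous F → ∫ s in (0:ℝ)..t, F (η s) =
      (∫ s in (0:ℝ)..t, F (γ s)) + ((∫ s in (0:ℝ)..0 + p, F (0 + (s - 0))) - (∫ s in α..α + p, F (γ α + (s - α))) +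
       ∫ s in (0:ℝ)..α, F (γ s + p) - F (γ s)) := by
    intro F hF
    have k1 : Continuous fun s => F (η s) := by fun_prop
    have k2 : Continuous fun s => F (γ s) := by fun_prop
    have k3 : Continuous fun s => F (γ s + p) := by fun_prop
    rw [int_split3 k1 0 p (α + p) t, int_split3 k2 0 α (α + p) t,
      intervalIntegral.integral_sub (k3.intervalIntegrable _ _) (k2.intervalIntegrable _ _)]
    have j1 : ∫ s in (0:ℝ)..p, F (η s) = ∫ s in (0:ℝ)..0 + p, F (0 + (s - 0)) := by
      rw [zero_add]
      exact int_cong hp'.le fun s _ hs => by rw [v1 s hs]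
    have j3 : ∫ s in α + p..t, F (η s) = ∫ s in α + p..t, F (γ s) :=
      int_cong h1 fun s hs _ => by rw [v3 s hs]
    have j4 : ∫ s in α..α + p, F (γ s) = ∫ s in α..α + p, F (γ α + (s - α)) :=
      int_cong (by linarith) fun s a1 a2 => by rw [hs s ⟨a1, a2⟩]
    have j2 : ∫ s in p..α + p, F (η s) = ∫ s in (0:ℝ)..α, F (γ s + p) := by
      rw [int_cong (g := fun s => F (γ (s + -p) + p)) (by linarith) fun s a1 a2 => by rw [v2 s a1 a2]]
      rw [intervalIntegral.integral_comp_add_right (fun s => F (γ s + p))]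
      congr 1 <;> linarith
    rw [j1, j2, j3, j4]; ring
  refine ⟨η, aη, ?_, ?_⟩
  · refine Prod.ext ?_ (Prod.ext ?_ ?_)
    · have := key Real.cos (by fun_prop)
      simp only [hpd, cos_per, Real.cos_add_two_pi] at this
      simpa [Fend] using this
    · have := key Real.sin (by fun_prop)
      simp only [hpd, sin_per, Real.sin_add_two_pi] at this
      simpa [Fend] using this
    · exact v3 t h1
  · have := key (fun x => x) (by fun_prop)
    rw [this, lin_int, lin_int]
    simp; ring

theorem circ_end {t : ℝ} {γ : ℝ → ℝ} (h : Adm γ) {α : ℝ} (h0 : 0 ≤ α) (h1 : α + 2 * Real.pi ≤ t)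
    (hs : ∀ s ∈ Icc α (α + 2 * Real.pi), γ s = γ α - (s - α)) :
    ∃ η, Adm η ∧ Fend t η = Fend t γ ∧
      (∫ s in (0:ℝ)..t, η s) = (∫ s in (0:ℝ)..t, γ s) +
        2 * Real.pi * ((γ t - γ (α + 2 * Real.pi)) + (t - (α + 2 * Real.pi))) := by
  have hp := Real.pi_pos
  set p := 2 * Real.pi with hpd
  have hp' : 0 < p := by linarith
  have eβ : γ (α + p) = γ α - p := by rw [hs (α + p) ⟨by linarith, le_rfl⟩]; ring
  set g2 := glue (t - p) (fun s => γ (s + p) + p) (fun s => (γ t + t) - s) with hg2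
  have c2 : (fun s => γ (s + p) + p) (t - p) = (fun s => (γ t + t) - s) (t - p) := by
    simp only [sub_add_cancel]; ring
  have c1 : γ α = g2 α := by
    rw [hg2, glue_left (by linarith), eβ]; ring
  set η := glue α γ g2 with hη
  have v1 : ∀ s, s ≤ α → η s = γ s := fun s hs => by rw [hη, glue_left hs]
  have v2 : ∀ s, α ≤ s → s ≤ t - p → η s = γ (s + p) + p := fun s a1 a2 => by
    rw [hη, glue_right c1 a1, hg2, glue_left a2]
  have v3 : ∀ s, t - p ≤ s → η s = (γ t + p) - (s - (t - p)) := fun s a1 => by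
    rw [hη, glue_right c1 (by linarith), hg2, glue_right c2 a1]; ring
  have aη : Adm η := ⟨glue_lip c1 h.1 (glue_lip c2 (shift_lip h.1 _ _) (negid_lip _)),
    by rw [v1 0 h0]; exact h.2⟩
  have hcη := aη.cont
  have hcγ := h.cont
  have key : ∀ F : ℝ → ℝ, Continuous F → ∫ s in (0:ℝ)..t, F (η s) =
      (∫ s in (0:ℝ)..t, F (γ s)) + ((∫ s in (t - p)..(t - p) + p, F ((γ t + p) - (s - (t - p)))) - (∫ s in α..α + p, F (γ α - (s - α))) +
       ∫ s in (α + p)..t, F (γ s + p) - F (γ s)) := by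
    intro F hF
    have k1 : Continuous fun s => F (η s) := by fun_prop
    have k2 : Continuous fun s => F (γ s) := by fun_prop
    have k3 : Continuous fun s => F (γ s + p) := by fun_prop
    rw [int_split3 k1 0 α (t - p) t, int_split3 k2 0 α (α + p) t,
      intervalIntegral.integral_sub (k3.intervalIntegrable _ _) (k2.intervalIntegrable _ _)]
    have j3 : ∫ s in (t - p)..t, F (η s) = ∫ s in (t - p)..(t - p) + p, F ((γ t + p) - (s - (t - p))) := by
      rw [sub_add_cancel]
      exact int_cong (by linarith) fun s hs _ => by rw [v3 s hs]
    have j1 : ∫ s in 0..α, F (η s) = ∫ s in 0..α, F (γ s) :=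
      int_cong h0 fun s _ hs => by rw [v1 s hs]
    have j4 : ∫ s in α..α + p, F (γ s) = ∫ s in α..α + p, F (γ α - (s - α)) :=
      int_cong (by linarith) fun s a1 a2 => by rw [hs s ⟨a1, a2⟩]
    have j2 : ∫ s in α..t - p, F (η s) = ∫ s in α + p..t, F (γ s + p) := by
      rw [int_cong (g := fun s => F (γ (s + p) + p)) (by linarith) fun s a1 a2 => by rw [v2 s a1 a2]]
      rw [intervalIntegral.integral_comp_add_right (fun s => F (γ s + p))]
      congr 1; linarith
    rw [j1, j2, j3, j4]; ring
  refine ⟨η, aη, ?_, ?_⟩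
  · refine Prod.ext ?_ (Prod.ext ?_ ?_)
    · have := key Real.cos (by fun_prop)
      simp only [hpd, cos_per', Real.cos_add_two_pi] at this
      simpa [Fend] using this
    · have := key Real.sin (by fun_prop)
      simp only [hpd, sin_per', Real.sin_add_two_pi] at this
      simpa [Fend] using this
    · show η t = γ t
      rw [v3 t (by linarith)]; ring
  · have := key (fun x => x) (by fun_prop)
    rw [this, lin_int', lin_int', eβ]
    simp; ring


def LexMax (t : ℝ) (γ : ℝ → ℝ) : Prop := ∀ η, Adm η → Fend t η = Fend t γ →
  (∫ s in (0:ℝ)..t, η s) ≤ (∫ s in (0:ℝ)..t, γ s) ∧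
  ((∫ s in (0:ℝ)..t, η s) = (∫ s in (0:ℝ)..t, γ s) →
    (∫ s in (0:ℝ)..t, s * η s) ≤ ∫ s in (0:ℝ)..t, s * γ s)

theorem swap_le {t : ℝ} {γ : ℝ → ℝ} (h : Adm γ) (hM : LexMax t γ) {s₁ s₂ s₃ : ℝ} (h0 : 0 ≤ s₁) (h12 : s₁ ≤ s₂)
    (h23 : s₂ ≤ s₃) (h3 : s₃ ≤ t) (e1 : γ s₁ = γ s₂) (e2 : γ s₃ = γ s₂) :
    (s₃ - s₂) * (∫ s in s₁..s₂, γ s) - (s₂ - s₁) * (∫ s in s₂..s₃, γ s) ≤ 0 := by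
  obtain ⟨η, a, b, c, d⟩ := swap_move h h0 h12 h23 h3 e1 e2
  have := (hM η a b).2 c
  linarith

/-- integral over a roof: up by `d` then down by `d` -/
theorem roof {γ : ℝ → ℝ} (hc : Continuous γ) {z d : ℝ} (hd : 0 ≤ d)
    (h1 : ∀ s ∈ Icc (z - d) z, γ s = γ z + (s - z)) (h2 : ∀ s ∈ Icc z (z + d), γ s = γ z - (s - z)) :
    ∫ s in (z - d)..(z + d), γ s = 2 * d * γ z - d ^ 2 := by
  rw [← intervalIntegral.integral_add_adjacent_intervals (hc.intervalIntegrable _ z) (hc.intervalIntegrable _ _)]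
  have i2 : ∫ s in z..z + d, γ s = γ z * d - d ^ 2 / 2 := by
    rw [← lin_int' z]
    exact int_cong (by linarith) fun s a b => h2 s ⟨a, b⟩
  have i1 : ∫ s in (z - d)..z, γ s = (γ z - d) * d + d ^ 2 / 2 := by
    rw [← lin_int (z - d), sub_add_cancel]
    exact int_cong (by linarith) fun s a b => by rw [h1 s ⟨a, b⟩]; ring
  rw [i1, i2]; ring

theorem valley {γ : ℝ → ℝ} (hc : Continuous γ) {z d : ℝ} (hd : 0 ≤ d)
    (h1 : ∀ s ∈ Icc (z - d) z, γ s = γ z - (s - z)) (h2 : ∀ s ∈ Icc z (z + d), γ s = γ z + (s - z)) :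
    ∫ s in (z - d)..(z + d), γ s = 2 * d * γ z + d ^ 2 := by
  have := roof (γ := fun s => - γ s) hc.neg hd (fun s hs => by rw [h1 s hs]; ring) (fun s hs => by rw [h2 s hs]; ring)
  rw [intervalIntegral.integral_neg] at this
  linarith

theorem zig1 {t : ℝ} {γ : ℝ → ℝ} (h : Adm γ) (hM : LexMax t γ) {z₁ z₂ ε D : ℝ} (hε : 0 < ε) (hD : 0 < D)
    (h0 : 0 ≤ z₁ - ε) (hz : z₂ = z₁ + ε + D) (h3 : z₂ + D ≤ t)
    (k1 : ∀ s ∈ Icc (z₁ - ε) z₁, γ s = γ z₁ + (s - z₁)) (k2 : ∀ s ∈ Icc z₁ z₂, γ s = γ z₁ - (s - z₁))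
    (k3 : ∀ s ∈ Icc z₂ (z₂ + D), γ s = γ z₂ + (s - z₂)) : False := by
  have r := roof h.cont hε.le k1 (fun s hs => k2 s ⟨hs.1, by linarith [hs.2]⟩)
  have e2 : γ z₂ = γ z₁ - (z₂ - z₁) := k2 z₂ ⟨by linarith, le_rfl⟩
  have v := valley h.cont hD.le (fun s hs => by
    rw [e2, k2 s ⟨by linarith [hs.1], hs.2⟩]; ring) k3
  have a1 : γ (z₁ - ε) = γ z₁ - ε := by rw [k1 _ ⟨le_rfl, by linarith⟩]; ring
  have a2 : γ (z₁ + ε) = γ z₁ - ε := by rw [k2 _ ⟨by linarith, by linarith⟩]; ring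
  have a3 : γ (z₂ + D) = γ z₁ - ε := by rw [k3 _ ⟨by linarith, by linarith⟩, e2, hz]; ring
  have hm : z₂ - D = z₁ + ε := by linarith
  have := swap_le h hM h0 (by linarith : z₁ - ε ≤ z₁ + ε) (by linarith) h3 (a1.trans a2.symm) (a3.trans a2.symm)
  rw [hm] at v
  rw [r, v, e2, hz] at this
  have p1 : 0 < D * ε ^ 2 := by positivity
  have p2 : 0 < ε * D ^ 2 := by positivity
  nlinarith

theorem zig2 {t : ℝ} {γ : ℝ → ℝ} (h : Adm γ) (hM : LexMax t γ) {z₂ z₃ ε D : ℝ} (hε : 0 < ε) (hD : 0 < D)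
    (h0 : 0 ≤ z₂ - D) (hz : z₃ = z₂ + D + ε) (h3 : z₃ + ε ≤ t)
    (k1 : ∀ s ∈ Icc (z₂ - D) z₂, γ s = γ z₂ + (s - z₂)) (k2 : ∀ s ∈ Icc z₂ z₃, γ s = γ z₂ - (s - z₂))
    (k3 : ∀ s ∈ Icc z₃ (z₃ + ε), γ s = γ z₃ + (s - z₃)) : False := by
  have r := roof h.cont hD.le k1 (fun s hs => k2 s ⟨hs.1, by linarith [hs.2]⟩)
  have e2 : γ z₃ = γ z₂ - (z₃ - z₂) := k2 z₃ ⟨by linarith, le_rfl⟩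
  have v := valley h.cont hε.le (fun s hs => by
    rw [e2, k2 s ⟨by linarith [hs.1], hs.2⟩]; ring) k3
  have a1 : γ (z₂ - D) = γ z₂ - D := by rw [k1 _ ⟨le_rfl, by linarith⟩]; ring
  have a2 : γ (z₂ + D) = γ z₂ - D := by rw [k2 _ ⟨by linarith, by linarith⟩]; ring
  have a3 : γ (z₃ + ε) = γ z₂ - D := by rw [k3 _ ⟨by linarith, by linarith⟩, e2, hz]; ring
  have hm : z₃ - ε = z₂ + D := by linarith
  have := swap_le h hM h0 (by linarith : z₂ - D ≤ z₂ + D) (by linarith) h3 (a1.trans a2.symm) (a3.trans a2.symm)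
  rw [hm] at v
  rw [r, v, e2, hz] at this
  have p1 : 0 < D * ε ^ 2 := by positivity
  have p2 : 0 < ε * D ^ 2 := by positivity
  nlinarith

section
variable {t a b l : ℝ} {γ : ℝ → ℝ}

theorem sign_const {f : ℝ → ℝ} (hf : Continuous f) {x y : ℝ} (h : ∀ s ∈ Ioo x y, f s ≠ 0) :
    (∀ s ∈ Ioo x y, 0 < f s) ∨ (∀ s ∈ Ioo x y, f s < 0) := by
  by_contra hc
  push Not at hc
  obtain ⟨⟨u, hu, fu⟩, v, hv, fv⟩ := hc
  have := isPreconnected_Ioo.intermediate_value hu hv hf.continuousOn ⟨fu, fv⟩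
  obtain ⟨s, hs, e⟩ := this
  exact h s hs e

theorem Xt.gap_deriv (E : Xt t a b l γ) {x y : ℝ} (hx : 0 ≤ x) (hy : y ≤ t)
    (h : ∀ s ∈ Ioo x y, psi t a b l γ s ≠ 0) :
    ∃ c ∈ ({-1, 1} : Set ℝ), ∀ s ∈ Ioo x y, deriv γ s = c := by
  rcases sign_const E.psi_cont h with h | h
  · exact ⟨1, by simp, fun s hs => (Ex.der_pos E (hx.trans_lt hs.1) (hs.2.trans_le hy) (h s hs)).deriv⟩
  · exact ⟨-1, by simp, fun s hs => (Ex.der_neg E (hx.trans_lt hs.1) (hs.2.trans_le hy) (h s hs)).deriv⟩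

theorem csc_of_no_zero (E : Xt t a b l γ) (h : ∀ s ∈ Ioo 0 t, psi t a b l γ s ≠ 0) :
    IsCSCControl 0 t (deriv γ) := by
  obtain ⟨c, hc, hd⟩ := E.gap_deriv le_rfl le_rfl h
  exact ⟨t, t, E.ht.le, le_rfl, le_rfl, c, hc, c, hc, hd, by simp, by simp⟩

theorem csc_of_one_zero (E : Xt t a b l γ) {z : ℝ} (hz : z ∈ Ioo 0 t)
    (h : ∀ s ∈ Ioo 0 t, psi t a b l γ s = 0 → s = z) :
    IsCSCControl 0 t (deriv γ) := by
  obtain ⟨c, hc, hd⟩ := E.gap_deriv le_rfl hz.2.le (fun s hs e => hs.2.ne (h s ⟨hs.1, hs.2.trans hz.2⟩ e))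
  obtain ⟨c', hc', hd'⟩ := E.gap_deriv hz.1.le le_rfl (fun s hs e => hs.1.ne' (h s ⟨hz.1.trans hs.1, hs.2⟩ e))
  exact ⟨z, z, hz.1.le, le_rfl, hz.2.le, c, hc, c', hc', hd, by simp, hd'⟩

/-- last zero before / first zero after a nonzero point -/
theorem exists_gap {f : ℝ → ℝ} (hf : Continuous f) {x y s : ℝ} (hx : f x = 0) (hy : f y = 0)
    (hs : s ∈ Icc x y) (h : f s ≠ 0) :
    ∃ α β, x ≤ α ∧ α < s ∧ s < β ∧ β ≤ y ∧ f α = 0 ∧ f β = 0 ∧ ∀ u ∈ Ioo α β, f u ≠ 0 := by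
  have cl : IsClosed {u | f u = 0} := isClosed_eq hf continuous_const
  obtain ⟨α, ha, ha'⟩ := (isCompact_Icc.inter_right cl : IsCompact (Icc x s ∩ {u | f u = 0})).exists_isGreatest
    ⟨x, ⟨le_rfl, hs.1⟩, hx⟩
  obtain ⟨β, hb, hb'⟩ := (isCompact_Icc.inter_right cl : IsCompact (Icc s y ∩ {u | f u = 0})).exists_isLeast
    ⟨y, ⟨hs.2, le_rfl⟩, hy⟩
  have za : f α = 0 := ha.2
  have zb : f β = 0 := hb.2
  have h1 : α < s := lt_of_le_of_ne ha.1.2 (fun e => h (e ▸ za))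
  have h2 : s < β := lt_of_le_of_ne hb.1.1 (fun e => h (e ▸ zb))
  refine ⟨α, β, ha.1.1, h1, h2, hb.1.2, za, zb, fun u hu e => ?_⟩
  rcases le_total u s with h3 | h3
  · exact absurd (ha' ⟨⟨ha.1.1.trans hu.1.le, h3⟩, e⟩) (not_le.2 hu.1)
  · exact absurd (hb' ⟨⟨h3, hu.2.le.trans hb.1.2⟩, e⟩) (not_le.2 hu.2)

end


section
variable {t a b l : ℝ} {γ : ℝ → ℝ}

theorem tan_pos (E : Xt t a b l γ) (hM : LexMax t γ)
    (hcos : ∀ z ∈ Icc 0 t, ∀ z' ∈ Icc 0 t, psi t a b l γ z = 0 → psi t a b l γ z' = 0 → Real.cos (γ z - γ z') = 1)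
    {z₁ z₂ s : ℝ} (h0 : 0 ≤ z₁) (h2 : z₂ ≤ t) (e1 : psi t a b l γ z₁ = 0) (e2 : psi t a b l γ z₂ = 0)
    (hs : s ∈ Icc z₁ z₂) (hp : 0 < psi t a b l γ s) : ∀ u ∈ Icc 0 s, γ u = u := by
  obtain ⟨α, β, k1, k2, k3, k4, k5, k6, k7⟩ := exists_gap E.psi_cont e1 e2 hs hp.ne'
  have hpos : ∀ u ∈ Ioo α β, 0 < psi t a b l γ u := by
    rcases sign_const E.psi_cont k7 with h | h
    · exact h
    · exact absurd (h s ⟨k2, k3⟩) (not_lt.2 hp.le)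
  have sl := Ex.slope_pos E (h0.trans k1) (k4.trans h2) hpos
  have hβ : γ β - γ α = β - α := by rw [sl β ⟨by linarith, le_rfl⟩]; ring
  have hc := hcos β ⟨by linarith, by linarith⟩ α ⟨by linarith, by linarith⟩ k6 k5
  have hper : α + 2 * Real.pi ≤ β := by
    by_contra hlt
    push Not at hlt
    rw [Real.cos_eq_one_iff_of_lt_of_lt (by linarith [Real.pi_pos]) (by linarith)] at hc
    linarith
  obtain ⟨η, m1, m2, m3⟩ := circ_start E.adm (h0.trans k1) (by linarith : α + 2 * Real.pi ≤ t)
    (fun u hu => sl u ⟨hu.1, hu.2.trans hper⟩)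
  have := (hM η m1 m2).1
  have hα : α - γ α ≤ 0 := by
    by_contra hlt
    push Not at hlt
    have : 0 < 2 * Real.pi * (α - γ α) := by have := Real.pi_pos; positivity
    linarith
  have g0 := E.adm.2
  intro u hu
  have u1 := E.adm.up hu.1
  rcases le_total u α with h | h
  · have := E.adm.up h
    linarith
  · have := sl u ⟨h, by linarith [hu.2]⟩
    linarith

theorem tan_neg (E : Xt t a b l γ) (hM : LexMax t γ)
    (hcos : ∀ z ∈ Icc 0 t, ∀ z' ∈ Icc 0 t, psi t a b l γ z = 0 → psi t a b l γ z' = 0 → Real.cos (γ z - γ z') = 1)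
    {z₁ z₂ s : ℝ} (h0 : 0 ≤ z₁) (h2 : z₂ ≤ t) (e1 : psi t a b l γ z₁ = 0) (e2 : psi t a b l γ z₂ = 0)
    (hs : s ∈ Icc z₁ z₂) (hp : psi t a b l γ s < 0) : ∀ u ∈ Icc s t, γ u = (γ t + t) - u := by
  obtain ⟨α, β, k1, k2, k3, k4, k5, k6, k7⟩ := exists_gap E.psi_cont e1 e2 hs hp.ne
  have hpos : ∀ u ∈ Ioo α β, psi t a b l γ u < 0 := by
    rcases sign_const E.psi_cont k7 with h | h
    · exact absurd (h s ⟨k2, k3⟩) (not_lt.2 hp.le)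
    · exact h
  have sl := Ex.slope_neg E (h0.trans k1) (k4.trans h2) hpos
  have hβ : γ α - γ β = β - α := by rw [sl β ⟨by linarith, le_rfl⟩]; ring
  have hc := hcos α ⟨by linarith, by linarith⟩ β ⟨by linarith, by linarith⟩ k5 k6
  have hper : α + 2 * Real.pi ≤ β := by
    by_contra hlt
    push Not at hlt
    rw [Real.cos_eq_one_iff_of_lt_of_lt (by linarith [Real.pi_pos]) (by linarith)] at hc
    linarith
  have hpi := Real.pi_pos
  obtain ⟨η, m1, m2, m3⟩ := circ_end E.adm (h0.trans k1) (by linarith : α + 2 * Real.pi ≤ t)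
    (fun u hu => sl u ⟨hu.1, hu.2.trans hper⟩)
  have := (hM η m1 m2).1
  have hα : ((γ t - γ (α + 2 * Real.pi)) + (t - (α + 2 * Real.pi))) ≤ 0 := by
    by_contra hlt
    push Not at hlt
    have : 0 < 2 * Real.pi * ((γ t - γ (α + 2 * Real.pi)) + (t - (α + 2 * Real.pi))) := by positivity
    linarith
  intro u hu
  have u1 := E.adm.down hu.2
  rcases le_total (α + 2 * Real.pi) u with h | h
  · have := E.adm.down h
    linarith
  · have := sl u ⟨by linarith [hu.1], by linarith [hu.2]⟩
    have := sl (α + 2 * Real.pi) ⟨by linarith [hu.1], by linarith [hu.2]⟩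
    linarith

theorem tan_case (E : Xt t a b l γ) (hM : LexMax t γ)
    (hcos : ∀ z ∈ Icc 0 t, ∀ z' ∈ Icc 0 t, psi t a b l γ z = 0 → psi t a b l γ z' = 0 → Real.cos (γ z - γ z') = 1)
    (hz : ∃ z ∈ Icc 0 t, psi t a b l γ z = 0) : IsCSCControl 0 t (deriv γ) := by
  have cl : IsClosed {u | psi t a b l γ u = 0} := isClosed_eq E.psi_cont continuous_const
  have cp : IsCompact (Icc 0 t ∩ {u | psi t a b l γ u = 0}) := isCompact_Icc.inter_right cl
  obtain ⟨z, hz, hz'⟩ := hz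
  obtain ⟨z₁, ha, ha'⟩ := cp.exists_isLeast ⟨z, hz, hz'⟩
  obtain ⟨z₂, hb, hb'⟩ := cp.exists_isGreatest ⟨z, hz, hz'⟩
  have e1 : psi t a b l γ z₁ = 0 := ha.2
  have e2 : psi t a b l γ z₂ = 0 := hb.2
  have z12 : z₁ ≤ z₂ := ha' hb
  have hpos := @tan_pos t a b l γ E hM hcos z₁ z₂
  have hneg := @tan_neg t a b l γ E hM hcos z₁ z₂
  set A := {s ∈ Icc z₁ z₂ | 0 < psi t a b l γ s} with hA
  set B := {s ∈ Icc z₁ z₂ | psi t a b l γ s < 0} with hB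
  have H1 : ∃ t₁, z₁ ≤ t₁ ∧ t₁ ≤ z₂ ∧ (∃ c ∈ ({-1, 1} : Set ℝ), ∀ u ∈ Ioo 0 t₁, deriv γ u = c) ∧
      (∀ s ∈ Icc z₁ z₂, t₁ < s → psi t a b l γ s ≤ 0) ∧ (t₁ = z₁ ∨ ∀ u < t₁, ∃ s ∈ A, u < s) := by
    by_cases hne : A.Nonempty
    · have bd : BddAbove A := ⟨z₂, fun s hs => hs.1.2⟩
      have ap : ∀ u < sSup A, ∃ s ∈ A, u < s := fun u hu => exists_lt_of_lt_csSup hne hu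
      refine ⟨sSup A, ?_, csSup_le hne fun s hs => hs.1.2, ⟨1, by simp, fun u hu => ?_⟩, fun s hs h => ?_, Or.inr ap⟩
      · obtain ⟨s, hs⟩ := hne
        exact hs.1.1.trans (le_csSup bd hs)
      · obtain ⟨s, hs, hus⟩ := ap u hu.2
        have := hpos ha.1.1 hb.1.2 e1 e2 hs.1 hs.2
        have ev : γ =ᶠ[nhds u] fun u => u := by
          filter_upwards [Ioo_mem_nhds hu.1 hus] with v hv
          exact this v ⟨hv.1.le, hv.2.le⟩
        rw [ev.deriv_eq]; simp
      · by_contra hc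
        exact absurd (le_csSup bd (show s ∈ A from ⟨hs, not_le.1 hc⟩)) (not_le.2 h)
    · refine ⟨z₁, le_rfl, z12, E.gap_deriv le_rfl ha.1.2 (fun s hs e => ?_), fun s hs h => ?_, Or.inl rfl⟩
      · exact absurd (ha' ⟨⟨hs.1.le, hs.2.le.trans ha.1.2⟩, e⟩) (not_le.2 hs.2)
      · by_contra hc
        exact hne ⟨s, hs, not_le.1 hc⟩
  have H2 : ∃ t₂, z₁ ≤ t₂ ∧ t₂ ≤ z₂ ∧ (∃ c ∈ ({-1, 1} : Set ℝ), ∀ u ∈ Ioo t₂ t, deriv γ u = c) ∧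
      (∀ s ∈ Icc z₁ z₂, s < t₂ → 0 ≤ psi t a b l γ s) ∧ (t₂ = z₂ ∨ ∀ u, t₂ < u → ∃ s ∈ B, s < u) := by
    by_cases hne : B.Nonempty
    · have bd : BddBelow B := ⟨z₁, fun s hs => hs.1.1⟩
      have ap : ∀ u, sInf B < u → ∃ s ∈ B, s < u := fun u hu => exists_lt_of_csInf_lt hne hu
      refine ⟨sInf B, le_csInf hne fun s hs => hs.1.1, ?_, ⟨-1, by simp, fun u hu => ?_⟩, fun s hs h => ?_, Or.inr ap⟩
      · obtain ⟨s, hs⟩ := hne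
        exact (csInf_le bd hs).trans hs.1.2
      · obtain ⟨s, hs, hus⟩ := ap u hu.1
        have := hneg ha.1.1 hb.1.2 e1 e2 hs.1 hs.2
        have ev : γ =ᶠ[nhds u] fun u => (γ t + t) - u := by
          filter_upwards [Ioo_mem_nhds hus hu.2] with v hv
          exact this v ⟨hv.1.le, hv.2.le⟩
        rw [ev.deriv_eq]; simp [deriv_const_sub]
      · by_contra hc
        exact absurd (csInf_le bd (show s ∈ B from ⟨hs, not_le.1 hc⟩)) (not_le.2 h)
    · refine ⟨z₂, z12, le_rfl, E.gap_deriv hb.1.1 le_rfl (fun s hs e => ?_), fun s hs h => ?_, Or.inl rfl⟩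
      · exact absurd (hb' ⟨⟨hb.1.1.trans hs.1.le, hs.2.le⟩, e⟩) (not_le.2 hs.1)
      · by_contra hc
        exact hne ⟨s, hs, not_le.1 hc⟩
  obtain ⟨t₁, p1, p2, ⟨c, hc, p3⟩, p4, p5⟩ := H1
  obtain ⟨t₂, q1, q2, ⟨d, hd, q3⟩, q4, q5⟩ := H2
  have t12 : t₁ ≤ t₂ := by
    rcases p5 with rfl | p5
    · exact q1
    rcases q5 with rfl | q5
    · exact p2
    by_contra hlt
    push Not at hlt
    obtain ⟨s, hs, h1⟩ := p5 _ hlt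
    obtain ⟨s', hs', h2⟩ := q5 _ h1
    have f1 := hpos ha.1.1 hb.1.2 e1 e2 hs.1 hs.2
    have f2 := hneg ha.1.1 hb.1.2 e1 e2 hs'.1 hs'.2
    have i1 : s' ∈ Icc z₁ z₂ := hs'.1
    have i2 : s ∈ Icc z₁ z₂ := hs.1
    have z0 : 0 ≤ z₁ := ha.1.1
    have zt : z₂ ≤ t := hb.1.2
    have g1 := f1 s' ⟨z0.trans i1.1, h2.le⟩
    have g2 := f1 s ⟨z0.trans i2.1, le_rfl⟩
    have g3 := f2 s' ⟨le_rfl, i1.2.trans zt⟩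
    have g4 := f2 s ⟨h2.le, i2.2.trans zt⟩
    linarith
  refine ⟨t₁, t₂, ha.1.1.trans p1, t12, q2.trans hb.1.2, c, hc, d, hd, p3, fun s hs => ?_, q3⟩
  have hz0 : ∀ u ∈ Ioo t₁ t₂, psi t a b l γ u = 0 ∧ u ∈ Icc 0 t := fun u hu => by
    have hu' : u ∈ Icc z₁ z₂ := ⟨p1.trans hu.1.le, hu.2.le.trans q2⟩
    exact ⟨le_antisymm (p4 u hu' hu.1) (q4 u hu' hu.2), ha.1.1.trans hu'.1, hu'.2.trans hb.1.2⟩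
  have ev : γ =ᶠ[nhds s] fun _ => γ s := by
    filter_upwards [Ioo_mem_nhds hs.1 hs.2, Metric.ball_mem_nhds s (ε := 2 * Real.pi) (by have := Real.pi_pos; positivity)] with u hu hu2
    have := hcos u (hz0 u hu).2 s (hz0 s hs).2 (hz0 u hu).1 (hz0 s hs).1
    rw [mem_ball, Real.dist_eq] at hu2
    have l1 := abs_lt.1 ((E.adm.lip u s).trans_lt hu2)
    rw [Real.cos_eq_one_iff_of_lt_of_lt l1.1 l1.2] at this
    linarith
  rw [ev.deriv_eq]; simp

end


section
variable {t a b l : ℝ} {γ : ℝ → ℝ}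

theorem loc_neg (E : Xt t a b l γ) {z : ℝ} (hz : z ∈ Ioo 0 t) (h0 : psi t a b l γ z = 0) (hw : ww a b γ z < 0) :
    ∃ ε > 0, 0 ≤ z - ε ∧ z + ε ≤ t ∧ (∀ s ∈ Ioo (z - ε) z, psi t a b l γ s < 0) ∧
      (∀ s ∈ Ioo z (z + ε), 0 < psi t a b l γ s) := by
  obtain ⟨ε, hε, h⟩ := Metric.eventually_nhds_iff.1 (sign_of_deriv (E.psi_deriv z) (by linarith) h0)
  refine ⟨min ε (min z (t - z)), lt_min hε (lt_min hz.1 (by linarith [hz.2])), ?_, ?_, fun s hs => ?_, fun s hs => ?_⟩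
  · have := (min_le_right ε (min z (t - z))).trans (min_le_left _ _)
    linarith
  · have := (min_le_right ε (min z (t - z))).trans (min_le_right _ _)
    linarith
  · have := min_le_left ε (min z (t - z))
    exact (h (by rw [Real.dist_eq, abs_lt]; constructor <;> linarith [hs.1, hs.2])).2 hs.2
  · have := min_le_left ε (min z (t - z))
    exact (h (by rw [Real.dist_eq, abs_lt]; constructor <;> linarith [hs.1, hs.2])).1 hs.1

theorem ww_neg (s : ℝ) : ww a (-b) (fun s => - γ s) s = - ww a b γ s := by
  simp [ww]; ring

theorem loc_pos (E : Xt t a b l γ) {z : ℝ} (hz : z ∈ Ioo 0 t) (h0 : psi t a b l γ z = 0) (hw : 0 < ww a b γ z) :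
    ∃ ε > 0, 0 ≤ z - ε ∧ z + ε ≤ t ∧ (∀ s ∈ Ioo (z - ε) z, 0 < psi t a b l γ s) ∧
      (∀ s ∈ Ioo z (z + ε), psi t a b l γ s < 0) := by
  obtain ⟨ε, h1, h2, h3, h4, h5⟩ := loc_neg E.neg hz (by rw [psi_neg, h0, neg_zero]) (by rw [ww_neg]; linarith)
  refine ⟨ε, h1, h2, h3, fun s hs => ?_, fun s hs => ?_⟩
  · have := h4 s hs; rw [psi_neg] at this; linarith
  · have := h5 s hs; rw [psi_neg] at this; linarith

theorem next_zero (E : Xt t a b l γ) {z z' : ℝ} (hz : z ∈ Ioo 0 t) (h0 : psi t a b l γ z = 0)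
    (hw : ww a b γ z ≠ 0) (hzz : z < z') (h0' : psi t a b l γ z' = 0) :
    ∃ n, z < n ∧ n ≤ z' ∧ psi t a b l γ n = 0 ∧ ∀ u ∈ Ioo z n, psi t a b l γ u ≠ 0 := by
  have : ∃ ε > 0, ∀ s ∈ Ioo z (z + ε), psi t a b l γ s ≠ 0 := by
    rcases lt_or_gt_of_ne hw with h | h
    · obtain ⟨ε, h1, -, -, -, h5⟩ := loc_neg E hz h0 h
      exact ⟨ε, h1, fun s hs => (h5 s hs).ne'⟩
    · obtain ⟨ε, h1, -, -, -, h5⟩ := loc_pos E hz h0 h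
      exact ⟨ε, h1, fun s hs => (h5 s hs).ne⟩
  obtain ⟨ε, hε, h⟩ := this
  set s := min (z + ε / 2) z' with hs
  have s1 : z < s := lt_min (by linarith) hzz
  have s2 : s < z + ε := (min_le_left _ _).trans_lt (by linarith)
  have s3 : s ≤ z' := min_le_right _ _
  obtain ⟨α, β, k1, k2, k3, k4, k5, k6, k7⟩ := exists_gap E.psi_cont h0 h0' ⟨s1.le, s3⟩ (h s ⟨s1, s2⟩)
  have hα : α = z := by
    by_contra hne
    exact h α ⟨lt_of_le_of_ne k1 (Ne.symm hne), k2.trans s2⟩ k5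
  rw [hα] at k7
  exact ⟨β, by linarith, k4, k6, k7⟩

/-- sign after a zero with `w < 0`, and sign of `w` at the end -/
theorem seg_pos (E : Xt t a b l γ) {z n : ℝ} (hz : z ∈ Ioo 0 t) (hn : n ∈ Ioo 0 t) (hzn : z < n)
    (h0 : psi t a b l γ z = 0) (h1 : psi t a b l γ n = 0) (hw : ww a b γ z < 0) (hwn : ww a b γ n ≠ 0)
    (h : ∀ u ∈ Ioo z n, psi t a b l γ u ≠ 0) :
    (∀ u ∈ Ioo z n, 0 < psi t a b l γ u) ∧ 0 < ww a b γ n := by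
  have hp : ∀ u ∈ Ioo z n, 0 < psi t a b l γ u := by
    rcases sign_const E.psi_cont h with h | h
    · exact h
    · obtain ⟨ε, k1, -, -, -, k5⟩ := loc_neg E hz h0 hw
      obtain ⟨u, u1, u2⟩ := exists_between (lt_min hzn (by linarith : z < z + ε))
      have := h u ⟨u1, u2.trans_le (min_le_left _ _)⟩
      have := k5 u ⟨u1, u2.trans_le (min_le_right _ _)⟩
      linarith
  refine ⟨hp, ?_⟩
  rcases lt_or_gt_of_ne hwn with h | h
  · obtain ⟨ε, k1, -, -, k4, -⟩ := loc_neg E hn h1 h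
    obtain ⟨u, u1, u2⟩ := exists_between (max_lt hzn (by linarith : n - ε < n))
    have := hp u ⟨(le_max_left _ _).trans_lt u1, u2⟩
    have := k4 u ⟨(le_max_right _ _).trans_lt u1, u2⟩
    linarith
  · exact h

theorem seg_neg (E : Xt t a b l γ) {z n : ℝ} (hz : z ∈ Ioo 0 t) (hn : n ∈ Ioo 0 t) (hzn : z < n)
    (h0 : psi t a b l γ z = 0) (h1 : psi t a b l γ n = 0) (hw : 0 < ww a b γ z) (hwn : ww a b γ n ≠ 0)
    (h : ∀ u ∈ Ioo z n, psi t a b l γ u ≠ 0) :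
    (∀ u ∈ Ioo z n, psi t a b l γ u < 0) ∧ ww a b γ n < 0 := by
  have := seg_pos E.neg hz hn hzn (by rw [psi_neg, h0, neg_zero]) (by rw [psi_neg, h1, neg_zero])
    (by rw [ww_neg]; linarith) (by rw [ww_neg]; simpa using hwn) (fun u hu => by rw [psi_neg]; simpa using h u hu)
  rw [ww_neg] at this
  refine ⟨fun u hu => ?_, by linarith [this.2]⟩
  have := this.1 u hu
  rw [psi_neg] at this
  linarith

theorem no_three (E : Xt t a b l γ) (hM : LexMax t γ)
    (hw : ∀ z ∈ Icc 0 t, psi t a b l γ z = 0 → ww a b γ z ≠ 0) {x y z : ℝ} (hx : 0 < x) (hxy : x < y)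
    (hyz : y < z) (hz : z < t) (ex : psi t a b l γ x = 0) (ey : psi t a b l γ y = 0)
    (ez : psi t a b l γ z = 0) : False := by
  have hxI : x ∈ Ioo 0 t := ⟨hx, by linarith⟩
  obtain ⟨n, n1, n2, n3, n4⟩ := next_zero E hxI ex (hw x ⟨hx.le, by linarith⟩ ex) hxy ey
  have hnI : n ∈ Ioo 0 t := ⟨by linarith, by linarith⟩
  have hwn := hw n ⟨by linarith, by linarith⟩ n3
  obtain ⟨m, m1, m2, m3, m4⟩ := next_zero E hnI n3 hwn (by linarith : n < z) ez
  have hmI : m ∈ Ioo 0 t := ⟨by linarith, by linarith⟩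
  have hwm := hw m ⟨by linarith, by linarith⟩ m3
  have hne : ∀ u v, u ∈ Icc 0 t → v ∈ Icc 0 t → psi t a b l γ u = 0 → γ u = γ v → psi t a b l γ v = 0 := by
    intro u v hu hv h e
    have h1 := E.H_const u hu
    have h2 := E.H_const v hv
    rw [h, abs_zero, e] at h1
    have : |psi t a b l γ v| = 0 := by linarith
    simpa using this
  rcases lt_or_gt_of_ne (hw x ⟨hx.le, by linarith⟩ ex) with hwx | hwx
  · obtain ⟨p1, q1⟩ := seg_pos E hxI hnI n1 ex n3 hwx hwn n4
    obtain ⟨p2, q2⟩ := seg_neg E hnI hmI m1 n3 m3 q1 hwm m4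
    obtain ⟨ε, k1, k2, k3, k4, k5⟩ := loc_neg E hmI m3 q2
    have s1 := Ex.slope_pos E hx.le hnI.2.le p1
    have s2 := Ex.slope_neg E hnI.1.le hmI.2.le p2
    have s3 := Ex.slope_pos E hmI.1.le k3 k5
    have en := s1 n ⟨n1.le, le_rfl⟩
    have hBA : m - n ≤ n - x := by
      by_contra hc
      push Not at hc
      refine m4 (n + (n - x)) ⟨by linarith, by linarith⟩ (hne x _ ⟨hx.le, by linarith⟩ ⟨by linarith, by linarith⟩ ex ?_)
      rw [s2 (n + (n - x)) ⟨by linarith, by linarith⟩]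
      linarith
    set e := min ε (m - n) / 2 with he
    have e1 : 0 < e := by have := lt_min k1 (sub_pos.2 m1); linarith
    have e2 : e < ε := by have := min_le_left ε (m - n); linarith
    have e3 : e < m - n := by have := min_le_right ε (m - n); linarith
    refine zig2 E.adm hM (z₂ := n) (z₃ := m) (D := m - n - e) e1 (by linarith) (by linarith) (by ring) (by linarith)
      (fun s hs => ?_) s2 (fun s hs => s3 s ⟨hs.1, by linarith [hs.2]⟩)
    rw [s1 s ⟨by linarith [hs.1], hs.2⟩]; linarith
  · obtain ⟨p1, q1⟩ := seg_neg E hxI hnI n1 ex n3 hwx hwn n4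
    obtain ⟨p2, q2⟩ := seg_pos E hnI hmI m1 n3 m3 q1 hwm m4
    obtain ⟨ε, k1, k2, k3, k4, k5⟩ := loc_pos E hxI ex hwx
    have s1 := Ex.slope_neg E hx.le hnI.2.le p1
    have s2 := Ex.slope_pos E hnI.1.le hmI.2.le p2
    have s0 := Ex.slope_pos E k2 hxI.2.le k4
    have en := s1 n ⟨n1.le, le_rfl⟩
    have em := s2 m ⟨m1.le, le_rfl⟩
    have hBA : n - x ≤ m - n := by
      by_contra hc
      push Not at hc
      refine n4 (n - (m - n)) ⟨by linarith, by linarith⟩ (hne m _ ⟨hmI.1.le, hmI.2.le⟩ ⟨by linarith, by linarith⟩ m3 ?_)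
      rw [s1 (n - (m - n)) ⟨by linarith, by linarith⟩]
      linarith
    set e := min ε (n - x) / 2 with he
    have e1 : 0 < e := by have := lt_min k1 (sub_pos.2 n1); linarith
    have e2 : e < ε := by have := min_le_left ε (n - x); linarith
    have e3 : e < n - x := by have := min_le_right ε (n - x); linarith
    refine zig1 E.adm hM (z₁ := x) (z₂ := n) (D := n - x - e) e1 (by linarith) (by linarith) (by ring) (by linarith)
      (fun s hs => ?_) s1 (fun s hs => s2 s ⟨hs.1, by linarith [hs.2]⟩)
    have := s0 x ⟨by linarith, le_rfl⟩
    rw [s0 s ⟨by linarith [hs.1], hs.2⟩]; linarith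

theorem ccc_of_two (E : Xt t a b l γ)
    (hw : ∀ z ∈ Icc 0 t, psi t a b l γ z = 0 → ww a b γ z ≠ 0) {x y : ℝ} (hx : 0 < x) (hxy : x < y)
    (hy : y < t) (ex : psi t a b l γ x = 0) (ey : psi t a b l γ y = 0)
    (h : ∀ s ∈ Ioo 0 t, psi t a b l γ s = 0 → s = x ∨ s = y) : IsCCCControl 0 t (deriv γ) := by
  have hxI : x ∈ Ioo 0 t := ⟨hx, by linarith⟩
  have hyI : y ∈ Ioo 0 t := ⟨by linarith, hy⟩
  have hwx := hw x ⟨hx.le, by linarith⟩ ex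
  have hwy := hw y ⟨by linarith, by linarith⟩ ey
  have n1 : ∀ s ∈ Ioo 0 x, psi t a b l γ s ≠ 0 := fun s hs e => by
    rcases h s ⟨hs.1, by linarith [hs.2]⟩ e with h | h <;> linarith [hs.2]
  have n2 : ∀ s ∈ Ioo x y, psi t a b l γ s ≠ 0 := fun s hs e => by
    rcases h s ⟨by linarith [hs.1], by linarith [hs.2]⟩ e with h | h <;> linarith [hs.2, hs.1]
  have n3 : ∀ s ∈ Ioo y t, psi t a b l γ s ≠ 0 := fun s hs e => by
    rcases h s ⟨by linarith [hs.1], by linarith [hs.2]⟩ e with h | h <;> linarith [hs.2, hs.1]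
  rcases lt_or_gt_of_ne hwx with hwx | hwx
  · obtain ⟨p2, q⟩ := seg_pos E hxI hyI hxy ex ey hwx hwy n2
    have p1 : ∀ s ∈ Ioo 0 x, psi t a b l γ s < 0 := by
      rcases sign_const E.psi_cont n1 with h | h
      · obtain ⟨ε, k1, k2, -, k4, -⟩ := loc_neg E hxI ex hwx
        have := h (x - ε / 2) ⟨by linarith, by linarith⟩
        have := k4 (x - ε / 2) ⟨by linarith, by linarith⟩
        linarith
      · exact h
    have p3 : ∀ s ∈ Ioo y t, psi t a b l γ s < 0 := by
      rcases sign_const E.psi_cont n3 with h | h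
      · obtain ⟨ε, k1, -, k3, -, k5⟩ := loc_pos E hyI ey q
        have := h (y + ε / 2) ⟨by linarith, by linarith⟩
        have := k5 (y + ε / 2) ⟨by linarith, by linarith⟩
        linarith
      · exact h
    refine ⟨x, y, hx.le, hxy.le, hy.le, -1, by simp, fun s hs => ?_, fun s hs => ?_, fun s hs => ?_⟩
    · exact (Ex.der_neg E hs.1 (by linarith [hs.2]) (p1 s hs)).deriv
    · rw [neg_neg]
      exact (Ex.der_pos E (by linarith [hs.1]) (by linarith [hs.2]) (p2 s hs)).deriv
    · exact (Ex.der_neg E (by linarith [hs.1]) hs.2 (p3 s hs)).deriv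
  · obtain ⟨p2, q⟩ := seg_neg E hxI hyI hxy ex ey hwx hwy n2
    have p1 : ∀ s ∈ Ioo 0 x, 0 < psi t a b l γ s := by
      rcases sign_const E.psi_cont n1 with h | h
      · exact h
      · obtain ⟨ε, k1, k2, -, k4, -⟩ := loc_pos E hxI ex hwx
        have := h (x - ε / 2) ⟨by linarith, by linarith⟩
        have := k4 (x - ε / 2) ⟨by linarith, by linarith⟩
        linarith
    have p3 : ∀ s ∈ Ioo y t, 0 < psi t a b l γ s := by
      rcases sign_const E.psi_cont n3 with h | h
      · exact h
      · obtain ⟨ε, k1, -, k3, -, k5⟩ := loc_neg E hyI ey q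
        have := h (y + ε / 2) ⟨by linarith, by linarith⟩
        have := k5 (y + ε / 2) ⟨by linarith, by linarith⟩
        linarith
    refine ⟨x, y, hx.le, hxy.le, hy.le, 1, by simp, fun s hs => ?_, fun s hs => ?_, fun s hs => ?_⟩
    · exact (Ex.der_pos E hs.1 (by linarith [hs.2]) (p1 s hs)).deriv
    · exact (Ex.der_neg E (by linarith [hs.1]) (by linarith [hs.2]) (p2 s hs)).deriv
    · exact (Ex.der_pos E (by linarith [hs.1]) hs.2 (p3 s hs)).deriv

theorem nontan_case (E : Xt t a b l γ) (hM : LexMax t γ)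
    (hw : ∀ z ∈ Icc 0 t, psi t a b l γ z = 0 → ww a b γ z ≠ 0) :
    IsCSCControl 0 t (deriv γ) ∨ IsCCCControl 0 t (deriv γ) := by
  by_cases h1 : ∃ x ∈ Ioo 0 t, psi t a b l γ x = 0
  swap
  · push Not at h1
    exact Or.inl (csc_of_no_zero E h1)
  by_cases h2 : ∃ x y, 0 < x ∧ x < y ∧ y < t ∧ psi t a b l γ x = 0 ∧ psi t a b l γ y = 0
  · obtain ⟨x, y, hx, hxy, hy, ex, ey⟩ := h2
    refine Or.inr (ccc_of_two E hw hx hxy hy ex ey fun s hs e => ?_)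
    rcases lt_trichotomy s x with k | k | k
    · exact (no_three E hM hw hs.1 k hxy hy e ex ey).elim
    · exact Or.inl k
    rcases lt_trichotomy s y with k' | k' | k'
    · exact (no_three E hM hw hx k k' hy ex e ey).elim
    · exact Or.inr k'
    · exact (no_three E hM hw hx hxy k' hs.2 ex ey e).elim
  · obtain ⟨x, hx, ex⟩ := h1
    refine Or.inl (csc_of_one_zero E hx fun s hs e => ?_)
    by_contra hne
    rcases lt_or_gt_of_ne hne with k | k
    · exact h2 ⟨s, x, hs.1, k, hx.2, e, ex⟩
    · exact h2 ⟨x, s, hx.1, k, hs.2, ex, e⟩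

theorem final_case (E : Xt t a b l γ) (hM : LexMax t γ) (hne : a ≠ 0 ∨ b ≠ 0 ∨ l ≠ 0) :
    IsCSCControl 0 t (deriv γ) ∨ IsCCCControl 0 t (deriv γ) := by
  by_cases hw : ∀ z ∈ Icc 0 t, psi t a b l γ z = 0 → ww a b γ z ≠ 0
  · exact nontan_case E hM hw
  push Not at hw
  obtain ⟨z, hz, ez, wz⟩ := hw
  left
  refine tan_case E hM ?_ ⟨z, hz, ez⟩
  have hρ : a ^ 2 + b ^ 2 ≠ 0 := by
    intro h
    have ha : a = 0 := by nlinarith [sq_nonneg a, sq_nonneg b]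
    have hb : b = 0 := by nlinarith [sq_nonneg a, sq_nonneg b]
    subst ha hb
    have : psi t 0 0 l γ z = l := by
      simp [psi, Psi, ww]
    rcases hne with h | h | h
    · exact h rfl
    · exact h rfl
    · exact h (by rw [← this, ez])
  have idn : ∀ s, ww a b γ s ^ 2 + PP a b (γ s) ^ 2 = a ^ 2 + b ^ 2 := by
    intro s
    simp only [ww, PP]
    linear_combination (a ^ 2 + b ^ 2) * Real.sin_sq_add_cos_sq (γ s)
  have hH : ∀ u ∈ Icc 0 t, psi t a b l γ u = 0 → PP a b (γ u) = PP a b (γ z) := by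
    intro u hu eu
    have h1 := E.H_const u hu
    have h2 := E.H_const z hz
    rw [eu] at h1
    rw [ez] at h2
    linarith
  have hW : ∀ u ∈ Icc 0 t, psi t a b l γ u = 0 → ww a b γ u = 0 := by
    intro u hu eu
    have h1 := idn u
    have h2 := idn z
    rw [hH u hu eu] at h1
    rw [wz] at h2
    have : ww a b γ u ^ 2 = 0 := by linarith
    simpa using this
  intro u hu v hv eu ev
  have pu := hH u hu eu
  have pv := hH v hv ev
  have wu := hW u hu eu
  have wv := hW v hv ev
  have iz := idn z
  rw [wz] at iz
  set H := PP a b (γ z) with hHd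
  have hab : ∀ s, PP a b (γ s) * Real.cos (γ s) - ww a b γ s * Real.sin (γ s) = a ∧
      PP a b (γ s) * Real.sin (γ s) + ww a b γ s * Real.cos (γ s) = b := by
    intro s
    simp only [ww, PP]
    constructor
    · linear_combination a * Real.sin_sq_add_cos_sq (γ s)
    · linear_combination b * Real.sin_sq_add_cos_sq (γ s)
  have au := hab u
  have av := hab v
  rw [pu, wu] at au
  rw [pv, wv] at av
  have : (a ^ 2 + b ^ 2) * Real.cos (γ u - γ v) = (a ^ 2 + b ^ 2) * 1 := by
    rw [Real.cos_sub, ← iz]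
    have k1 : H * Real.cos (γ u) = a := by linarith [au.1]
    have k2 : H * Real.sin (γ u) = b := by linarith [au.2]
    have k3 : H * Real.cos (γ v) = a := by linarith [av.1]
    have k4 : H * Real.sin (γ v) = b := by linarith [av.2]
    calc _ = (H * Real.cos (γ u)) * (H * Real.cos (γ v)) + (H * Real.sin (γ u)) * (H * Real.sin (γ v)) := by ring
      _ = a ^ 2 + b ^ 2 := by rw [k1, k2, k3, k4]; ring
      _ = _ := by rw [← iz]; ring
  exact mul_left_cancel₀ hρ this

end

theorem main_thm
    (t : ℝ) (ht : 0 < t) (q : ℝ × ℝ × ℝ) (hq : q ∈ frontier (DubinsReach t)) :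
    ∃ χ u, IsDubinsTraj 0 t (0, 0, 0) χ u ∧
      (IsCSCControl 0 t u ∨ IsCCCControl 0 t u) ∧ χ t = q := by
  have hs : DubinsReach t = Fend t '' {γ | Adm γ} := by
    ext p
    constructor
    · intro hp
      obtain ⟨γ, h1, h2⟩ := exists_adm_of_mem ht hp
      exact ⟨γ, h1, h2⟩
    · rintro ⟨γ, h1, rfl⟩
      exact mem_reach_of_adm h1 t
  rw [hs, frontier, (Fend_closed ht).closure_eq] at hq
  obtain ⟨γ, h1, h2, h3⟩ := exists_lexmax ht hq.1
  have hM : LexMax t γ := fun η hη e => h3 η hη (e.trans h2)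
  obtain ⟨a, b, l, hne, ho⟩ := pmp ht h1 (by rw [h2]; exact hq.2)
  exact ⟨fun s => Fend s γ, deriv γ, traj_of_adm h1 t, final_case (xt_of ht h1 ho) hM hne, h2⟩

/-- **Proposition 1.** Every boundary point of the Dubins reachable set
at time `t > 0` is reached by a Dubins trajectory of class CSC or CCC (with possibly
degenerate subintervals, which includes all subsegments of such curves). -/
theorem dubins_boundary_reached_by_CSC_or_CCC
    (t : ℝ) (ht : 0 < t) (q : ℝ × ℝ × ℝ) (hq : q ∈ frontier (DubinsReach t)) :
    ∃ χ u, IsDubinsTraj 0 t (0, 0, 0) χ u ∧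
      (IsCSCControl 0 t u ∨ IsCCCControl 0 t u) ∧ χ t = q := by
  exact main_thm t ht q hq
end
end
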